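/- Fix τ > 0, δ ∈ (0, τ/10), and ν ∈ (0, δ/10). Let d = d(N) be integers with N^τ ≤ d ≤ N/2 and dN even, let z = z(N) ∈ D_δ, and let φ = φ(N) ∈ [N^{−1}, N^ν] be deterministic. Assume that for every ε, D > 0 there is N₀ such that for all N ≥ N₀, ℙ( max_{i,j} |G_{ij}(z) − δ_{ij} m(z)| ≥ N^ε φ ) ≤ N^{−D}. Then for every ε, D > 0 there is N₀ such that for all N ≥ N₀, ℙ( max_{i,j} |δ_{ij} + z G_{ij}(z) + Ḡ(z) G_{ij}(z)| ≥ N^ε 𝔈̃ ) ≤ N^{−D}, where 𝔈̃ := (1+φ)³ · ( (φ + Im m(z))/(Nη) + 1/d )^{1/2}. -/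

import Mathlib

open MeasureTheory Filter Matrix
open scoped ENNReal NNReal

noncomputable section

/-- `A` is the adjacency matrix of a `d`-regular graph on `N` vertices:
a symmetric `{0,1}`-matrix with zero diagonal and all row sums equal to `d`. -/
def IsAdjMat (N d : ℕ) (A : Matrix (Fin N) (Fin N) ℝ) : Prop :=
  A.IsSymm ∧ (∀ i, A i i = 0) ∧ (∀ i j, A i j = 0 ∨ A i j = 1) ∧ ∀ i, ∑ j, A i j = d

/-- probability of an event under the uniform measure on `d`-regular graphs on `N` vertices. -/
def PrReg (N d : ℕ) (E : Matrix (Fin N) (Fin N) ℝ → Prop) : ℝ :=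
  (Nat.card {A : Matrix (Fin N) (Fin N) ℝ // IsAdjMat N d A ∧ E A} : ℝ) /
    (Nat.card {A : Matrix (Fin N) (Fin N) ℝ // IsAdjMat N d A} : ℝ)

/-- expectation of `F` under the uniform measure on `d`-regular graphs on `N` vertices. -/
def Ereg (N d : ℕ) (F : Matrix (Fin N) (Fin N) ℝ → ℝ) : ℝ :=
  (∑ᶠ A : {A : Matrix (Fin N) (Fin N) ℝ // IsAdjMat N d A}, F A.1) /
    (Nat.card {A : Matrix (Fin N) (Fin N) ℝ // IsAdjMat N d A} : ℝ)

/-- the `k`-th largest eigenvalue (`1`-based indexing) of a symmetric matrix. -/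
def eigval {N : ℕ} (A : Matrix (Fin N) (Fin N) ℝ) (k : ℕ) : ℝ :=
  if hA : A.IsHermitian then
    if h : k - 1 < N then
      hA.eigenvalues (Tuple.sort hA.eigenvalues (Fin.rev ⟨k - 1, h⟩))
    else 0
  else 0

/-- `q = √(d(N-d)/N)`. -/
def qval (N d : ℕ) : ℝ := Real.sqrt ((d : ℝ) * ((N : ℝ) - (d : ℝ)) / (N : ℝ))

/-- the projection `P⊥ = I - e eᵀ` (complex version). -/
def Pperp (N : ℕ) : Matrix (Fin N) (Fin N) ℂ := 1 - Matrix.of fun _ _ => (N : ℂ)⁻¹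

/-- the projection `P⊥ = I - e eᵀ` (real version). -/
def PperpR (N : ℕ) : Matrix (Fin N) (Fin N) ℝ := 1 - Matrix.of fun _ _ => (N : ℝ)⁻¹

/-- the Green function `G(z) = P⊥ (q⁻¹𝒜 - z)⁻¹ P⊥`. -/
def greenM (N d : ℕ) (A : Matrix (Fin N) (Fin N) ℝ) (z : ℂ) : Matrix (Fin N) (Fin N) ℂ :=
  Pperp N * (((qval N d : ℝ) : ℂ)⁻¹ • A.map Complex.ofReal - z • 1)⁻¹ * Pperp N

/-- the normalized trace `Ḡ(z) = N⁻¹ Tr G(z)`. -/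
def gbar (N d : ℕ) (A : Matrix (Fin N) (Fin N) ℝ) (z : ℂ) : ℂ :=
  (N : ℂ)⁻¹ * (greenM N d A z).trace

/-- the Stieltjes transform of the semicircle density `ϱ(x) = (2π)⁻¹ √((4-x²)₊)`. -/
def mSC (z : ℂ) : ℂ :=
  ∫ x in (-2 : ℝ)..2, ((Real.sqrt (4 - x ^ 2) / (2 * Real.pi) : ℝ) : ℂ) / ((x : ℂ) - z)

/-- `(Δ_{ij})_{xy} = δ_{ix}δ_{jy} + δ_{iy}δ_{jx}`. -/
def Dmat (N : ℕ) (i j : Fin N) : Matrix (Fin N) (Fin N) ℝ :=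
  Matrix.of fun x y =>
    (if i = x ∧ j = y then (1 : ℝ) else 0) + (if i = y ∧ j = x then (1 : ℝ) else 0)

/-- `ξ_{ij}^{kl} = Δ_{ij} + Δ_{kl} - Δ_{ik} - Δ_{jl}`. -/
def xiMat (N : ℕ) (i j k l : Fin N) : Matrix (Fin N) (Fin N) ℝ :=
  Dmat N i j + Dmat N k l - Dmat N i k - Dmat N j l

/-- `χ_{ij}^{kl}(𝒜) = 𝒜_{ij}(1-𝒜_{ik})𝒜_{kl}(1-𝒜_{jl})`. -/
def chi (N : ℕ) (A : Matrix (Fin N) (Fin N) ℝ) (i j k l : Fin N) : ℝ :=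
  A i j * (1 - A i k) * A k l * (1 - A j l)

/-- `𝓜_{ij}(F(𝒜)) = max_{k,l} |F(𝒜 + ξ_{ij}^{kl})|`. -/
def Mmax (N : ℕ) (i j : Fin N) (F : Matrix (Fin N) (Fin N) ℝ → ℝ)
    (A : Matrix (Fin N) (Fin N) ℝ) : ℝ :=
  ⨆ p : Fin N × Fin N, |F (A + xiMat N i j p.1 p.2)|

instance matMS (N : ℕ) : MeasurableSpace (Matrix (Fin N) (Fin N) ℝ) :=
  show MeasurableSpace (Fin N → Fin N → ℝ) from inferInstance

/-- the GOE: push-forward of independent centered Gaussians with variance `(1+δ_{ij})/N`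
on the upper triangle under the symmetrization map. -/
def goeMeasure (N : ℕ) : Measure (Matrix (Fin N) (Fin N) ℝ) :=
  Measure.map (fun f => Matrix.of fun i j => if i ≤ j then f (i, j) else f (j, i))
    (Measure.pi fun p : Fin N × Fin N =>
      ProbabilityTheory.gaussianReal 0 (if p.1 = p.2 then 2 / N else 1 / N))

/-- the uniform probability measure on `d`-regular graphs on `N` vertices, as a measure. -/
def uniformReg (N d : ℕ) : Measure (Matrix (Fin N) (Fin N) ℝ) :=
  (Nat.card {A : Matrix (Fin N) (Fin N) ℝ // IsAdjMat N d A} : ℝ≥0∞)⁻¹ •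
    Measure.sum fun A : {A : Matrix (Fin N) (Fin N) ℝ // IsAdjMat N d A} =>
      Measure.dirac A.1

/-- the matrix flow `A(t) = e^{-t/2} q⁻¹𝒜 + √(1-e^{-t}) W`, where `W = P⊥ H P⊥`. -/
def flowMat (N d : ℕ) (A H : Matrix (Fin N) (Fin N) ℝ) (t : ℝ) : Matrix (Fin N) (Fin N) ℝ :=
  Real.exp (-t / 2) • ((qval N d)⁻¹ • A) +
    Real.sqrt (1 - Real.exp (-t)) • (PperpR N * H * PperpR N)

/-- the Green function of the matrix flow, `G(t;z) = P⊥ (A(t) - z)⁻¹ P⊥`. -/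
def greenFlow (N d : ℕ) (A H : Matrix (Fin N) (Fin N) ℝ) (t : ℝ) (z : ℂ) :
    Matrix (Fin N) (Fin N) ℂ :=
  Pperp N * ((flowMat N d A H t).map Complex.ofReal - z • 1)⁻¹ * Pperp N

/-- the normalized trace of the Green function of the flow. -/
def gbarFlow (N d : ℕ) (A H : Matrix (Fin N) (Fin N) ℝ) (t : ℝ) (z : ℂ) : ℂ :=
  (N : ℂ)⁻¹ * (greenFlow N d A H t z).trace

/-- A weighted family of moves `A ↦ move A s` on a finite set of points, for which the
weighted counting measure on pairs `(A, s)` is invariant under `(A, s) ↦ (move A s, rev s)`. -/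
structure SwitchSystem (Ω S : Type) [Fintype S] where
  pts : Finset Ω
  w : Ω → S → ℝ
  move : Ω → S → Ω
  rev : S → S
  w_nonneg : ∀ A ∈ pts, ∀ s, 0 ≤ w A s
  move_mem : ∀ A ∈ pts, ∀ s, w A s ≠ 0 → move A s ∈ pts
  move_move : ∀ A ∈ pts, ∀ s, w A s ≠ 0 → move (move A s) (rev s) = A
  sum_move : ∀ f : Ω → S → ℝ,
    ∑ A ∈ pts, ∑ s, w A s * f (move A s) (rev s) = ∑ A ∈ pts, ∑ s, w A s * f A s

/-- The conditions under which an observable `Z`, recovered up to small errors from an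
antisymmetric function `F` of the moves, concentrates at scale `E` around zero. -/
structure SwitchBound {Ω S : Type} [Fintype S] (X : SwitchSystem Ω S) (good : Ω → Prop)
    (Z : Ω → ℂ) (F : Ω → S → ℂ) (n E K : ℝ) (b' b c : Ω → S → ℝ) : Prop where
  n_pos : 0 < n
  E_pos : 0 < E
  one_le_K : 1 ≤ K
  antisymm : ∀ A ∈ X.pts, ∀ s, X.w A s ≠ 0 → F (X.move A s) (X.rev s) = -F A s
  approx : ∀ A ∈ X.pts, good A →
    ‖Z A - (n : ℂ)⁻¹ * ∑ s, (X.w A s : ℂ) * F A s‖ ≤ E + n⁻¹ * ∑ s, X.w A s * b' A s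
  err_le : ∀ A ∈ X.pts, ∀ s, X.w A s ≠ 0 → good A → good (X.move A s) →
    b' A s ≤ b A s + b (X.move A s) (X.rev s)
  b_nonneg : ∀ A ∈ X.pts, ∀ s, 0 ≤ b A s
  b_sum : ∀ A ∈ X.pts, good A → ∑ s, X.w A s * b A s ≤ n * E
  incr_le : ∀ A ∈ X.pts, ∀ s, X.w A s ≠ 0 → good A → good (X.move A s) →
    ‖F A s‖ * ‖Z A - Z (X.move A s)‖ ≤ c A s + c (X.move A s) (X.rev s)
  c_nonneg : ∀ A ∈ X.pts, ∀ s, 0 ≤ c A s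
  c_sum : ∀ A ∈ X.pts, good A → ∑ s, X.w A s * c A s ≤ n * E ^ 2
  Z_move : ∀ A ∈ X.pts, ∀ s, X.w A s ≠ 0 → good A → good (X.move A s) →
    ‖Z A - Z (X.move A s)‖ ≤ E
  Z_le : ∀ A ∈ X.pts, ‖Z A‖ ≤ K
  F_le : ∀ A ∈ X.pts, ∀ s, X.w A s ≠ 0 → ‖F A s‖ ≤ K
  b'_le : ∀ A ∈ X.pts, ∀ s, X.w A s ≠ 0 → b' A s ≤ K
  w_sum : ∀ A ∈ X.pts, ∑ s, X.w A s ≤ K * n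

/-- The function `w ↦ w̄ |w|ᵏ`, for which `w · powConj k w = |w|ᵏ⁺²`. -/
def powConj (k : ℕ) (w : ℂ) : ℂ := (starRingEnd ℂ) w * (‖w‖ : ℂ) ^ k

lemma norm_powConj (k : ℕ) (w : ℂ) : ‖powConj k w‖ = ‖w‖ ^ (k + 1) := by
  simp [powConj, pow_succ']

lemma mul_powConj (k : ℕ) (w : ℂ) : w * powConj k w = ((‖w‖ ^ (k + 2) : ℝ) : ℂ) := by
  have h : w * (starRingEnd ℂ) w = ((‖w‖ : ℂ)) ^ 2 := by
    rw [Complex.mul_conj, Complex.normSq_eq_norm_sq]; push_cast; rfl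
  rw [powConj, ← mul_assoc, h]; push_cast; ring

lemma norm_powConj_sub_le (k : ℕ) (a b : ℂ) {M : ℝ} (ha : ‖a‖ ≤ M) (hb : ‖b‖ ≤ M) :
    ‖powConj k a - powConj k b‖ ≤ (k + 1) * ‖a - b‖ * M ^ k := by
  have hM : 0 ≤ M := (norm_nonneg a).trans ha
  have h1 : powConj k a - powConj k b =
      (starRingEnd ℂ) (a - b) * (‖a‖ : ℂ) ^ k +
        (starRingEnd ℂ) b * (((‖a‖ ^ k - ‖b‖ ^ k : ℝ)) : ℂ) := by
    simp only [powConj, map_sub]; push_cast; ring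
  have h2 : ‖b‖ * |‖a‖ ^ k - ‖b‖ ^ k| ≤ k * ‖a - b‖ * M ^ k := by
    rcases k with _ | k
    · simp
    · have h3 := abs_pow_sub_pow_le ‖a‖ ‖b‖ (k + 1)
      have h4 : |‖a‖ - ‖b‖| ≤ ‖a - b‖ := abs_norm_sub_norm_le a b
      have h5 : max |‖a‖| |‖b‖| ^ k ≤ M ^ k := by
        gcongr; simp [ha, hb]
      simp only [Nat.add_sub_cancel] at h3
      calc ‖b‖ * |‖a‖ ^ (k + 1) - ‖b‖ ^ (k + 1)|
          ≤ M * (‖a - b‖ * ((k + 1 : ℕ) : ℝ) * M ^ k) := by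
            refine mul_le_mul hb (h3.trans ?_) (abs_nonneg _) hM
            gcongr
        _ = _ := by ring
  calc ‖powConj k a - powConj k b‖
      ≤ ‖a - b‖ * ‖a‖ ^ k + ‖b‖ * |‖a‖ ^ k - ‖b‖ ^ k| := by
        rw [h1]; refine (norm_add_le _ _).trans (le_of_eq ?_)
        rw [norm_mul, norm_mul, RCLike.norm_conj, RCLike.norm_conj, Complex.norm_real,
          Real.norm_eq_abs, norm_pow, Complex.norm_real, norm_norm]
    _ ≤ ‖a - b‖ * M ^ k + k * ‖a - b‖ * M ^ k := by gcongr
    _ = _ := by ring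

section

variable {Ω S : Type} [Fintype S] {X : SwitchSystem Ω S} {good : Ω → Prop}
  {Z : Ω → ℂ} {F : Ω → S → ℂ} {n E K : ℝ} {b' b c : Ω → S → ℝ}

open Classical in
/-- Weighted sums over bad points. -/
lemma SwitchBound.sum_bad_le (h : SwitchBound X good Z F n E K b' b c) :
    ∑ A ∈ X.pts, ∑ s, X.w A s * (if good A then 0 else 1 : ℝ) ≤
      K * n * (X.pts.filter fun A => ¬ good A).card := by
  have h1 : ∀ A ∈ X.pts, ∑ s, X.w A s * (if good A then 0 else 1 : ℝ) ≤
      if ¬ good A then K * n else 0 := by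
    intro A hA
    by_cases hg : good A
    · simp [hg]
    · simpa [hg] using h.w_sum A hA
  refine (Finset.sum_le_sum h1).trans (le_of_eq ?_)
  rw [← Finset.sum_filter, Finset.sum_const, nsmul_eq_mul, mul_comm]

open Classical in
/-- The contribution of the antisymmetric part, after symmetrization. -/
lemma SwitchBound.antisymm_part (h : SwitchBound X good Z F n E K b' b c) (k : ℕ) :
    n⁻¹ * ∑ A ∈ X.pts, ∑ s, X.w A s * (F A s * powConj k (Z A)).re ≤
      (k + 1) * E ^ 2 * ∑ A ∈ X.pts, (‖Z A‖ + E) ^ k +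
        2 * K ^ (k + 3) * (X.pts.filter fun A => ¬ good A).card := by
  have hn := h.n_pos
  have hE := h.E_pos
  have hK := h.one_le_K
  have hbad := h.sum_bad_le
  set β : Ω → ℝ := fun A => if good A then 0 else 1 with hβ
  have hβ0 : ∀ A, 0 ≤ β A := fun A => by simp only [hβ]; split_ifs <;> norm_num
  set c₁ : Ω → S → ℝ := fun A s =>
    if good A ∧ good (X.move A s) then
      c A s * min (‖Z A‖ + E) (‖Z (X.move A s)‖ + E) ^ k else 0 with hc₁
  set f : Ω → S → ℝ := fun A s => (F A s * powConj k (Z A)).re with hf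
  -- pointwise estimate
  have hpt : ∀ A ∈ X.pts, ∀ s, X.w A s * (f A s + f (X.move A s) (X.rev s)) ≤
      X.w A s * (((k + 1) * c₁ A s + 2 * K ^ (k + 2) * β A) +
        ((k + 1) * c₁ (X.move A s) (X.rev s) + 2 * K ^ (k + 2) * β (X.move A s))) := by
    intro A hA s
    by_cases hw : X.w A s = 0
    · simp [hw]
    refine mul_le_mul_of_nonneg_left ?_ (X.w_nonneg A hA s)
    have hA' := X.move_mem A hA s hw
    have hmm := X.move_move A hA s hw
    have e1 : f A s + f (X.move A s) (X.rev s) =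
        (F A s * (powConj k (Z A) - powConj k (Z (X.move A s)))).re := by
      simp only [hf, h.antisymm A hA s hw, ← Complex.add_re]; congr 1; ring
    rw [e1]
    refine (Complex.re_le_norm _).trans ?_
    rw [norm_mul]
    by_cases hg : good A ∧ good (X.move A s)
    · have hg' : good (X.move A s) ∧ good (X.move (X.move A s) (X.rev s)) := by
        rw [hmm]; exact hg.symm
      have hd := h.Z_move A hA s hw hg.1 hg.2
      set M := min (‖Z A‖ + E) (‖Z (X.move A s)‖ + E) with hM
      have hM1 : ‖Z A‖ ≤ M := by
        refine le_min (by linarith) ?_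
        have := norm_sub_norm_le (Z A) (Z (X.move A s)); linarith
      have hM2 : ‖Z (X.move A s)‖ ≤ M := by
        refine le_min ?_ (by linarith)
        have := norm_sub_norm_le (Z (X.move A s)) (Z A)
        rw [norm_sub_rev] at this; linarith
      have hM0 : 0 ≤ M := (norm_nonneg _).trans hM1
      have e2 : c₁ A s = c A s * M ^ k := by simp only [hc₁, if_pos hg, hM]
      have e3 : c₁ (X.move A s) (X.rev s) = c (X.move A s) (X.rev s) * M ^ k := by
        simp only [hc₁, if_pos hg']; rw [hmm, min_comm]
      have e4 : β A = 0 := by simp [hβ, hg.1]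
      have e5 : β (X.move A s) = 0 := by simp [hβ, hg.2]
      rw [e2, e3, e4, e5]
      calc ‖F A s‖ * ‖powConj k (Z A) - powConj k (Z (X.move A s))‖
          ≤ ‖F A s‖ * ((k + 1) * ‖Z A - Z (X.move A s)‖ * M ^ k) := by
            gcongr; exact norm_powConj_sub_le k _ _ hM1 hM2
        _ = (k + 1) * M ^ k * (‖F A s‖ * ‖Z A - Z (X.move A s)‖) := by ring
        _ ≤ (k + 1) * M ^ k * (c A s + c (X.move A s) (X.rev s)) := by
            gcongr; exact h.incr_le A hA s hw hg.1 hg.2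
        _ = _ := by ring
    · have hg' : ¬ (good (X.move A s) ∧ good (X.move (X.move A s) (X.rev s))) := by
        rw [hmm]; exact fun hh => hg hh.symm
      have e2 : c₁ A s = 0 := by simp only [hc₁, if_neg hg]
      have e3 : c₁ (X.move A s) (X.rev s) = 0 := by simp only [hc₁, if_neg hg']
      have e4 : 1 ≤ β A + β (X.move A s) := by
        simp only [hβ]
        by_cases h1 : good A <;> by_cases h2 : good (X.move A s) <;> simp_all
      rw [e2, e3]
      have p1 : ‖powConj k (Z A)‖ ≤ K ^ (k + 1) := by
        rw [norm_powConj]; gcongr; exact h.Z_le A hA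
      have p2 : ‖powConj k (Z (X.move A s))‖ ≤ K ^ (k + 1) := by
        rw [norm_powConj]; gcongr; exact h.Z_le _ hA'
      calc ‖F A s‖ * ‖powConj k (Z A) - powConj k (Z (X.move A s))‖
          ≤ K * (K ^ (k + 1) + K ^ (k + 1)) := by
            gcongr
            · exact h.F_le A hA s hw
            · exact (norm_sub_le _ _).trans (add_le_add p1 p2)
        _ = 2 * K ^ (k + 2) * 1 := by ring
        _ ≤ 2 * K ^ (k + 2) * (β A + β (X.move A s)) := by gcongr
        _ = _ := by ring
  have hsum := Finset.sum_le_sum fun A hA => Finset.sum_le_sum fun s (_ : s ∈ Finset.univ) =>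
    hpt A hA s
  simp only [mul_add, Finset.sum_add_distrib] at hsum
  rw [X.sum_move f, X.sum_move (fun A s => (k + 1) * c₁ A s),
    X.sum_move (fun A s => 2 * K ^ (k + 2) * β A)] at hsum
  have hc1sum : ∑ A ∈ X.pts, ∑ s, X.w A s * ((k + 1) * c₁ A s) ≤
      (k + 1) * (n * E ^ 2) * ∑ A ∈ X.pts, (‖Z A‖ + E) ^ k := by
    rw [Finset.mul_sum]
    refine Finset.sum_le_sum fun A hA => ?_
    by_cases hg : good A
    · calc ∑ s, X.w A s * ((k + 1) * c₁ A s)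
          ≤ ∑ s, (k + 1) * (‖Z A‖ + E) ^ k * (X.w A s * c A s) := by
            refine Finset.sum_le_sum fun s _ => ?_
            have hw := X.w_nonneg A hA s
            have hcn := h.c_nonneg A hA s
            have : c₁ A s ≤ c A s * (‖Z A‖ + E) ^ k := by
              simp only [hc₁]; split_ifs
              · gcongr; exact min_le_left _ _
              · positivity
            calc X.w A s * ((k + 1) * c₁ A s)
                ≤ X.w A s * ((k + 1) * (c A s * (‖Z A‖ + E) ^ k)) := by gcongr
              _ = _ := by ring
        _ = (k + 1) * (‖Z A‖ + E) ^ k * ∑ s, X.w A s * c A s := by rw [Finset.mul_sum]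
        _ ≤ (k + 1) * (‖Z A‖ + E) ^ k * (n * E ^ 2) := by
            gcongr; exact h.c_sum A hA hg
        _ = _ := by ring
    · have : ∀ s, c₁ A s = 0 := fun s => by simp [hc₁, hg]
      simp only [this, mul_zero, Finset.sum_const_zero]; positivity
  have hβsum : ∑ A ∈ X.pts, ∑ s, X.w A s * (2 * K ^ (k + 2) * β A) ≤
      2 * K ^ (k + 2) * (K * n * (X.pts.filter fun A => ¬ good A).card) := by
    calc _ = 2 * K ^ (k + 2) * ∑ A ∈ X.pts, ∑ s, X.w A s * β A := by
          simp only [Finset.mul_sum]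
          exact Finset.sum_congr rfl fun _ _ => Finset.sum_congr rfl fun _ _ => by ring
      _ ≤ _ := by gcongr
  have hfin : ∑ A ∈ X.pts, ∑ s, X.w A s * f A s ≤
      n * ((k + 1) * E ^ 2 * ∑ A ∈ X.pts, (‖Z A‖ + E) ^ k +
        2 * K ^ (k + 3) * (X.pts.filter fun A => ¬ good A).card) := by
    have e : n * ((k + 1) * E ^ 2 * ∑ A ∈ X.pts, (‖Z A‖ + E) ^ k +
        2 * K ^ (k + 3) * (X.pts.filter fun A => ¬ good A).card) =
        (k + 1) * (n * E ^ 2) * ∑ A ∈ X.pts, (‖Z A‖ + E) ^ k +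
        2 * K ^ (k + 2) * (K * n * (X.pts.filter fun A => ¬ good A).card) := by ring
    rw [e]; linarith
  calc _ ≤ n⁻¹ * (n * ((k + 1) * E ^ 2 * ∑ A ∈ X.pts, (‖Z A‖ + E) ^ k +
        2 * K ^ (k + 3) * (X.pts.filter fun A => ¬ good A).card)) := by gcongr
    _ = _ := by field_simp

open Classical in
/-- The contribution of the approximation error. -/
lemma SwitchBound.error_part (h : SwitchBound X good Z F n E K b' b c) (k : ℕ) :
    ∑ A ∈ X.pts, ‖Z A - (n : ℂ)⁻¹ * ∑ s, (X.w A s : ℂ) * F A s‖ * ‖Z A‖ ^ (k + 1) ≤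
      3 * E * ∑ A ∈ X.pts, (‖Z A‖ + E) ^ (k + 1) +
        4 * K ^ (k + 3) * (X.pts.filter fun A => ¬ good A).card := by
  have hn := h.n_pos
  have hE := h.E_pos
  have hK := h.one_le_K
  have hK0 : 0 ≤ K := by linarith
  have hbad := h.sum_bad_le
  set β : Ω → ℝ := fun A => if good A then 0 else 1 with hβ
  have hβ0 : ∀ A, 0 ≤ β A := fun A => by simp only [hβ]; split_ifs <;> norm_num
  set b₁ : Ω → S → ℝ := fun A s =>
    if good A ∧ good (X.move A s) then
      b A s * min (‖Z A‖ + E) (‖Z (X.move A s)‖ + E) ^ (k + 1) else 0 with hb₁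
  have hb1sum : ∑ A ∈ X.pts, ∑ s, X.w A s * b₁ A s ≤
      n * E * ∑ A ∈ X.pts, (‖Z A‖ + E) ^ (k + 1) := by
    rw [Finset.mul_sum]
    refine Finset.sum_le_sum fun A hA => ?_
    by_cases hg : good A
    · calc ∑ s, X.w A s * b₁ A s
          ≤ ∑ s, (‖Z A‖ + E) ^ (k + 1) * (X.w A s * b A s) := by
            refine Finset.sum_le_sum fun s _ => ?_
            have hw := X.w_nonneg A hA s
            have hcn := h.b_nonneg A hA s
            have : b₁ A s ≤ b A s * (‖Z A‖ + E) ^ (k + 1) := by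
              simp only [hb₁]; split_ifs
              · gcongr; exact min_le_left _ _
              · positivity
            calc X.w A s * b₁ A s
                ≤ X.w A s * (b A s * (‖Z A‖ + E) ^ (k + 1)) := by gcongr
              _ = _ := by ring
        _ = (‖Z A‖ + E) ^ (k + 1) * ∑ s, X.w A s * b A s := by rw [Finset.mul_sum]
        _ ≤ (‖Z A‖ + E) ^ (k + 1) * (n * E) := by
            gcongr; exact h.b_sum A hA hg
        _ = _ := by ring
    · have : ∀ s, b₁ A s = 0 := fun s => by simp [hb₁, hg]
      simp only [this, mul_zero, Finset.sum_const_zero]; positivity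
  have hcard : ∑ A ∈ X.pts, β A = (X.pts.filter fun A => ¬ good A).card := by
    rw [Finset.card_filter]; push_cast
    refine Finset.sum_congr rfl fun A _ => ?_
    simp only [hβ]; by_cases hg : good A <;> simp [hg]
  -- pointwise bound
  have hpt : ∀ A ∈ X.pts,
      ‖Z A - (n : ℂ)⁻¹ * ∑ s, (X.w A s : ℂ) * F A s‖ * ‖Z A‖ ^ (k + 1) ≤
        E * (‖Z A‖ + E) ^ (k + 1) + 2 * K ^ (k + 3) * β A +
          n⁻¹ * ∑ s, X.w A s * (b₁ A s + (b₁ (X.move A s) (X.rev s) +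
            K ^ (k + 2) * β (X.move A s)) + K ^ (k + 2) * β A) := by
    intro A hA
    have hb1n : ∀ A ∈ X.pts, ∀ s, 0 ≤ b₁ A s := by
      intro A hA s
      have := h.b_nonneg A hA s
      simp only [hb₁]; split_ifs <;> positivity
    have hlast : 0 ≤ n⁻¹ * ∑ s, X.w A s * (b₁ A s + (b₁ (X.move A s) (X.rev s) +
            K ^ (k + 2) * β (X.move A s)) + K ^ (k + 2) * β A) := by
      refine mul_nonneg (by positivity) (Finset.sum_nonneg fun s _ => ?_)
      by_cases hw : X.w A s = 0
      · simp [hw]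
      have h1 := X.w_nonneg A hA s
      have h2 := hb1n A hA s
      have h3 := hb1n _ (X.move_mem A hA s hw) (X.rev s)
      have h4 := hβ0 A
      have h5 := hβ0 (X.move A s)
      positivity
    by_cases hg : good A
    · have e4 : β A = 0 := by simp [hβ, hg]
      have h1 := h.approx A hA hg
      have hsum : (∑ s, X.w A s * b' A s) * ‖Z A‖ ^ (k + 1) ≤
          ∑ s, X.w A s * (b₁ A s + (b₁ (X.move A s) (X.rev s) +
            K ^ (k + 2) * β (X.move A s)) + K ^ (k + 2) * β A) := by
        rw [Finset.sum_mul]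
        refine Finset.sum_le_sum fun s _ => ?_
        by_cases hw : X.w A s = 0
        · simp [hw]
        rw [mul_assoc]
        refine mul_le_mul_of_nonneg_left ?_ (X.w_nonneg A hA s)
        have hA' := X.move_mem A hA s hw
        have hmm := X.move_move A hA s hw
        by_cases hg2 : good (X.move A s)
        · have hd := h.Z_move A hA s hw hg hg2
          set M := min (‖Z A‖ + E) (‖Z (X.move A s)‖ + E) with hM
          have hM1 : ‖Z A‖ ≤ M := by
            refine le_min (by linarith) ?_
            have := norm_sub_norm_le (Z A) (Z (X.move A s)); linarith
          have hM0 : 0 ≤ M := (norm_nonneg _).trans hM1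
          have e2 : b₁ A s = b A s * M ^ (k + 1) := by simp only [hb₁, if_pos (And.intro hg hg2), hM]
          have e3 : b₁ (X.move A s) (X.rev s) = b (X.move A s) (X.rev s) * M ^ (k + 1) := by
            simp only [hb₁]; rw [hmm, min_comm, if_pos ⟨hg2, hg⟩]
          have e5 : β (X.move A s) = 0 := by simp [hβ, hg2]
          rw [e2, e3, e4, e5]
          have hb0 := h.b_nonneg A hA s
          have hb1 := h.b_nonneg _ hA' (X.rev s)
          calc b' A s * ‖Z A‖ ^ (k + 1)
              ≤ (b A s + b (X.move A s) (X.rev s)) * ‖Z A‖ ^ (k + 1) := by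
                gcongr; exact h.err_le A hA s hw hg hg2
            _ ≤ (b A s + b (X.move A s) (X.rev s)) * M ^ (k + 1) := by gcongr
            _ = _ := by ring
        · have e5 : β (X.move A s) = 1 := by simp [hβ, hg2]
          have h2 := hb1n A hA s
          have h3 := hb1n _ hA' (X.rev s)
          rw [e4, e5]
          have : b' A s * ‖Z A‖ ^ (k + 1) ≤ K * K ^ (k + 1) := by
            have := h.b'_le A hA s hw
            have := h.Z_le A hA
            gcongr
          have e : K * K ^ (k + 1) = K ^ (k + 2) := by ring
          linarith
      calc ‖Z A - (n : ℂ)⁻¹ * ∑ s, (X.w A s : ℂ) * F A s‖ * ‖Z A‖ ^ (k + 1)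
          ≤ (E + n⁻¹ * ∑ s, X.w A s * b' A s) * ‖Z A‖ ^ (k + 1) := by gcongr
        _ = E * ‖Z A‖ ^ (k + 1) + n⁻¹ * ((∑ s, X.w A s * b' A s) * ‖Z A‖ ^ (k + 1)) := by ring
        _ ≤ E * (‖Z A‖ + E) ^ (k + 1) + n⁻¹ * ∑ s, X.w A s * (b₁ A s +
            (b₁ (X.move A s) (X.rev s) +
            K ^ (k + 2) * β (X.move A s)) + K ^ (k + 2) * β A) := by
            gcongr; linarith
        _ ≤ _ := by rw [e4]; simp
    · have e4 : β A = 1 := by simp [hβ, hg]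
      have h1 : ‖Z A - (n : ℂ)⁻¹ * ∑ s, (X.w A s : ℂ) * F A s‖ ≤ K + K ^ 2 := by
        have h2 : ‖∑ s, (X.w A s : ℂ) * F A s‖ ≤ K * n * K := by
          calc _ ≤ ∑ s, X.w A s * K := by
                refine (norm_sum_le _ _).trans (Finset.sum_le_sum fun s _ => ?_)
                by_cases hw : X.w A s = 0
                · simp [hw]
                rw [norm_mul, Complex.norm_real, Real.norm_of_nonneg (X.w_nonneg A hA s)]
                exact mul_le_mul_of_nonneg_left (h.F_le A hA s hw) (X.w_nonneg A hA s)
            _ = (∑ s, X.w A s) * K := by rw [Finset.sum_mul]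
            _ ≤ _ := by gcongr; exact h.w_sum A hA
        calc _ ≤ ‖Z A‖ + ‖(n : ℂ)⁻¹ * ∑ s, (X.w A s : ℂ) * F A s‖ := norm_sub_le _ _
          _ ≤ K + n⁻¹ * (K * n * K) := by
            gcongr
            · exact h.Z_le A hA
            · rw [norm_mul, norm_inv, Complex.norm_real, Real.norm_of_nonneg hn.le]
              gcongr
          _ = K + K ^ 2 := by field_simp
      calc _ ≤ (K + K ^ 2) * K ^ (k + 1) := by gcongr; exact h.Z_le A hA
        _ ≤ (K ^ 2 + K ^ 2) * K ^ (k + 1) := by gcongr; nlinarith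
        _ = 2 * K ^ (k + 3) * β A := by rw [e4]; ring
        _ ≤ _ := by
          have : 0 ≤ E * (‖Z A‖ + E) ^ (k + 1) := by positivity
          linarith
  refine (Finset.sum_le_sum hpt).trans ?_
  simp only [Finset.sum_add_distrib, ← Finset.mul_sum, mul_add]
  rw [X.sum_move b₁, X.sum_move (fun A s => K ^ (k + 2) * β A)]
  have hβsum : ∑ A ∈ X.pts, ∑ s, X.w A s * (K ^ (k + 2) * β A) ≤
      K ^ (k + 2) * (K * n * (X.pts.filter fun A => ¬ good A).card) := by
    calc _ = K ^ (k + 2) * ∑ A ∈ X.pts, ∑ s, X.w A s * β A := by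
          simp only [Finset.mul_sum]
          exact Finset.sum_congr rfl fun _ _ => Finset.sum_congr rfl fun _ _ => by ring
      _ ≤ _ := by gcongr
  rw [hcard]
  set Q := ∑ A ∈ X.pts, (‖Z A‖ + E) ^ (k + 1)
  set B : ℝ := (((X.pts.filter fun A => ¬ good A).card : ℕ) : ℝ)
  have h1 : n⁻¹ * ∑ A ∈ X.pts, ∑ s, X.w A s * b₁ A s ≤ E * Q := by
    calc _ ≤ n⁻¹ * (n * E * Q) := by gcongr
      _ = _ := by field_simp
  have h2 : n⁻¹ * ∑ A ∈ X.pts, ∑ s, X.w A s * (K ^ (k + 2) * β A) ≤ K ^ (k + 3) * B := by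
    calc _ ≤ n⁻¹ * (K ^ (k + 2) * (K * n * B)) := by gcongr
      _ = _ := by field_simp; ring
  linarith

open Classical in
lemma SwitchBound.sum_norm_pow_le (h : SwitchBound X good Z F n E K b' b c) (k : ℕ) :
    ∑ A ∈ X.pts, ‖Z A‖ ^ (k + 2) ≤
      (k + 4) * E * ∑ A ∈ X.pts, (‖Z A‖ + E) ^ (k + 1) +
        6 * K ^ (k + 3) * (X.pts.filter fun A => ¬ good A).card := by
  have hE := h.E_pos
  have h1 := h.antisymm_part k
  have h2 := h.error_part k
  have h3 : ∑ A ∈ X.pts, ‖Z A‖ ^ (k + 2) ≤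
      ∑ A ∈ X.pts, ‖Z A - (n : ℂ)⁻¹ * ∑ s, (X.w A s : ℂ) * F A s‖ * ‖Z A‖ ^ (k + 1) +
      n⁻¹ * ∑ A ∈ X.pts, ∑ s, X.w A s * (F A s * powConj k (Z A)).re := by
    rw [Finset.mul_sum, ← Finset.sum_add_distrib]
    refine Finset.sum_le_sum fun A _ => ?_
    have e1 : ‖Z A‖ ^ (k + 2) = (Z A * powConj k (Z A)).re := by
      rw [mul_powConj, Complex.ofReal_re]
    have e2 : n⁻¹ * ∑ s, X.w A s * (F A s * powConj k (Z A)).re =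
        (((n : ℂ)⁻¹ * ∑ s, (X.w A s : ℂ) * F A s) * powConj k (Z A)).re := by
      rw [mul_assoc, Finset.sum_mul, ← Complex.ofReal_inv, Complex.re_ofReal_mul,
        Complex.re_sum]
      simp only [mul_assoc, Complex.re_ofReal_mul]
    rw [e1, e2, ← sub_le_iff_le_add, ← Complex.sub_re, ← sub_mul]
    refine (Complex.re_le_norm _).trans ?_
    rw [norm_mul, norm_powConj]
  have h4 : E ^ 2 * ∑ A ∈ X.pts, (‖Z A‖ + E) ^ k ≤
      E * ∑ A ∈ X.pts, (‖Z A‖ + E) ^ (k + 1) := by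
    rw [Finset.mul_sum, Finset.mul_sum]
    refine Finset.sum_le_sum fun A _ => ?_
    have : E ≤ ‖Z A‖ + E := by linarith [norm_nonneg (Z A)]
    calc E ^ 2 * (‖Z A‖ + E) ^ k = E * (E * (‖Z A‖ + E) ^ k) := by ring
      _ ≤ E * ((‖Z A‖ + E) * (‖Z A‖ + E) ^ k) := by gcongr
      _ = _ := by ring
  have h5 : (k + 1) * E ^ 2 * ∑ A ∈ X.pts, (‖Z A‖ + E) ^ k ≤
      (k + 1) * (E * ∑ A ∈ X.pts, (‖Z A‖ + E) ^ (k + 1)) := by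
    rw [mul_assoc]; gcongr
  linarith

/-- The constant in the tail bound obtained from moments of order `k + 2`. -/
def tailConst (k : ℕ) : ℝ := 2 * (2 * (2 ^ (k + 2) * (k + 5))) ^ (k + 2) + 2 * (2 ^ (k + 2) * 6)

open Classical in
/-- Tail bound for `Z` at scale `E`. -/
lemma SwitchBound.card_large_le (h : SwitchBound X good Z F n E K b' b c) (k : ℕ) {t : ℝ}
    (ht : 0 < t) :
    ((X.pts.filter fun A => t * E ≤ ‖Z A‖).card : ℝ) ≤ tailConst k * (t ^ (k + 2))⁻¹ *
      (X.pts.card + K ^ (k + 3) * (E ^ (k + 2))⁻¹ *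
        (X.pts.filter fun A => ¬ good A).card) := by
  have hE := h.E_pos
  have hK : 0 < K := lt_of_lt_of_le one_pos h.one_le_K
  have h1 := h.sum_norm_pow_le k
  set B : ℝ := (((X.pts.filter fun A => ¬ good A).card : ℕ) : ℝ) with hB
  have hB0 : 0 ≤ B := by positivity
  set C : ℝ := 2 ^ (k + 2) * (k + 5) with hC
  have hC0 : 0 < C := by positivity
  set W : Ω → ℝ := fun A => ‖Z A‖ + E with hW
  have hWE : ∀ A, E ≤ W A := fun A => by simp [hW]
  have hW0 : ∀ A, 0 < W A := fun A => hE.trans_le (hWE A)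
  have h2 : ∀ A, W A ^ (k + 2) ≤ 2 ^ (k + 2) * (‖Z A‖ ^ (k + 2) + E * W A ^ (k + 1)) := by
    intro A
    have h3 := add_pow_le (norm_nonneg (Z A)) hE.le (k + 2)
    have h4 : E ^ (k + 2) ≤ E * W A ^ (k + 1) := by
      rw [pow_succ']; gcongr; exact hWE A
    calc W A ^ (k + 2) ≤ 2 ^ (k + 2 - 1) * (‖Z A‖ ^ (k + 2) + E ^ (k + 2)) := h3
      _ ≤ 2 ^ (k + 2) * (‖Z A‖ ^ (k + 2) + E * W A ^ (k + 1)) := by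
        gcongr
        · norm_num
        · omega
  have h5 : ∀ A, C * (E * W A ^ (k + 1)) ≤
      2⁻¹ * W A ^ (k + 2) + 2⁻¹ * (2 * C) ^ (k + 2) * E ^ (k + 2) := by
    intro A
    have hw := hW0 A
    by_cases hle : 2 * C * E ≤ W A
    · have : C * (E * W A ^ (k + 1)) ≤ 2⁻¹ * W A ^ (k + 2) := by
        calc C * (E * W A ^ (k + 1)) = 2⁻¹ * ((2 * C * E) * W A ^ (k + 1)) := by ring
          _ ≤ 2⁻¹ * (W A * W A ^ (k + 1)) := by gcongr
          _ = _ := by ring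
      have : 0 ≤ 2⁻¹ * (2 * C) ^ (k + 2) * E ^ (k + 2) := by positivity
      linarith
    · push Not at hle
      have : C * (E * W A ^ (k + 1)) ≤ 2⁻¹ * (2 * C) ^ (k + 2) * E ^ (k + 2) := by
        calc C * (E * W A ^ (k + 1)) ≤ C * (E * (2 * C * E) ^ (k + 1)) := by gcongr
          _ = _ := by rw [mul_pow]; ring
      have : 0 ≤ 2⁻¹ * W A ^ (k + 2) := by positivity
      linarith
  have h6 : ∑ A ∈ X.pts, W A ^ (k + 2) ≤
      2 * (2 * C) ^ (k + 2) * E ^ (k + 2) * X.pts.card +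
        2 * (2 ^ (k + 2) * 6) * K ^ (k + 3) * B := by
    have s1 := Finset.sum_le_sum fun A (_ : A ∈ X.pts) => h2 A
    have s2 := Finset.sum_le_sum fun A (_ : A ∈ X.pts) => h5 A
    simp only [← Finset.mul_sum, Finset.sum_add_distrib, Finset.sum_const, nsmul_eq_mul] at s1 s2
    have s3 : 2 ^ (k + 2) * (∑ A ∈ X.pts, ‖Z A‖ ^ (k + 2) + E * ∑ A ∈ X.pts, W A ^ (k + 1)) ≤
        C * (E * ∑ A ∈ X.pts, W A ^ (k + 1)) + 2 ^ (k + 2) * 6 * (K ^ (k + 3) * B) := by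
      calc _ ≤ 2 ^ (k + 2) * (((k + 4) * E * ∑ A ∈ X.pts, W A ^ (k + 1) +
            6 * K ^ (k + 3) * B) + E * ∑ A ∈ X.pts, W A ^ (k + 1)) := by gcongr
        _ = _ := by rw [hC]; ring
    have : 0 ≤ (2 * C) ^ (k + 2) * E ^ (k + 2) * X.pts.card := by positivity
    linarith
  have h7 : ((X.pts.filter fun A => t * E ≤ ‖Z A‖).card : ℝ) * (t * E) ^ (k + 2) ≤
      ∑ A ∈ X.pts, W A ^ (k + 2) := by
    rw [← nsmul_eq_mul, ← Finset.sum_const]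
    refine (Finset.sum_le_sum fun A hA => ?_).trans
      (Finset.sum_le_sum_of_subset_of_nonneg (Finset.filter_subset _ _) fun A _ _ => by
        have := hW0 A; positivity)
    have := (Finset.mem_filter.1 hA).2
    gcongr; simp only [hW]; linarith
  have h8 := h7.trans h6
  rw [← le_div_iff₀ (by positivity)] at h8
  refine h8.trans ?_
  rw [div_le_iff₀ (by positivity)]
  have e : tailConst k * (t ^ (k + 2))⁻¹ * (X.pts.card + K ^ (k + 3) * (E ^ (k + 2))⁻¹ * B) *
      (t * E) ^ (k + 2) = tailConst k * (E ^ (k + 2) * X.pts.card + K ^ (k + 3) * B) := by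
    rw [mul_pow]; field_simp
  rw [e, tailConst, add_mul]
  have g1 : 0 ≤ 2 * (2 * C) ^ (k + 2) * (K ^ (k + 3) * B) := by positivity
  have g2 : 0 ≤ 2 * (2 ^ (k + 2) * 6) * (E ^ (k + 2) * (X.pts.card : ℝ)) := by positivity
  linarith

end

lemma finite_isAdjMat (N d : ℕ) : {A : Matrix (Fin N) (Fin N) ℝ | IsAdjMat N d A}.Finite := by
  have h : {A : Fin N → Fin N → ℝ | ∀ i, A i ∈ {v : Fin N → ℝ | ∀ j, v j ∈ ({0, 1} : Set ℝ)}}.Finite :=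
    Set.Finite.pi' fun _ => Set.Finite.pi' fun _ => Set.toFinite _
  refine h.subset fun A hA i j => ?_
  simpa using hA.2.2.1 i j

/-- The finite set of adjacency matrices of `d`-regular graphs on `N` vertices. -/
def regPts (N d : ℕ) : Finset (Matrix (Fin N) (Fin N) ℝ) := (finite_isAdjMat N d).toFinset

lemma mem_regPts {N d : ℕ} {A : Matrix (Fin N) (Fin N) ℝ} : A ∈ regPts N d ↔ IsAdjMat N d A := by
  simp [regPts]

open Classical in
lemma PrReg_eq (N d : ℕ) (E : Matrix (Fin N) (Fin N) ℝ → Prop) :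
    PrReg N d E = ((regPts N d).filter E).card / (regPts N d).card := by
  have h1 : Nat.card {A : Matrix (Fin N) (Fin N) ℝ // IsAdjMat N d A} = (regPts N d).card := by
    rw [← Nat.card_eq_finsetCard]
    exact Nat.card_congr (Equiv.subtypeEquivRight fun A => mem_regPts.symm)
  have h2 : Nat.card {A : Matrix (Fin N) (Fin N) ℝ // IsAdjMat N d A ∧ E A} =
      ((regPts N d).filter E).card := by
    rw [← Nat.card_eq_finsetCard]
    exact Nat.card_congr (Equiv.subtypeEquivRight fun A => by simp [mem_regPts])
  rw [PrReg, h1, h2]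

/-- The indicator that the edges `ik`, `lm` may be replaced by `il`, `km`; here `s = (k, l, m)`. -/
def switchWeight {N : ℕ} (i : Fin N) (A : Matrix (Fin N) (Fin N) ℝ)
    (s : Fin N × Fin N × Fin N) : ℝ :=
  chi N A i s.1 s.2.1 s.2.2 * ((if i = s.2.1 then 0 else 1) * (if s.1 = s.2.2 then 0 else 1))

lemma switchWeight_ne_zero {N d : ℕ} {i : Fin N} {A : Matrix (Fin N) (Fin N) ℝ}
    (hA : IsAdjMat N d A) {s : Fin N × Fin N × Fin N} :
    switchWeight i A s ≠ 0 ↔ A i s.1 = 1 ∧ A i s.2.1 = 0 ∧ A s.2.1 s.2.2 = 1 ∧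
      A s.1 s.2.2 = 0 ∧ i ≠ s.2.1 ∧ s.1 ≠ s.2.2 := by
  obtain ⟨k, l, m⟩ := s
  simp only [switchWeight, chi]
  rcases hA.2.2.1 i k with h1 | h1 <;> rcases hA.2.2.1 i l with h2 | h2 <;>
    rcases hA.2.2.1 l m with h3 | h3 <;> rcases hA.2.2.1 k m with h4 | h4 <;>
    simp [h1, h2, h3, h4] <;> tauto

lemma switchWeight_eq_one {N d : ℕ} {i : Fin N} {A : Matrix (Fin N) (Fin N) ℝ}
    (hA : IsAdjMat N d A) {s : Fin N × Fin N × Fin N} (h : switchWeight i A s ≠ 0) :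
    switchWeight i A s = 1 := by
  obtain ⟨h1, h2, h3, h4, h5, h6⟩ := (switchWeight_ne_zero hA).1 h
  simp [switchWeight, chi, h1, h2, h3, h4, h5, h6]

lemma switchWeight_nonneg {N d : ℕ} {i : Fin N} {A : Matrix (Fin N) (Fin N) ℝ}
    (hA : IsAdjMat N d A) (s : Fin N × Fin N × Fin N) : 0 ≤ switchWeight i A s := by
  by_cases h : switchWeight i A s = 0
  · rw [h]
  · rw [switchWeight_eq_one hA h]; exact zero_le_one

lemma Dmat_symm (N : ℕ) (a b : Fin N) : (Dmat N a b).IsSymm := by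
  ext x y
  simp only [Dmat, Matrix.transpose_apply, Matrix.of_apply]
  ring

lemma xiMat_symm (N : ℕ) (i j k l : Fin N) : (xiMat N i j k l).IsSymm := by
  simp only [xiMat, Matrix.IsSymm, Matrix.transpose_add, Matrix.transpose_sub,
    (Dmat_symm N _ _).eq]

lemma xiMat_swap (N : ℕ) (i k l m : Fin N) : xiMat N i l k m = -xiMat N i k l m := by
  simp only [xiMat]; abel

lemma sum_Dmat_apply (N : ℕ) (a b x : Fin N) :
    ∑ y, Dmat N a b x y = (if a = x then 1 else 0) + (if b = x then 1 else 0) := by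
  simp only [Dmat, Matrix.of_apply, Finset.sum_add_distrib]
  congr 1
  · by_cases h : a = x <;> simp [h]
  · by_cases h : b = x <;> simp [h]

lemma sum_xiMat_apply (N : ℕ) (i j k l x : Fin N) : ∑ y, xiMat N i j k l x y = 0 := by
  simp only [xiMat, Matrix.add_apply, Matrix.sub_apply, Finset.sum_add_distrib,
    Finset.sum_sub_distrib, sum_Dmat_apply]
  ring

lemma switch_ne {N d : ℕ} {i k l m : Fin N} {A : Matrix (Fin N) (Fin N) ℝ}
    (hA : IsAdjMat N d A) (h1 : A i k = 1) (h2 : A i l = 0) (h3 : A l m = 1) :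
    i ≠ k ∧ l ≠ m ∧ i ≠ m ∧ k ≠ l := by
  have hs : ∀ x y, A x y = A y x := fun x y => hA.1.apply y x
  refine ⟨?_, ?_, ?_, ?_⟩
  · rintro rfl; rw [hA.2.1] at h1; norm_num at h1
  · rintro rfl; rw [hA.2.1] at h3; norm_num at h3
  · rintro rfl; rw [hs, h2] at h3; norm_num at h3
  · rintro rfl; rw [h2] at h1; norm_num at h1

set_option linter.unusedSimpArgs false in
lemma isAdjMat_switch {N d : ℕ} {i k l m : Fin N} {A : Matrix (Fin N) (Fin N) ℝ}
    (hA : IsAdjMat N d A) (h1 : A i k = 1) (h2 : A i l = 0) (h3 : A l m = 1) (h4 : A k m = 0)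
    (h5 : i ≠ l) (h6 : k ≠ m) : IsAdjMat N d (A - xiMat N i k l m) := by
  have hs : ∀ x y, A x y = A y x := fun x y => hA.1.apply y x
  obtain ⟨hik, hlm, him, hkl⟩ := switch_ne hA h1 h2 h3
  refine ⟨?_, ?_, ?_, ?_⟩
  · simp only [Matrix.IsSymm, Matrix.transpose_sub, hA.1.eq, (xiMat_symm N _ _ _ _).eq]
  · intro x
    have : xiMat N i k l m x x = 0 := by
      simp only [xiMat, Dmat, Matrix.add_apply, Matrix.sub_apply, Matrix.of_apply]
      have e : ∀ a b : Fin N, a ≠ b → (a = x ∧ b = x ↔ False) := fun a b hab =>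
        ⟨fun hh => hab (hh.1.trans hh.2.symm), False.elim⟩
      simp [e _ _ hik, e _ _ hlm, e _ _ h5, e _ _ h6]
    rw [Matrix.sub_apply, this, hA.2.1, sub_zero]
  · intro x y
    have hxy := hA.2.2.1 x y
    have h1' := hs i k ▸ h1
    have h2' := hs i l ▸ h2
    have h3' := hs l m ▸ h3
    have h4' := hs k m ▸ h4
    simp only [xiMat, Dmat, Matrix.add_apply, Matrix.sub_apply, Matrix.of_apply]
    by_cases a1 : i = x
    · subst a1
      by_cases b1 : k = y
      · subst b1
        simp [hik, hik.symm, hkl, hkl.symm, him, him.symm, h5, h5.symm, h6, h6.symm, h1]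
      by_cases b2 : l = y
      · subst b2
        simp [hik, hik.symm, hkl, hkl.symm, him, him.symm, h5, h5.symm, hlm.symm, h2]
      simp [hik.symm, h5.symm, him.symm, b1, b2, hxy]
    by_cases a2 : k = x
    · subst a2
      by_cases b1 : i = y
      · subst b1
        simp [hik, hik.symm, hkl, hkl.symm, him, him.symm, h5, h5.symm, h6, h6.symm, h1']
      by_cases b2 : m = y
      · subst b2
        simp [hik, hik.symm, hkl, hkl.symm, him, h6, h6.symm, hlm, h4]
      simp [hik, hkl.symm, h6.symm, b1, b2, hxy]
    by_cases a3 : l = x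
    · subst a3
      by_cases b1 : m = y
      · subst b1
        simp [hkl, him, h5, h6, hlm, hlm.symm, h3]
      by_cases b2 : i = y
      · subst b2
        simp [hik.symm, hkl, him.symm, h5, h5.symm, hlm.symm, h2']
      simp [h5, hkl, hlm.symm, b1, b2, hxy]
    by_cases a4 : m = x
    · subst a4
      by_cases b1 : l = y
      · subst b1
        simp [hkl, him, h5, h6, hlm, h3']
      by_cases b2 : k = y
      · subst b2
        simp [hik, hkl.symm, him, h6, hlm, h4']
      simp [him, h6, hlm, b1, b2, hxy]
    simp [a1, a2, a3, a4, hxy]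
  · intro x
    simp only [Matrix.sub_apply, Finset.sum_sub_distrib, sum_xiMat_apply, hA.2.2.2 x, sub_zero]

/-- The values of `ξ` needed for the weight of the reverse switching. -/
lemma xiMat_values {N : ℕ} {i k l m : Fin N} (hik : i ≠ k) (hlm : l ≠ m) (him : i ≠ m)
    (hkl : k ≠ l) (h5 : i ≠ l) (h6 : k ≠ m) :
    xiMat N i k l m i l = -1 ∧ xiMat N i k l m i k = 1 ∧ xiMat N i k l m k m = -1 ∧
      xiMat N i k l m l m = 1 := by
  simp only [xiMat, Dmat, Matrix.add_apply, Matrix.sub_apply, Matrix.of_apply]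
  simp [hik, hik.symm, hlm, hlm.symm, him, him.symm, hkl, hkl.symm, h5, h5.symm, h6, h6.symm]

lemma switchWeight_switch {N d : ℕ} {i : Fin N} {A : Matrix (Fin N) (Fin N) ℝ}
    (hA : IsAdjMat N d A) {s : Fin N × Fin N × Fin N} (h : switchWeight i A s ≠ 0) :
    IsAdjMat N d (A - xiMat N i s.1 s.2.1 s.2.2) ∧
      switchWeight i (A - xiMat N i s.1 s.2.1 s.2.2) (s.2.1, s.1, s.2.2) ≠ 0 := by
  obtain ⟨h1, h2, h3, h4, h5, h6⟩ := (switchWeight_ne_zero hA).1 h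
  obtain ⟨hik, hlm, him, hkl⟩ := switch_ne hA h1 h2 h3
  have hA' := isAdjMat_switch hA h1 h2 h3 h4 h5 h6
  obtain ⟨v1, v2, v3, v4⟩ := xiMat_values hik hlm him hkl h5 h6
  refine ⟨hA', (switchWeight_ne_zero hA').2 ⟨?_, ?_, ?_, ?_, hik, hlm⟩⟩ <;>
    simp [h1, h2, h3, h4, v1, v2, v3, v4]

open Classical in
/-- Switchings at the vertex `i` as a weighted family of moves on regular graphs. -/
def regSwitch (N d : ℕ) (i : Fin N) :
    SwitchSystem (Matrix (Fin N) (Fin N) ℝ) (Fin N × Fin N × Fin N) where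
  pts := regPts N d
  w := switchWeight i
  move A s := A - xiMat N i s.1 s.2.1 s.2.2
  rev s := (s.2.1, s.1, s.2.2)
  w_nonneg A hA s := switchWeight_nonneg (mem_regPts.1 hA) s
  move_mem A hA s h := mem_regPts.2 (switchWeight_switch (mem_regPts.1 hA) h).1
  move_move A hA s h := by simp [xiMat_swap N i s.1]
  sum_move f := by
    rw [← Finset.sum_product', ← Finset.sum_product']
    refine Finset.sum_bij_ne_zero
      (fun p _ _ => (p.1 - xiMat N i p.2.1 p.2.2.1 p.2.2.2, (p.2.2.1, p.2.1, p.2.2.2))) ?_ ?_ ?_ ?_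
    · intro p hp h
      have hA := mem_regPts.1 (Finset.mem_product.1 hp).1
      exact Finset.mem_product.2
        ⟨mem_regPts.2 (switchWeight_switch hA (left_ne_zero_of_mul h)).1, Finset.mem_univ _⟩
    · rintro ⟨A, k, l, m⟩ _ _ ⟨B, k', l', m'⟩ _ _ h
      simp only [Prod.mk.injEq] at h
      obtain ⟨h0, rfl, rfl, rfl⟩ := h
      simpa using h0
    · rintro ⟨B, k, l, m⟩ hp h
      have hB := mem_regPts.1 (Finset.mem_product.1 hp).1
      have hw := left_ne_zero_of_mul h
      obtain ⟨g1, g2⟩ := switchWeight_switch hB hw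
      refine ⟨(B - xiMat N i k l m, (l, k, m)), Finset.mem_product.2
        ⟨mem_regPts.2 g1, Finset.mem_univ _⟩, ?_, ?_⟩
      · refine mul_ne_zero g2 ?_
        have : B - xiMat N i k l m - xiMat N i l k m = B := by simp [xiMat_swap N i k]
        simpa [this] using right_ne_zero_of_mul h
      · simp [xiMat_swap N i k]
    · intro p hp h
      have hA := mem_regPts.1 (Finset.mem_product.1 hp).1
      have hw := left_ne_zero_of_mul h
      obtain ⟨g1, g2⟩ := switchWeight_switch hA hw
      rw [switchWeight_eq_one hA hw, switchWeight_eq_one g1 g2]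

lemma Pperp_transpose (N : ℕ) : (Pperp N)ᵀ = Pperp N := by
  ext i j; simp [Pperp, Matrix.one_apply, eq_comm]

lemma Pperp_conjTranspose (N : ℕ) : (Pperp N)ᴴ = Pperp N := by
  ext i j
  simp only [Pperp, Matrix.conjTranspose_apply, Matrix.sub_apply, Matrix.one_apply,
    Matrix.of_apply, star_sub, eq_comm (a := j)]
  split_ifs <;> simp

lemma Pperp_apply {N : ℕ} (i j : Fin N) :
    Pperp N i j = (if i = j then 1 else 0) - (N : ℂ)⁻¹ := by
  simp [Pperp, Matrix.one_apply]

lemma Pperp_mul_self (N : ℕ) : Pperp N * Pperp N = Pperp N := by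
  rcases Nat.eq_zero_or_pos N with rfl | hN
  · ext i; exact i.elim0
  have hN' : (N : ℂ) ≠ 0 := by exact_mod_cast hN.ne'
  ext i j
  simp only [Matrix.mul_apply, Pperp_apply, sub_mul, mul_sub, Finset.sum_sub_distrib]
  simp [hN']

lemma sum_Pperp_apply {N : ℕ} (j : Fin N) : ∑ i, Pperp N i j = 0 := by
  have hN' : (N : ℂ) ≠ 0 := by exact_mod_cast (Fin.pos j).ne'
  simp [Pperp_apply, hN']

section

variable {N d : ℕ} {A A' : Matrix (Fin N) (Fin N) ℝ} {z : ℂ}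

/-- The shifted rescaled adjacency matrix `q⁻¹𝒜 - z`. -/
def shiftMat (N d : ℕ) (A : Matrix (Fin N) (Fin N) ℝ) (z : ℂ) : Matrix (Fin N) (Fin N) ℂ :=
  ((qval N d : ℝ) : ℂ)⁻¹ • A.map Complex.ofReal - z • 1

lemma shiftMat_transpose (hA : IsAdjMat N d A) : (shiftMat N d A z)ᵀ = shiftMat N d A z := by
  have h : (A.map Complex.ofReal)ᵀ = A.map Complex.ofReal := by
    rw [← Matrix.transpose_map, hA.1.eq]
  rw [shiftMat, Matrix.transpose_sub, Matrix.transpose_smul, Matrix.transpose_smul, h,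
    Matrix.transpose_one]

lemma shiftMat_conjTranspose (hA : IsAdjMat N d A) :
    (shiftMat N d A z)ᴴ = shiftMat N d A (star z) := by
  have h : (A.map Complex.ofReal)ᴴ = A.map Complex.ofReal := by
    ext i j
    simp [hA.1.apply j i]
  rw [shiftMat, Matrix.conjTranspose_sub, Matrix.conjTranspose_smul, Matrix.conjTranspose_smul, h,
    Matrix.conjTranspose_one, shiftMat]
  simp

lemma shiftMat_sub_star : shiftMat N d A (star z) - shiftMat N d A z = (z - star z) • 1 := by
  rw [shiftMat, shiftMat, sub_smul]; abel

open scoped ComplexOrder in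
lemma isUnit_det_shiftMat (hA : IsAdjMat N d A) (hz : 0 < z.im) :
    IsUnit (shiftMat N d A z).det := by
  rw [isUnit_iff_ne_zero]
  intro h0
  obtain ⟨v, hv, hv0⟩ := Matrix.exists_mulVec_eq_zero_iff.2 h0
  have h1 : star v ⬝ᵥ (shiftMat N d A (star z) *ᵥ v) = 0 := by
    rw [Matrix.dotProduct_mulVec, ← shiftMat_conjTranspose hA, ← Matrix.star_mulVec, hv0]
    simp
  have h2 : star v ⬝ᵥ ((shiftMat N d A (star z) - shiftMat N d A z) *ᵥ v) = 0 := by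
    rw [Matrix.sub_mulVec, dotProduct_sub, h1, hv0]; simp
  rw [shiftMat_sub_star, Matrix.smul_mulVec, Matrix.one_mulVec, dotProduct_smul,
    smul_eq_mul, mul_eq_zero] at h2
  rcases h2 with h2 | h2
  · have := congrArg Complex.im h2
    simp at this
    linarith
  · exact hv (dotProduct_star_self_eq_zero.1 h2)

lemma Pperp_comm_shiftMat (hA : IsAdjMat N d A) :
    Pperp N * shiftMat N d A z = shiftMat N d A z * Pperp N := by
  have h : Pperp N * A.map Complex.ofReal = A.map Complex.ofReal * Pperp N := by
    ext i j
    have e1 : ∑ x, (A x j : ℂ) = d := by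
      rw [← Complex.ofReal_sum, Finset.sum_congr rfl fun x _ => hA.1.apply j x, hA.2.2.2 j]; simp
    have e2 : ∑ x, (A i x : ℂ) = d := by rw [← Complex.ofReal_sum, hA.2.2.2 i]; simp
    simp only [Matrix.mul_apply, Pperp_apply, sub_mul, mul_sub, Finset.sum_sub_distrib,
      Matrix.map_apply]
    rw [← Finset.mul_sum, ← Finset.sum_mul, e1, e2]
    simp [mul_comm]
  simp only [shiftMat, mul_sub, sub_mul, Matrix.mul_smul, Matrix.smul_mul, h, mul_one, one_mul]

lemma greenM_eq : greenM N d A z = Pperp N * (shiftMat N d A z)⁻¹ * Pperp N := rfl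

lemma shiftMat_mul_greenM (hA : IsAdjMat N d A) (hz : 0 < z.im) :
    shiftMat N d A z * greenM N d A z = Pperp N := by
  rw [greenM_eq, mul_assoc, ← mul_assoc, ← Pperp_comm_shiftMat hA, mul_assoc,
    ← mul_assoc _ _ (Pperp N), Matrix.mul_nonsing_inv _ (isUnit_det_shiftMat hA hz), one_mul, Pperp_mul_self]

lemma greenM_transpose (hA : IsAdjMat N d A) : (greenM N d A z)ᵀ = greenM N d A z := by
  rw [greenM_eq, Matrix.transpose_mul, Matrix.transpose_mul, Matrix.transpose_nonsing_inv,
    shiftMat_transpose hA, Pperp_transpose, mul_assoc]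

lemma greenM_symm (hA : IsAdjMat N d A) (i j : Fin N) :
    greenM N d A z i j = greenM N d A z j i :=
  congrFun (congrFun (greenM_transpose hA (z := z)) j) i

lemma greenM_mul_shiftMat (hA : IsAdjMat N d A) (hz : 0 < z.im) :
    greenM N d A z * shiftMat N d A z = Pperp N := by
  have h := congrArg Matrix.transpose (shiftMat_mul_greenM hA hz)
  rwa [Matrix.transpose_mul, greenM_transpose hA, shiftMat_transpose hA, Pperp_transpose] at h

lemma Pperp_mul_greenM : Pperp N * greenM N d A z = greenM N d A z := by
  rw [greenM_eq, ← mul_assoc, ← mul_assoc, Pperp_mul_self]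

lemma greenM_mul_Pperp : greenM N d A z * Pperp N = greenM N d A z := by
  rw [greenM_eq, mul_assoc, Pperp_mul_self]

lemma sum_greenM_apply (j : Fin N) : ∑ i, greenM N d A z i j = 0 := by
  have h : ∀ i, greenM N d A z i j = ∑ k, Pperp N i k * greenM N d A z k j := fun i => by
    conv_lhs => rw [← Pperp_mul_greenM, Matrix.mul_apply]
  rw [Finset.sum_congr rfl fun i _ => h i, Finset.sum_comm]
  simp_rw [← Finset.sum_mul, sum_Pperp_apply]
  simp

/-- Ward identity. -/
lemma sum_norm_sq_greenM (hA : IsAdjMat N d A) (hz : 0 < z.im) (j : Fin N) :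
    ∑ l, ‖greenM N d A z l j‖ ^ 2 = (greenM N d A z j j).im / z.im := by
  set G := greenM N d A z with hG
  have h1 : Gᴴ * (shiftMat N d A z * G) = Gᴴ := by
    rw [shiftMat_mul_greenM hA hz]
    have := congrArg Matrix.conjTranspose (Pperp_mul_greenM (N := N) (d := d) (A := A) (z := z))
    rwa [Matrix.conjTranspose_mul, Pperp_conjTranspose] at this
  have h2 : Gᴴ * (shiftMat N d A (star z) * G) = G := by
    rw [← shiftMat_conjTranspose hA, ← mul_assoc, ← Matrix.conjTranspose_mul,
      shiftMat_mul_greenM hA hz, Pperp_conjTranspose, Pperp_mul_greenM]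
  have h3 : Gᴴ * ((shiftMat N d A (star z) - shiftMat N d A z) * G) = G - Gᴴ := by
    rw [sub_mul, mul_sub, h1, h2]
  rw [shiftMat_sub_star, Matrix.smul_mul, one_mul, Matrix.mul_smul] at h3
  have h4 := congrArg Complex.im (congrFun (congrFun h3 j) j)
  have h5 : (Gᴴ * G) j j = ((∑ l, ‖G l j‖ ^ 2 : ℝ) : ℂ) := by
    rw [Matrix.mul_apply]; push_cast
    refine Finset.sum_congr rfl fun l _ => ?_
    rw [Matrix.conjTranspose_apply, mul_comm]
    exact Complex.mul_conj' _
  rw [Matrix.smul_apply, h5] at h4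
  simp only [smul_eq_mul, Complex.star_def, Complex.mul_im, Complex.sub_re, Complex.sub_im,
    Complex.conj_re, Complex.conj_im, Complex.ofReal_re, Complex.ofReal_im, Matrix.sub_apply,
    Matrix.conjTranspose_apply] at h4
  rw [eq_div_iff hz.ne']
  linarith

lemma norm_greenM_le (hA : IsAdjMat N d A) (hz : 0 < z.im) (i j : Fin N) :
    ‖greenM N d A z i j‖ ≤ 1 / z.im := by
  have h : ∀ a b, ‖greenM N d A z a b‖ ^ 2 ≤ ‖greenM N d A z b b‖ / z.im := fun a b => by
    calc ‖greenM N d A z a b‖ ^ 2 ≤ ∑ l, ‖greenM N d A z l b‖ ^ 2 :=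
          Finset.single_le_sum (f := fun l => ‖greenM N d A z l b‖ ^ 2)
            (fun _ _ => by positivity) (Finset.mem_univ a)
      _ = (greenM N d A z b b).im / z.im := sum_norm_sq_greenM hA hz b
      _ ≤ _ := by gcongr; exact (le_abs_self _).trans (Complex.abs_im_le_norm _)
  have h1 : ‖greenM N d A z j j‖ ≤ 1 / z.im := by
    by_contra! hlt
    have hpos : 0 < ‖greenM N d A z j j‖ := lt_trans (by positivity) hlt
    have := h j j
    rw [sq, div_eq_mul_one_div] at this
    exact absurd (le_of_mul_le_mul_left this hpos) (not_le.2 hlt)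
  have h2 : ‖greenM N d A z i j‖ ^ 2 ≤ (1 / z.im) ^ 2 := by
    calc _ ≤ ‖greenM N d A z j j‖ / z.im := h i j
      _ ≤ (1 / z.im) / z.im := by gcongr
      _ = _ := by ring
  exact le_of_sq_le_sq h2 (by positivity)

lemma greenM_sub_greenM (hA : IsAdjMat N d A) (hA' : IsAdjMat N d A') (hz : 0 < z.im) :
    greenM N d A z - greenM N d A' z = -(((qval N d : ℝ) : ℂ)⁻¹ •
      (greenM N d A z * (A - A').map Complex.ofReal * greenM N d A' z)) := by
  have h1 : greenM N d A z * (shiftMat N d A z - shiftMat N d A' z) * greenM N d A' z =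
      greenM N d A' z - greenM N d A z := by
    rw [mul_sub, sub_mul, greenM_mul_shiftMat hA hz, mul_assoc, shiftMat_mul_greenM hA' hz,
      greenM_mul_Pperp, Pperp_mul_greenM]
  have h2 : shiftMat N d A z - shiftMat N d A' z =
      ((qval N d : ℝ) : ℂ)⁻¹ • (A - A').map Complex.ofReal := by
    ext i j; simp [shiftMat]; ring
  rw [h2, Matrix.mul_smul, Matrix.smul_mul] at h1
  rw [h1, neg_sub]

lemma mul_Dmat_mul (X Y : Matrix (Fin N) (Fin N) ℂ) (a b x y : Fin N) :
    (X * (Dmat N a b).map Complex.ofReal * Y) x y = X x a * Y b y + X x b * Y a y := by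
  have h : (Dmat N a b).map Complex.ofReal = Matrix.single a b (1 : ℂ) + Matrix.single b a 1 := by
    ext u v
    simp only [Dmat, Matrix.map_apply, Matrix.of_apply, Matrix.add_apply, Matrix.single_apply,
      and_comm (a := a = v)]
    split_ifs <;> simp
  rw [h, mul_add, add_mul, Matrix.add_apply]
  simp [Matrix.mul_apply, Matrix.single_apply, ite_and, Finset.sum_ite_eq]

lemma greenM_switch (hA : IsAdjMat N d A) {i k l m : Fin N}
    (hA' : IsAdjMat N d (A - xiMat N i k l m)) (hz : 0 < z.im) (x y : Fin N) :
    greenM N d A z x y - greenM N d (A - xiMat N i k l m) z x y = -(((qval N d : ℝ) : ℂ)⁻¹ *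
      ((greenM N d A z x i * greenM N d (A - xiMat N i k l m) z k y
        + greenM N d A z x k * greenM N d (A - xiMat N i k l m) z i y)
      + (greenM N d A z x l * greenM N d (A - xiMat N i k l m) z m y
        + greenM N d A z x m * greenM N d (A - xiMat N i k l m) z l y)
      - (greenM N d A z x i * greenM N d (A - xiMat N i k l m) z l y
        + greenM N d A z x l * greenM N d (A - xiMat N i k l m) z i y)
      - (greenM N d A z x k * greenM N d (A - xiMat N i k l m) z m y
        + greenM N d A z x m * greenM N d (A - xiMat N i k l m) z k y))) := by
  have h := congrFun (congrFun (greenM_sub_greenM hA hA' hz) x) y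
  rw [sub_sub_cancel] at h
  rw [Matrix.sub_apply] at h
  rw [h, Matrix.neg_apply, Matrix.smul_apply, smul_eq_mul]
  have e : (xiMat N i k l m).map Complex.ofReal = (Dmat N i k).map Complex.ofReal +
      (Dmat N l m).map Complex.ofReal - (Dmat N i l).map Complex.ofReal
      - (Dmat N k m).map Complex.ofReal := by
    ext u v; simp [xiMat]
  rw [e, mul_sub, mul_sub, mul_add, sub_mul, sub_mul, add_mul]
  simp only [Matrix.sub_apply, Matrix.add_apply, mul_Dmat_mul]

end

/-- The centred rescaled adjacency matrix `q⁻¹(𝒜 - d/N)`. -/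
def hMat (N d : ℕ) (A : Matrix (Fin N) (Fin N) ℝ) : Matrix (Fin N) (Fin N) ℝ :=
  Matrix.of fun i j => (qval N d)⁻¹ * (A i j - d / N)

section

variable {N d : ℕ} {A : Matrix (Fin N) (Fin N) ℝ} {z : ℂ}

lemma qval_sq (hdN : 2 * d ≤ N) : qval N d ^ 2 = d * (N - d) / N := by
  have : (d : ℝ) ≤ N := by exact_mod_cast (by lia : d ≤ N)
  rw [qval, Real.sq_sqrt (by have := sub_nonneg.2 this; positivity)]

lemma qval_sq_mul (hd : 2 ≤ d) (hdN : 2 * d ≤ N) : qval N d ^ 2 * N = d * (N - d) := by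
  have hN : (N : ℝ) ≠ 0 := by exact_mod_cast (by lia : N ≠ 0)
  rw [qval_sq hdN]; field_simp

lemma le_two_mul_qval_sq (hd : 2 ≤ d) (hdN : 2 * d ≤ N) : (d : ℝ) ≤ 2 * qval N d ^ 2 := by
  have h : (2 * d : ℝ) ≤ N := by exact_mod_cast hdN
  have hd' : (2 : ℝ) ≤ d := by exact_mod_cast hd
  rw [qval_sq hdN, ← mul_div_assoc, le_div_iff₀ (by linarith)]
  nlinarith

lemma qval_sq_le (hdN : 2 * d ≤ N) : qval N d ^ 2 ≤ d := by
  rcases Nat.eq_zero_or_pos N with rfl | hN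
  · simp [qval]
  rw [qval_sq hdN, div_le_iff₀ (by exact_mod_cast hN)]
  have : (0 : ℝ) ≤ d := by positivity
  nlinarith

lemma one_le_qval (hd : 2 ≤ d) (hdN : 2 * d ≤ N) : 1 ≤ qval N d := by
  have h1 := le_two_mul_qval_sq hd hdN
  have h2 : (2 : ℝ) ≤ d := by exact_mod_cast hd
  have h3 : 0 ≤ qval N d := Real.sqrt_nonneg _
  nlinarith

lemma qval_pos (hd : 2 ≤ d) (hdN : 2 * d ≤ N) : 0 < qval N d :=
  zero_lt_one.trans_le (one_le_qval hd hdN)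

lemma inv_qval_le_one (hd : 2 ≤ d) (hdN : 2 * d ≤ N) : (qval N d)⁻¹ ≤ 1 :=
  inv_le_one_of_one_le₀ (one_le_qval hd hdN)

lemma inv_le_inv_qval_sq (hd : 2 ≤ d) (hdN : 2 * d ≤ N) : (N : ℝ)⁻¹ ≤ (qval N d)⁻¹ ^ 2 := by
  have h := qval_pos hd hdN
  rw [inv_pow]
  refine inv_anti₀ (by positivity) ((qval_sq_le hdN).trans ?_)
  exact_mod_cast (by lia : d ≤ N)

/-- The total weight of all switchings is at most `4q · Nq³`. -/
lemma deg_sq_mul_le (hd : 2 ≤ d) (hdN : 2 * d ≤ N) :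
    (d : ℝ) ^ 2 * N ≤ 4 * qval N d * (N * qval N d ^ 3) := by
  have h : (d : ℝ) ^ 2 ≤ (2 * qval N d ^ 2) ^ 2 := by
    gcongr; exact le_two_mul_qval_sq hd hdN
  calc (d : ℝ) ^ 2 * N ≤ (2 * qval N d ^ 2) ^ 2 * N := by gcongr
    _ = _ := by ring

lemma deg_sq_le (hd : 2 ≤ d) (hdN : 2 * d ≤ N) :
    (d : ℝ) ^ 2 ≤ 4 * (qval N d)⁻¹ * (N * qval N d ^ 3) := by
  have hq := qval_pos hd hdN
  have hN : qval N d ^ 2 ≤ N :=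
    (qval_sq_le hdN).trans (by exact_mod_cast (by lia : d ≤ N))
  calc (d : ℝ) ^ 2 ≤ (2 * qval N d ^ 2) ^ 2 := by gcongr; exact le_two_mul_qval_sq hd hdN
    _ = 4 * qval N d ^ 2 * qval N d ^ 2 := by ring
    _ ≤ 4 * qval N d ^ 2 * N := by gcongr
    _ = _ := by field_simp

lemma adj_symm (hA : IsAdjMat N d A) (i j : Fin N) : A i j = A j i := hA.1.apply j i

lemma adj_nonneg (hA : IsAdjMat N d A) (i j : Fin N) : 0 ≤ A i j := by
  rcases hA.2.2.1 i j with h | h <;> simp [h]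

lemma adj_le_one (hA : IsAdjMat N d A) (i j : Fin N) : A i j ≤ 1 := by
  rcases hA.2.2.1 i j with h | h <;> simp [h]

lemma sum_adj_left (hA : IsAdjMat N d A) (j : Fin N) : ∑ i, A i j = d := by
  rw [Finset.sum_congr rfl fun i _ => adj_symm hA i j, hA.2.2.2 j]

lemma hMat_symm (hA : IsAdjMat N d A) (i j : Fin N) : hMat N d A i j = hMat N d A j i := by
  simp [hMat, adj_symm hA i j]

lemma hMat_switch (B : Matrix (Fin N) (Fin N) ℝ) :
    hMat N d (A - B) = hMat N d A - (qval N d)⁻¹ • B := by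
  ext i j; simp [hMat]; ring

lemma adj_eq (hd : 2 ≤ d) (hdN : 2 * d ≤ N) (i j : Fin N) :
    A i j = qval N d * hMat N d A i j + d / N := by
  have hq := qval_pos hd hdN
  simp [hMat, hq.ne']

lemma abs_hMat_le (hA : IsAdjMat N d A) (hd : 2 ≤ d) (hdN : 2 * d ≤ N) (i j : Fin N) :
    |hMat N d A i j| ≤ (qval N d)⁻¹ := by
  have hq := qval_pos hd hdN
  have h1 := adj_nonneg hA i j
  have h2 := adj_le_one hA i j
  have h3 : (d : ℝ) / N ≤ 1 := div_le_one_of_le₀ (by exact_mod_cast (by lia)) (by positivity)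
  have h4 : 0 ≤ (d : ℝ) / N := by positivity
  simp only [hMat, Matrix.of_apply, abs_mul, abs_of_pos (inv_pos.2 hq)]
  refine mul_le_of_le_one_right (by positivity) (abs_le.2 ⟨by linarith, by linarith⟩)

lemma sum_hMat (hA : IsAdjMat N d A) (i : Fin N) : ∑ j, hMat N d A i j = 0 := by
  have hN : (N : ℝ) ≠ 0 := by exact_mod_cast (Fin.pos i).ne'
  simp only [hMat, Matrix.of_apply, ← Finset.mul_sum, Finset.sum_sub_distrib, hA.2.2.2 i]
  simp
  right
  field_simp
  simp

lemma sum_abs_hMat_le (hA : IsAdjMat N d A) (hd : 2 ≤ d) (hdN : 2 * d ≤ N) (i : Fin N) :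
    ∑ j, |hMat N d A i j| ≤ 4 * qval N d := by
  have hq := qval_pos hd hdN
  have hN : (N : ℝ) ≠ 0 := by exact_mod_cast (by lia : N ≠ 0)
  calc ∑ j, |hMat N d A i j| ≤ ∑ j, (qval N d)⁻¹ * (A i j + d / N) := by
        refine Finset.sum_le_sum fun j _ => ?_
        simp only [hMat, Matrix.of_apply, abs_mul, abs_of_pos (inv_pos.2 hq)]
        gcongr
        have := adj_nonneg hA i j
        have h4 : 0 ≤ (d : ℝ) / N := by positivity
        exact abs_le.2 ⟨by linarith, by linarith⟩
    _ = (qval N d)⁻¹ * (2 * d) := by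
        rw [← Finset.mul_sum, Finset.sum_add_distrib, hA.2.2.2 i]
        simp
        field_simp
        norm_num
    _ ≤ (qval N d)⁻¹ * (2 * (2 * qval N d ^ 2)) := by
        gcongr; exact le_two_mul_qval_sq hd hdN
    _ = _ := by field_simp; norm_num

lemma hMat_sq_diag (hA : IsAdjMat N d A) (hd : 2 ≤ d) (hdN : 2 * d ≤ N) (i : Fin N) :
    (hMat N d A * hMat N d A) i i = 1 := by
  have hq := qval_pos hd hdN
  have hN : (N : ℝ) ≠ 0 := by exact_mod_cast (by lia : N ≠ 0)
  have h : ∀ j, hMat N d A i j * hMat N d A j i =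
      (qval N d)⁻¹ ^ 2 * (A i j - 2 * (d / N) * A i j + (d / N) ^ 2) := fun j => by
    have h01 : A i j * A i j = A i j := by rcases hA.2.2.1 i j with h | h <;> simp [h]
    simp only [hMat, Matrix.of_apply, adj_symm hA j i]
    linear_combination (qval N d)⁻¹ ^ 2 * h01
  rw [Matrix.mul_apply, Finset.sum_congr rfl fun j _ => h j, ← Finset.mul_sum,
    Finset.sum_add_distrib, Finset.sum_sub_distrib, ← Finset.mul_sum, hA.2.2.2 i]
  simp only [Finset.sum_const, Finset.card_univ, Fintype.card_fin, nsmul_eq_mul]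
  have h2 := qval_sq_mul hd hdN
  field_simp
  linear_combination -h2

lemma abs_hMat_sq_le (hA : IsAdjMat N d A) (hd : 2 ≤ d) (hdN : 2 * d ≤ N) (i j : Fin N) :
    |(hMat N d A * hMat N d A) i j| ≤ 1 := by
  have h1 := hMat_sq_diag hA hd hdN i
  have h2 := hMat_sq_diag hA hd hdN j
  rw [Matrix.mul_apply] at h1 h2 ⊢
  have h3 := Finset.sum_mul_sq_le_sq_mul_sq Finset.univ (fun k => hMat N d A i k)
    (fun k => hMat N d A k j)
  have e1 : ∑ k, hMat N d A i k ^ 2 = 1 := by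
    rw [← h1]; exact Finset.sum_congr rfl fun k _ => by rw [sq, hMat_symm hA k i]
  have e2 : ∑ k, hMat N d A k j ^ 2 = 1 := by
    rw [← h2]; exact Finset.sum_congr rfl fun k _ => by rw [sq, hMat_symm hA j k]
  rw [e1, e2, mul_one] at h3
  exact abs_le_one_iff_mul_self_le_one.2 (by rwa [← sq])

lemma adj_sq_apply (hA : IsAdjMat N d A) (hd : 2 ≤ d) (hdN : 2 * d ≤ N) (i j : Fin N) :
    (A * A) i j = qval N d ^ 2 * (hMat N d A * hMat N d A) i j + d ^ 2 / N := by
  have hN : (N : ℝ) ≠ 0 := by exact_mod_cast (by lia : N ≠ 0)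
  have h : ∀ k, A i k * A k j = qval N d ^ 2 * (hMat N d A i k * hMat N d A k j) +
      d / N * qval N d * hMat N d A i k + d / N * qval N d * hMat N d A j k + (d / N) ^ 2 :=
    fun k => by
      rw [adj_eq (A := A) hd hdN i k, adj_eq (A := A) hd hdN k j, hMat_symm hA j k]; ring
  rw [Matrix.mul_apply, Matrix.mul_apply, Finset.sum_congr rfl fun k _ => h k]
  simp only [Finset.sum_add_distrib, ← Finset.mul_sum, sum_hMat hA]
  simp
  field_simp

lemma sum_hMat_sq (hA : IsAdjMat N d A) (j : Fin N) :
    ∑ i, (hMat N d A * hMat N d A) i j = 0 := by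
  simp only [Matrix.mul_apply]
  rw [Finset.sum_comm]
  simp only [← Finset.sum_mul]
  refine Finset.sum_eq_zero fun k _ => ?_
  rw [Finset.sum_congr rfl fun i _ => hMat_symm hA i k, sum_hMat hA, zero_mul]

lemma adj_cube_apply (hA : IsAdjMat N d A) (hd : 2 ≤ d) (hdN : 2 * d ≤ N) (i j : Fin N) :
    (A * (A * A)) i j =
      qval N d ^ 3 * (hMat N d A * (hMat N d A * hMat N d A)) i j + d ^ 3 / N := by
  have hN : (N : ℝ) ≠ 0 := by exact_mod_cast (by lia : N ≠ 0)
  have h : ∀ k, A i k * (A * A) k j =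
      qval N d ^ 3 * (hMat N d A i k * (hMat N d A * hMat N d A) k j) +
      d ^ 2 / N * qval N d * hMat N d A i k +
      d / N * qval N d ^ 2 * (hMat N d A * hMat N d A) k j + d / N * (d ^ 2 / N) :=
    fun k => by
      rw [adj_eq (A := A) hd hdN i k, adj_sq_apply hA hd hdN]; ring
  rw [Matrix.mul_apply, Matrix.mul_apply, Finset.sum_congr rfl fun k _ => h k]
  simp only [Finset.sum_add_distrib, ← Finset.mul_sum, sum_hMat hA, sum_hMat_sq hA]
  simp
  field_simp

lemma sum_hMat_mul_greenM (hA : IsAdjMat N d A) (hz : 0 < z.im) (i j : Fin N) :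
    ∑ k, (hMat N d A i k : ℂ) * greenM N d A z k j =
      z * greenM N d A z i j + (if i = j then 1 else 0) - (N : ℂ)⁻¹ := by
  have h := congrFun (congrFun (shiftMat_mul_greenM hA hz) i) j
  rw [shiftMat, sub_mul, Matrix.smul_mul, Matrix.smul_mul, one_mul, Matrix.sub_apply,
    Matrix.smul_apply, Matrix.smul_apply, Matrix.mul_apply, Pperp_apply, Finset.smul_sum] at h
  have e : ∀ k, (hMat N d A i k : ℂ) * greenM N d A z k j =
      ((qval N d : ℝ) : ℂ)⁻¹ • (A.map Complex.ofReal i k * greenM N d A z k j) -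
        ((qval N d : ℝ) : ℂ)⁻¹ * (d / N) * greenM N d A z k j := fun k => by
    simp [hMat]; ring
  rw [Finset.sum_congr rfl fun k _ => e k, Finset.sum_sub_distrib, ← Finset.mul_sum,
    sum_greenM_apply, mul_zero, sub_zero]
  rw [smul_eq_mul] at h
  linear_combination h

end

section

variable {N d : ℕ} {A : Matrix (Fin N) (Fin N) ℝ}

lemma sum_chi (hA : IsAdjMat N d A) (i k l : Fin N) :
    ∑ m, chi N A i k l m = A i k * (1 - A i l) * (d - (A * A) k l) := by
  have h : ∀ m, chi N A i k l m = A i k * (1 - A i l) * (A l m - A k m * A m l) := fun m => by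
    rw [chi, adj_symm hA m l]; ring
  rw [Finset.sum_congr rfl fun m _ => h m, ← Finset.mul_sum, Finset.sum_sub_distrib,
    hA.2.2.2 l, Matrix.mul_apply]

lemma adj_sq_symm (hA : IsAdjMat N d A) (k l : Fin N) : (A * A) k l = (A * A) l k := by
  have h : (A * A)ᵀ = A * A := by rw [Matrix.transpose_mul, hA.1.eq]
  exact congrFun (congrFun h l) k

lemma sum_adj_sq (hA : IsAdjMat N d A) (k : Fin N) : ∑ l, (A * A) k l = d ^ 2 := by
  simp only [Matrix.mul_apply]
  rw [Finset.sum_comm]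
  simp only [← Finset.mul_sum, hA.2.2.2, ← Finset.sum_mul]
  ring

lemma sum_chi_mul_sub_real (hA : IsAdjMat N d A) (hd : 2 ≤ d) (hdN : 2 * d ≤ N) (i : Fin N)
    (Y : Fin N → ℝ) :
    ∑ k, ∑ l, ∑ m, chi N A i k l m * (Y k - Y l) =
      N * qval N d ^ 3 * ∑ k, hMat N d A i k * Y k +
        qval N d ^ 3 * ∑ k, (hMat N d A * (hMat N d A * hMat N d A)) i k * Y k := by
  have hN : (N : ℝ) ≠ 0 := by exact_mod_cast (by lia : N ≠ 0)
  have h0 : ∑ k, ∑ l, A i k * A i l * (d - (A * A) k l) * (Y k - Y l) = 0 := by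
    have h : ∑ k, ∑ l, A i k * A i l * (d - (A * A) k l) * (Y k - Y l) =
        -∑ k, ∑ l, A i k * A i l * (d - (A * A) k l) * (Y k - Y l) := by
      conv_lhs => rw [Finset.sum_comm]
      rw [← Finset.sum_neg_distrib]
      refine Finset.sum_congr rfl fun k _ => ?_
      rw [← Finset.sum_neg_distrib]
      refine Finset.sum_congr rfl fun l _ => ?_
      rw [adj_sq_symm hA l k]; ring
    linarith
  have h1 : ∀ k l, ∑ m, chi N A i k l m * (Y k - Y l) =
      (A i k * Y k * (d - (A * A) k l) - A i k * (d - (A * A) k l) * Y l) -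
        A i k * A i l * (d - (A * A) k l) * (Y k - Y l) := fun k l => by
    rw [← Finset.sum_mul, sum_chi hA]; ring
  simp only [h1, Finset.sum_sub_distrib, h0, sub_zero]
  have h2 : ∑ k, ∑ l, A i k * Y k * (d - (A * A) k l) =
      (N * d - d ^ 2) * ∑ k, A i k * Y k := by
    rw [Finset.mul_sum]
    refine Finset.sum_congr rfl fun k _ => ?_
    rw [← Finset.mul_sum, Finset.sum_sub_distrib, sum_adj_sq hA]
    simp; ring
  have h3 : ∑ k, ∑ l, A i k * (d - (A * A) k l) * Y l =
      ∑ l, (d ^ 2 - (A * (A * A)) i l) * Y l := by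
    rw [Finset.sum_comm]
    refine Finset.sum_congr rfl fun l _ => ?_
    rw [← Finset.sum_mul, Matrix.mul_apply]
    simp only [mul_sub, Finset.sum_sub_distrib, ← Finset.sum_mul, hA.2.2.2]
    ring
  rw [h2, h3, Finset.mul_sum, Finset.mul_sum, Finset.mul_sum, ← Finset.sum_sub_distrib,
    ← Finset.sum_add_distrib]
  refine Finset.sum_congr rfl fun k _ => ?_
  rw [adj_cube_apply hA hd hdN, adj_eq (A := A) hd hdN i k]
  have h4 := qval_sq_mul hd hdN
  field_simp
  linear_combination (-(N * qval N d * hMat N d A i k) * Y k) * h4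

lemma sum_chi_mul_real (hA : IsAdjMat N d A) (hd : 2 ≤ d) (hdN : 2 * d ≤ N) (i : Fin N)
    (Y : Fin N → ℝ) :
    ∑ k, ∑ l, ∑ m, chi N A i k l m * Y l =
      qval N d ^ 4 * ∑ l, Y l - qval N d ^ 3 * d * ∑ l, hMat N d A i l * Y l -
        (1 - d / N) * qval N d ^ 3 *
          ∑ l, (hMat N d A * (hMat N d A * hMat N d A)) i l * Y l +
        qval N d ^ 4 *
          ∑ l, hMat N d A i l * (hMat N d A * (hMat N d A * hMat N d A)) i l * Y l := by
  have hN : (N : ℝ) ≠ 0 := by exact_mod_cast (by lia : N ≠ 0)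
  have h1 : ∀ k l, ∑ m, chi N A i k l m * Y l =
      (d * A i k - A i k * (A * A) k l) * ((1 - A i l) * Y l) := fun k l => by
    rw [← Finset.sum_mul, sum_chi hA]; ring
  simp only [h1]
  rw [Finset.sum_comm]
  simp only [← Finset.sum_mul, Finset.sum_sub_distrib, ← Finset.mul_sum, hA.2.2.2 i]
  simp only [← Matrix.mul_apply, Finset.mul_sum]
  rw [← Finset.sum_sub_distrib, ← Finset.sum_sub_distrib, ← Finset.sum_add_distrib]
  refine Finset.sum_congr rfl fun l _ => ?_
  rw [adj_cube_apply hA hd hdN, adj_eq (A := A) hd hdN i l]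
  have h4 := qval_sq_mul hd hdN
  have h5 : qval N d ^ 4 * N ^ 2 = (d * (N - d)) ^ 2 := by rw [← h4]; ring
  field_simp
  linear_combination (-Y l) * h5 + Y l * N * qval N d * hMat N d A i l * d * h4

lemma sum_chi_mul_sub (hA : IsAdjMat N d A) (hd : 2 ≤ d) (hdN : 2 * d ≤ N) (i : Fin N)
    (Y : Fin N → ℂ) :
    ∑ k, ∑ l, ∑ m, (chi N A i k l m : ℂ) * (Y k - Y l) =
      ((N * qval N d ^ 3 : ℝ) : ℂ) * ∑ k, (hMat N d A i k : ℂ) * Y k +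
        ((qval N d ^ 3 : ℝ) : ℂ) *
          ∑ k, ((hMat N d A * (hMat N d A * hMat N d A)) i k : ℂ) * Y k := by
  apply Complex.ext
  · simp only [Complex.re_sum, Complex.re_ofReal_mul, Complex.add_re, Complex.sub_re]
    exact sum_chi_mul_sub_real hA hd hdN i fun k => (Y k).re
  · simp only [Complex.im_sum, Complex.im_ofReal_mul, Complex.add_im, Complex.sub_im]
    exact sum_chi_mul_sub_real hA hd hdN i fun k => (Y k).im

lemma sum_chi_mul (hA : IsAdjMat N d A) (hd : 2 ≤ d) (hdN : 2 * d ≤ N) (i : Fin N)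
    (Y : Fin N → ℂ) :
    ∑ k, ∑ l, ∑ m, (chi N A i k l m : ℂ) * Y l =
      ((qval N d ^ 4 : ℝ) : ℂ) * ∑ l, Y l -
        ((qval N d ^ 3 * d : ℝ) : ℂ) * ∑ l, (hMat N d A i l : ℂ) * Y l -
        (((1 - d / N) * qval N d ^ 3 : ℝ) : ℂ) *
          ∑ l, ((hMat N d A * (hMat N d A * hMat N d A)) i l : ℂ) * Y l +
        ((qval N d ^ 4 : ℝ) : ℂ) * ∑ l,
          ((hMat N d A i l * (hMat N d A * (hMat N d A * hMat N d A)) i l : ℝ) : ℂ) * Y l := by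
  apply Complex.ext
  · simp only [Complex.re_sum, Complex.re_ofReal_mul, Complex.add_re, Complex.sub_re]
    exact sum_chi_mul_real hA hd hdN i fun k => (Y k).re
  · simp only [Complex.im_sum, Complex.im_ofReal_mul, Complex.add_im, Complex.sub_im]
    exact sum_chi_mul_real hA hd hdN i fun k => (Y k).im

lemma sum_triple {M : Type*} [AddCommMonoid M] (f : Fin N × Fin N × Fin N → M) :
    ∑ s, f s = ∑ k, ∑ l, ∑ m, f (k, l, m) := by
  rw [Fintype.sum_prod_type]
  exact Finset.sum_congr rfl fun k _ => Fintype.sum_prod_type _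

lemma chi_sub_switchWeight_le (hA : IsAdjMat N d A) (i k l m : Fin N) :
    |chi N A i k l m - switchWeight i A (k, l, m)| ≤
      (if i = l then A i k * A i m else 0) + if k = m then A i k * A l k else 0 := by
  simp only [switchWeight, chi]
  by_cases h1 : i = l
  · subst h1
    rcases hA.2.2.1 i k with a | a <;> rcases hA.2.2.1 i m with b | b <;>
    rcases hA.2.2.1 k m with c | c <;> by_cases e : k = m <;> simp [a, b, c, e, hA.2.1]
  · by_cases h2 : k = m
    · subst h2
      simp only [h1, hA.2.1, if_true, if_false]
      rcases hA.2.2.1 i k with a | a <;> rcases hA.2.2.1 l k with b | b <;>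
      rcases hA.2.2.1 i l with c | c <;> simp [a, b, c]
    · simp [h1, h2]

lemma norm_sum_switchWeight_sub_le (hA : IsAdjMat N d A) (i : Fin N)
    (f : Fin N × Fin N × Fin N → ℂ) {B : ℝ} (hf : ∀ s, ‖f s‖ ≤ B) :
    ‖∑ s, (switchWeight i A s : ℂ) * f s -
      ∑ k, ∑ l, ∑ m, (chi N A i k l m : ℂ) * f (k, l, m)‖ ≤ 2 * d ^ 2 * B := by
  rw [← sum_triple fun s => (chi N A i s.1 s.2.1 s.2.2 : ℂ) * f s, ← Finset.sum_sub_distrib]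
  calc _ ≤ ∑ s : Fin N × Fin N × Fin N, ((if i = s.2.1 then A i s.1 * A i s.2.2 else 0) +
        if s.1 = s.2.2 then A i s.1 * A s.2.1 s.1 else 0) * B := by
        refine norm_sum_le_of_le _ fun s _ => ?_
        rw [← sub_mul, norm_mul, ← Complex.ofReal_sub, Complex.norm_real, norm_sub_rev]
        exact mul_le_mul (chi_sub_switchWeight_le hA i s.1 s.2.1 s.2.2) (hf s) (norm_nonneg _)
          ((abs_nonneg _).trans (chi_sub_switchWeight_le hA i s.1 s.2.1 s.2.2))
    _ = 2 * d ^ 2 * B := by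
        rw [← Finset.sum_mul, sum_triple]
        congr 1
        simp only [Finset.sum_add_distrib]
        have e1 : ∀ k : Fin N, ∑ l, ∑ m, (if i = l then A i k * A i m else 0) = A i k * d :=
          fun k => by
            simp only [← hA.2.2.2 i, Finset.mul_sum]
            rw [Finset.sum_comm]
            simp
        have e2 : ∀ k : Fin N, ∑ l, ∑ m, (if k = m then A i k * A l k else 0) = A i k * d :=
          fun k => by
            simp only [← sum_adj_left hA k, Finset.mul_sum]
            simp
        simp only [e1, e2, ← Finset.sum_mul, hA.2.2.2 i]
        ring

lemma switchWeight_le (hA : IsAdjMat N d A) (i : Fin N) (s : Fin N × Fin N × Fin N) :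
    switchWeight i A s ≤ A i s.1 * A s.2.1 s.2.2 := by
  by_cases h : switchWeight i A s = 0
  · rw [h]; exact mul_nonneg (adj_nonneg hA _ _) (adj_nonneg hA _ _)
  · obtain ⟨h1, -, h3, -⟩ := (switchWeight_ne_zero hA).1 h
    rw [switchWeight_eq_one hA h, h1, h3, mul_one]

lemma sum_switchWeight_mul_le (hA : IsAdjMat N d A) (i : Fin N) {f : Fin N → Fin N → ℝ} {B : ℝ}
    (hf : ∀ k l, 0 ≤ f k l) (hB : ∀ k, ∑ l, f k l ≤ B) :
    ∑ s, switchWeight i A s * f s.1 s.2.1 ≤ d ^ 2 * B := by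
  calc _ ≤ ∑ s : Fin N × Fin N × Fin N, A i s.1 * A s.2.1 s.2.2 * f s.1 s.2.1 :=
        Finset.sum_le_sum fun s _ =>
          mul_le_mul_of_nonneg_right (switchWeight_le hA i s) (hf _ _)
    _ = ∑ k, A i k * (d * ∑ l, f k l) := by
        rw [sum_triple]
        refine Finset.sum_congr rfl fun k _ => ?_
        rw [Finset.mul_sum, Finset.mul_sum]
        refine Finset.sum_congr rfl fun l _ => ?_
        dsimp only
        rw [← Finset.sum_mul, ← Finset.mul_sum, hA.2.2.2 l]; ring
    _ ≤ ∑ k, A i k * (d * B) := by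
        refine Finset.sum_le_sum fun k _ => mul_le_mul_of_nonneg_left ?_ (adj_nonneg hA _ _)
        gcongr; exact hB k
    _ = _ := by rw [← Finset.sum_mul, hA.2.2.2 i]; ring

lemma sum_switchWeight_mul_le' (hA : IsAdjMat N d A) (i : Fin N) {f : Fin N → ℝ} {B : ℝ}
    (hf : ∀ m, 0 ≤ f m) (hB : ∑ m, f m ≤ B) :
    ∑ s, switchWeight i A s * f s.2.2 ≤ d ^ 2 * B := by
  calc _ ≤ ∑ s : Fin N × Fin N × Fin N, A i s.1 * A s.2.1 s.2.2 * f s.2.2 :=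
        Finset.sum_le_sum fun s _ => mul_le_mul_of_nonneg_right (switchWeight_le hA i s) (hf _)
    _ = ∑ k, A i k * (d * ∑ m, f m) := by
        rw [sum_triple]
        refine Finset.sum_congr rfl fun k _ => ?_
        rw [Finset.sum_comm, Finset.mul_sum, Finset.mul_sum]
        refine Finset.sum_congr rfl fun l _ => ?_
        dsimp only
        rw [← Finset.sum_mul, ← Finset.mul_sum, sum_adj_left hA l]; ring
    _ = d ^ 2 * ∑ m, f m := by rw [← Finset.sum_mul, hA.2.2.2 i]; ring
    _ ≤ _ := by gcongr

lemma sum_switchWeight_le (hA : IsAdjMat N d A) (i : Fin N) :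
    ∑ s, switchWeight i A s ≤ d ^ 2 * N := by
  simpa using sum_switchWeight_mul_le hA i (f := fun _ _ => 1) (B := N)
    (fun _ _ => zero_le_one) (fun _ => by simp)

end

section

variable {N d : ℕ} {A : Matrix (Fin N) (Fin N) ℝ}

/-- The normalisation `Nq³` of sums over switchings. -/
def switchNorm (N d : ℕ) : ℝ := N * qval N d ^ 3

lemma switchNorm_pos (hd : 2 ≤ d) (hdN : 2 * d ≤ N) : 0 < switchNorm N d := by
  have hq := qval_pos hd hdN
  have hN : (0 : ℝ) < N := by exact_mod_cast (by lia : 0 < N)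
  unfold switchNorm; positivity

lemma inv_switchNorm_mul_le (hd : 2 ≤ d) (hdN : 2 * d ≤ N) :
    (switchNorm N d)⁻¹ * d ^ 2 ≤ 4 * (qval N d)⁻¹ := by
  rw [inv_mul_le_iff₀ (switchNorm_pos hd hdN), mul_comm]
  exact deg_sq_le hd hdN

/-- The cube of the centred rescaled adjacency matrix. -/
def hCube (N d : ℕ) (A : Matrix (Fin N) (Fin N) ℝ) : Matrix (Fin N) (Fin N) ℝ :=
  hMat N d A * (hMat N d A * hMat N d A)

lemma norm_potential_sub_le (hA : IsAdjMat N d A) (hd : 2 ≤ d) (hdN : 2 * d ≤ N) (i : Fin N)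
    (Y : Fin N → ℂ) {B : ℝ} (hB : ∀ k, ‖Y k‖ ≤ B) :
    ‖(∑ k, (hMat N d A i k : ℂ) * Y k) + (N : ℂ)⁻¹ * ∑ k, (hCube N d A i k : ℂ) * Y k -
      ((switchNorm N d : ℝ) : ℂ)⁻¹ * ∑ s, (switchWeight i A s : ℂ) * (Y s.1 - Y s.2.1)‖ ≤
      16 * (qval N d)⁻¹ * B := by
  have hn := switchNorm_pos hd hdN
  have hq := qval_pos hd hdN
  have hN : (N : ℂ) ≠ 0 := by exact_mod_cast (by lia : N ≠ 0)
  have hqc : ((qval N d : ℝ) : ℂ) ≠ 0 := by exact_mod_cast hq.ne'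
  have hB0 : 0 ≤ B := (norm_nonneg _).trans (hB i)
  have h1 := sum_chi_mul_sub hA hd hdN i Y
  have h2 := norm_sum_switchWeight_sub_le hA i (fun s => Y s.1 - Y s.2.1) (B := 2 * B)
    fun s => (norm_sub_le _ _).trans (by linarith [hB s.1, hB s.2.1])
  simp only [h1] at h2
  have h3 : (∑ k, (hMat N d A i k : ℂ) * Y k) + (N : ℂ)⁻¹ * ∑ k, (hCube N d A i k : ℂ) * Y k -
      ((switchNorm N d : ℝ) : ℂ)⁻¹ * ∑ s, (switchWeight i A s : ℂ) * (Y s.1 - Y s.2.1) =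
      -(((switchNorm N d : ℝ) : ℂ)⁻¹ * (∑ s, (switchWeight i A s : ℂ) * (Y s.1 - Y s.2.1) -
        (((N * qval N d ^ 3 : ℝ) : ℂ) * ∑ k, (hMat N d A i k : ℂ) * Y k +
        ((qval N d ^ 3 : ℝ) : ℂ) *
          ∑ k, ((hMat N d A * (hMat N d A * hMat N d A)) i k : ℂ) * Y k))) := by
    simp only [switchNorm, hCube]
    push_cast
    field_simp
    ring
  rw [h3, norm_neg, norm_mul, norm_inv, Complex.norm_real, Real.norm_of_nonneg hn.le]
  calc _ ≤ (switchNorm N d)⁻¹ * (2 * d ^ 2 * (2 * B)) := by gcongr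
    _ = (switchNorm N d)⁻¹ * d ^ 2 * (4 * B) := by ring
    _ ≤ 4 * (qval N d)⁻¹ * (4 * B) :=
        mul_le_mul_of_nonneg_right (inv_switchNorm_mul_le hd hdN) (by positivity)
    _ = _ := by ring

lemma norm_sum_switchWeight_mul_le (hA : IsAdjMat N d A) (i : Fin N)
    (f : Fin N × Fin N × Fin N → ℂ) :
    ‖∑ s, (switchWeight i A s : ℂ) * f s‖ ≤ ∑ s, switchWeight i A s * ‖f s‖ :=
  norm_sum_le_of_le _ fun s _ => by
    rw [norm_mul, Complex.norm_real, Real.norm_of_nonneg (switchWeight_nonneg hA s)]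

lemma norm_potential_switch_sub_le (hA : IsAdjMat N d A) (hd : 2 ≤ d) (hdN : 2 * d ≤ N)
    (i : Fin N) (Y : Fin N → ℂ) (Y' : Fin N × Fin N × Fin N → ℂ) {B : ℝ} (hB : ∀ k, ‖Y k‖ ≤ B) :
    ‖(∑ k, (hMat N d A i k : ℂ) * Y k) + (N : ℂ)⁻¹ * ∑ k, (hCube N d A i k : ℂ) * Y k -
      ((switchNorm N d : ℝ) : ℂ)⁻¹ * ∑ s, (switchWeight i A s : ℂ) * (Y s.1 - Y' s)‖ ≤
      16 * (qval N d)⁻¹ * B +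
        (switchNorm N d)⁻¹ * ∑ s, switchWeight i A s * ‖Y s.2.1 - Y' s‖ := by
  have hn := switchNorm_pos hd hdN
  have h1 := norm_potential_sub_le hA hd hdN i Y hB
  have h2 := norm_sum_switchWeight_mul_le hA i fun s => Y s.2.1 - Y' s
  have h3 : ∑ s, (switchWeight i A s : ℂ) * (Y s.1 - Y' s) =
      ∑ s, (switchWeight i A s : ℂ) * (Y s.1 - Y s.2.1) +
        ∑ s, (switchWeight i A s : ℂ) * (Y s.2.1 - Y' s) := by
    rw [← Finset.sum_add_distrib]
    exact Finset.sum_congr rfl fun s _ => by ring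
  rw [h3, mul_add, ← sub_sub]
  refine (norm_sub_le _ _).trans (add_le_add h1 ?_)
  rw [norm_mul, norm_inv, Complex.norm_real, Real.norm_of_nonneg hn.le]
  gcongr

lemma norm_average_sub_le (hA : IsAdjMat N d A) (hd : 2 ≤ d) (hdN : 2 * d ≤ N) (i : Fin N)
    (Y : Fin N → ℂ) {B Λ : ℝ} (hB : ∀ k, ‖Y k‖ ≤ B) (hΛ : ∀ k, |hCube N d A i k| ≤ Λ) :
    ‖(((qval N d)⁻¹ * (switchNorm N d)⁻¹ : ℝ) : ℂ) * ∑ s, (switchWeight i A s : ℂ) * Y s.2.1 -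
      ((N : ℂ)⁻¹ * ∑ k, Y k -
        ((d * (qval N d)⁻¹ / N : ℝ) : ℂ) * ∑ k, (hMat N d A i k : ℂ) * Y k)‖ ≤
      (8 * (qval N d)⁻¹ ^ 2 + 2 * (qval N d)⁻¹ * Λ) * B := by
  have hn := switchNorm_pos hd hdN
  have hq := qval_pos hd hdN
  have hN0 : (0 : ℝ) < N := by exact_mod_cast (by lia : 0 < N)
  have hN : (N : ℂ) ≠ 0 := by exact_mod_cast (by lia : N ≠ 0)
  have hqc : ((qval N d : ℝ) : ℂ) ≠ 0 := by exact_mod_cast hq.ne'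
  have hB0 : 0 ≤ B := (norm_nonneg _).trans (hB i)
  have hΛ0 : 0 ≤ Λ := (abs_nonneg _).trans (hΛ i)
  have h1 := sum_chi_mul hA hd hdN i Y
  have h2 := norm_sum_switchWeight_sub_le hA i (fun s => Y s.2.1) (B := B) fun s => hB _
  simp only [h1] at h2
  set W := ∑ s, (switchWeight i A s : ℂ) * Y s.2.1
  set T := ((qval N d ^ 4 : ℝ) : ℂ) * ∑ l, Y l -
        ((qval N d ^ 3 * d : ℝ) : ℂ) * ∑ l, (hMat N d A i l : ℂ) * Y l -
        (((1 - d / N) * qval N d ^ 3 : ℝ) : ℂ) *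
          ∑ l, ((hMat N d A * (hMat N d A * hMat N d A)) i l : ℂ) * Y l +
        ((qval N d ^ 4 : ℝ) : ℂ) * ∑ l,
          ((hMat N d A i l * (hMat N d A * (hMat N d A * hMat N d A)) i l : ℝ) : ℂ) * Y l with hT
  set S3 := ∑ l, (hCube N d A i l : ℂ) * Y l with hS3
  set S4 := ∑ l, ((hMat N d A i l * hCube N d A i l : ℝ) : ℂ) * Y l with hS4
  have h3 : (((qval N d)⁻¹ * (switchNorm N d)⁻¹ : ℝ) : ℂ) * W -
      ((N : ℂ)⁻¹ * ∑ k, Y k -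
        ((d * (qval N d)⁻¹ / N : ℝ) : ℂ) * ∑ k, (hMat N d A i k : ℂ) * Y k) =
      (((qval N d)⁻¹ * (switchNorm N d)⁻¹ : ℝ) : ℂ) * (W - T) -
        (((1 - d / N) * (qval N d)⁻¹ / N : ℝ) : ℂ) * S3 + (N : ℂ)⁻¹ * S4 := by
    simp only [hT, switchNorm, hS3, hS4, hCube]
    push_cast
    field_simp
    ring
  have hs3 : ‖S3‖ ≤ N * (Λ * B) := by
    refine (norm_sum_le_of_le (f := fun l => (hCube N d A i l : ℂ) * Y l)
      (n := fun _ => Λ * B) _ fun l _ => ?_).trans (by simp)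
    rw [norm_mul, Complex.norm_real]
    exact mul_le_mul (hΛ l) (hB l) (norm_nonneg _) hΛ0
  have hs4 : ‖S4‖ ≤ N * ((qval N d)⁻¹ * Λ * B) := by
    refine (norm_sum_le_of_le (f := fun l => ((hMat N d A i l * hCube N d A i l : ℝ) : ℂ) * Y l)
      (n := fun _ => (qval N d)⁻¹ * Λ * B) _ fun l _ => ?_).trans (by simp)
    rw [norm_mul, Complex.norm_real, Real.norm_eq_abs, abs_mul]
    have := abs_hMat_le hA hd hdN i l
    have := hΛ l
    have := hB l
    gcongr
  have hρ : |1 - (d : ℝ) / N| ≤ 1 := by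
    have h4 : (d : ℝ) / N ≤ 1 := div_le_one_of_le₀ (by exact_mod_cast (by lia)) (by positivity)
    have h5 : 0 ≤ (d : ℝ) / N := by positivity
    exact abs_le.2 ⟨by linarith, by linarith⟩
  rw [h3]
  calc _ ≤ (qval N d)⁻¹ * (switchNorm N d)⁻¹ * (2 * d ^ 2 * B) +
        1 * (qval N d)⁻¹ / N * (N * (Λ * B)) + (N : ℝ)⁻¹ * (N * ((qval N d)⁻¹ * Λ * B)) := by
        refine (norm_add_le _ _).trans (add_le_add ((norm_sub_le _ _).trans
          (add_le_add ?_ ?_)) ?_)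
        · rw [norm_mul, Complex.norm_real, Real.norm_of_nonneg (by positivity)]
          gcongr
        · rw [norm_mul, Complex.norm_real, Real.norm_eq_abs, abs_div, abs_mul, abs_of_pos hN0,
            abs_of_pos (inv_pos.2 hq)]
          gcongr
        · rw [norm_mul, norm_inv, Complex.norm_natCast]
          gcongr
    _ = (switchNorm N d)⁻¹ * d ^ 2 * (2 * (qval N d)⁻¹ * B) + 2 * (qval N d)⁻¹ * Λ * B := by
        field_simp; ring
    _ ≤ 4 * (qval N d)⁻¹ * (2 * (qval N d)⁻¹ * B) + 2 * (qval N d)⁻¹ * Λ * B :=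
        add_le_add (mul_le_mul_of_nonneg_right (inv_switchNorm_mul_le hd hdN) (by positivity))
          le_rfl
    _ = _ := by ring

lemma sum_abs_Dmat_le (N : ℕ) (a b x : Fin N) : ∑ y, |Dmat N a b x y| ≤ 2 := by
  have h : ∀ y, |Dmat N a b x y| = Dmat N a b x y := fun y => abs_of_nonneg (by
    simp only [Dmat, Matrix.of_apply]; split_ifs <;> norm_num)
  simp only [h, sum_Dmat_apply]
  split_ifs <;> norm_num

lemma sum_abs_xiMat_le (N : ℕ) (i k l m x : Fin N) : ∑ y, |xiMat N i k l m x y| ≤ 8 := by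
  have h : ∀ y, |xiMat N i k l m x y| ≤ |Dmat N i k x y| + |Dmat N l m x y| +
      |Dmat N i l x y| + |Dmat N k m x y| := fun y => by
    simp only [xiMat, Matrix.add_apply, Matrix.sub_apply]
    exact (abs_sub _ _).trans (add_le_add ((abs_sub _ _).trans
      (add_le_add (abs_add_le _ _) le_rfl)) le_rfl)
  refine (Finset.sum_le_sum fun y _ => h y).trans ?_
  simp only [Finset.sum_add_distrib]
  linarith [sum_abs_Dmat_le N i k x, sum_abs_Dmat_le N l m x, sum_abs_Dmat_le N i l x,
    sum_abs_Dmat_le N k m x]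

end

section

variable {N d : ℕ} {A A' : Matrix (Fin N) (Fin N) ℝ}

lemma four_mul_qval_le (hd : 2 ≤ d) (hdN : 2 * d ≤ N) : 4 * qval N d ≤ (N : ℝ) ^ 4 := by
  have hN : (4 : ℝ) ≤ N := by exact_mod_cast (by lia : 4 ≤ N)
  have h1 : qval N d ^ 2 ≤ N :=
    (qval_sq_le hdN).trans (by exact_mod_cast (by lia : d ≤ N))
  have h2 := one_le_qval hd hdN
  have h3 : qval N d ≤ N := by nlinarith
  have h4 : (N : ℝ) ^ 2 ≤ (N : ℝ) ^ 4 := pow_le_pow_right₀ (by linarith) (by norm_num)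
  nlinarith

lemma regSwitch_sum_le (hA : IsAdjMat N d A) (hd : 2 ≤ d) (hdN : 2 * d ≤ N) (i : Fin N) :
    ∑ s, (regSwitch N d i).w A s ≤ (N : ℝ) ^ 4 * switchNorm N d := by
  have hn := switchNorm_pos hd hdN
  calc _ ≤ (d : ℝ) ^ 2 * N := sum_switchWeight_le hA i
    _ ≤ 4 * qval N d * switchNorm N d := deg_sq_mul_le hd hdN
    _ ≤ _ := by gcongr; exact four_mul_qval_le hd hdN

lemma sum_switchWeight_const_le (hA : IsAdjMat N d A) (hd : 2 ≤ d) (hdN : 2 * d ≤ N) (i : Fin N)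
    {C : ℝ} (hC : 0 ≤ C) :
    ∑ s, switchWeight i A s * C ≤ switchNorm N d * (4 * qval N d * C) := by
  rw [← Finset.sum_mul]
  calc _ ≤ (d : ℝ) ^ 2 * N * C := by gcongr; exact sum_switchWeight_le hA i
    _ ≤ 4 * qval N d * switchNorm N d * C :=
        mul_le_mul_of_nonneg_right (deg_sq_mul_le hd hdN) hC
    _ = _ := by ring

/-- The observable controlling the codegrees. -/
def codegObs (N d : ℕ) (i j : Fin N) (A : Matrix (Fin N) (Fin N) ℝ) : ℝ :=
  (hMat N d A * hMat N d A) i j +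
    (N : ℝ)⁻¹ * ((hMat N d A * hMat N d A) * (hMat N d A * hMat N d A)) i j

lemma abs_hMat_sq_sub_le (hA : IsAdjMat N d A) (hd : 2 ≤ d) (hdN : 2 * d ≤ N)
    {i k l m : Fin N} (hA' : IsAdjMat N d (A - xiMat N i k l m)) (x y : Fin N) :
    |(hMat N d A * hMat N d A) x y - (hMat N d (A - xiMat N i k l m) *
      hMat N d (A - xiMat N i k l m)) x y| ≤ 16 * (qval N d)⁻¹ ^ 2 := by
  set ξ := xiMat N i k l m
  have hq := qval_pos hd hdN
  set κ := (qval N d)⁻¹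
  have e : (hMat N d A * hMat N d A) x y - (hMat N d (A - ξ) * hMat N d (A - ξ)) x y =
      κ * (∑ a, hMat N d A x a * ξ a y + ∑ a, ξ x a * hMat N d (A - ξ) a y) := by
    have h : hMat N d A * hMat N d A - hMat N d (A - ξ) * hMat N d (A - ξ) =
        κ • (hMat N d A * ξ + ξ * hMat N d (A - ξ)) := by
      rw [hMat_switch]
      simp only [mul_sub, sub_mul, Matrix.mul_smul, Matrix.smul_mul, smul_add, smul_sub]
      abel
    have h' := congrFun (congrFun h x) y
    simpa [Matrix.mul_apply] using h'
  have h1 : |∑ a, hMat N d A x a * ξ a y| ≤ κ * 8 := by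
    calc _ ≤ ∑ a, κ * |ξ y a| := by
          refine (Finset.abs_sum_le_sum_abs _ _).trans (Finset.sum_le_sum fun a _ => ?_)
          rw [abs_mul, show ξ a y = ξ y a from (xiMat_symm N i k l m).apply y a]
          gcongr
          exact abs_hMat_le hA hd hdN x a
      _ ≤ _ := by rw [← Finset.mul_sum]; gcongr; exact sum_abs_xiMat_le N i k l m y
  have h2 : |∑ a, ξ x a * hMat N d (A - ξ) a y| ≤ κ * 8 := by
    calc _ ≤ ∑ a, κ * |ξ x a| := by
          refine (Finset.abs_sum_le_sum_abs _ _).trans (Finset.sum_le_sum fun a _ => ?_)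
          rw [abs_mul, mul_comm]
          gcongr
          exact abs_hMat_le hA' hd hdN a y
      _ ≤ _ := by rw [← Finset.mul_sum]; gcongr; exact sum_abs_xiMat_le N i k l m x
  have hκ : 0 < κ := inv_pos.2 hq
  rw [e, abs_mul, abs_of_pos hκ]
  calc _ ≤ κ * (κ * 8 + κ * 8) := by
        gcongr; exact (abs_add_le _ _).trans (add_le_add h1 h2)
    _ = _ := by ring

lemma abs_codegObs_sub_le (hA : IsAdjMat N d A) (hd : 2 ≤ d) (hdN : 2 * d ≤ N)
    {i k l m : Fin N} (hA' : IsAdjMat N d (A - xiMat N i k l m)) (x y : Fin N) :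
    |codegObs N d x y A - codegObs N d x y (A - xiMat N i k l m)| ≤ 48 * (qval N d)⁻¹ ^ 2 := by
  have hM := abs_hMat_sq_sub_le hA hd hdN hA'
  have h1 := abs_hMat_sq_le hA hd hdN
  have h2 := abs_hMat_sq_le hA' hd hdN
  have hN : (0 : ℝ) < N := by exact_mod_cast (by lia : 0 < N)
  set κ := (qval N d)⁻¹
  simp only [codegObs]
  set M := hMat N d A * hMat N d A
  set M' := hMat N d (A - xiMat N i k l m) * hMat N d (A - xiMat N i k l m)
  have e : M x y + (N : ℝ)⁻¹ * (M * M) x y - (M' x y + (N : ℝ)⁻¹ * (M' * M') x y) =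
      (M x y - M' x y) +
        (N : ℝ)⁻¹ * ∑ a, (M x a * (M a y - M' a y) + (M x a - M' x a) * M' a y) := by
    rw [Matrix.mul_apply, Matrix.mul_apply]
    have : ∑ a, (M x a * (M a y - M' a y) + (M x a - M' x a) * M' a y) =
        ∑ a, M x a * M a y - ∑ a, M' x a * M' a y := by
      rw [← Finset.sum_sub_distrib]; exact Finset.sum_congr rfl fun a _ => by ring
    rw [this]; ring
  have hs : |∑ a, (M x a * (M a y - M' a y) + (M x a - M' x a) * M' a y)| ≤
      N * (32 * κ ^ 2) := by
    refine (Finset.abs_sum_le_sum_abs _ _).trans ?_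
    refine (Finset.sum_le_sum (g := fun _ => 32 * κ ^ 2) fun a _ => ?_).trans (by simp)
    calc _ ≤ 1 * (16 * κ ^ 2) + 16 * κ ^ 2 * 1 := by
          refine (abs_add_le _ _).trans (add_le_add ?_ ?_) <;> rw [abs_mul]
          · exact mul_le_mul (h1 _ _) (hM _ _) (abs_nonneg _) zero_le_one
          · exact mul_le_mul (hM _ _) (h2 _ _) (abs_nonneg _) (by positivity)
      _ = _ := by ring
  rw [e]
  calc _ ≤ 16 * κ ^ 2 + (N : ℝ)⁻¹ * (N * (32 * κ ^ 2)) := by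
        refine (abs_add_le _ _).trans (add_le_add (hM _ _) ?_)
        rw [abs_mul, abs_of_pos (inv_pos.2 hN)]
        gcongr
    _ = _ := by field_simp; ring

lemma abs_codegObs_le (hA : IsAdjMat N d A) (hd : 2 ≤ d) (hdN : 2 * d ≤ N) (x y : Fin N) :
    |codegObs N d x y A| ≤ 2 := by
  have h1 := abs_hMat_sq_le hA hd hdN
  have hN : (0 : ℝ) < N := by exact_mod_cast (by lia : 0 < N)
  have hs : |((hMat N d A * hMat N d A) * (hMat N d A * hMat N d A)) x y| ≤ N * 1 := by
    rw [Matrix.mul_apply]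
    refine (Finset.abs_sum_le_sum_abs _ _).trans ?_
    refine (Finset.sum_le_sum (g := fun _ => 1) fun a _ => ?_).trans (by simp)
    rw [abs_mul]
    exact mul_le_one₀ (h1 _ _) (abs_nonneg _) (h1 _ _)
  calc _ ≤ 1 + (N : ℝ)⁻¹ * (N * 1) := by
        refine (abs_add_le _ _).trans (add_le_add (h1 _ _) ?_)
        rw [abs_mul, abs_of_pos (inv_pos.2 hN)]
        gcongr
    _ = _ := by field_simp; norm_num

lemma xiMat_apply_third {N : ℕ} {i k l m j : Fin N} (hlm : l ≠ m) (hkl : k ≠ l) (hil : i ≠ l)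
    (hij : i ≠ j) : xiMat N i k l m l j = if m = j then 1 else 0 := by
  simp only [xiMat, Dmat, Matrix.add_apply, Matrix.sub_apply, Matrix.of_apply]
  simp [hlm.symm, hkl, hil, hij]

/-- Concentration input for the codegrees. -/
lemma codeg_switchBound (hd : 2 ≤ d) (hdN : 2 * d ≤ N) {i j : Fin N} (hij : i ≠ j) :
    SwitchBound (regSwitch N d i) (fun _ => True) (fun A => (codegObs N d i j A : ℂ))
      (fun A s => (hMat N d A s.1 j : ℂ) - hMat N d (A - xiMat N i s.1 s.2.1 s.2.2) s.2.1 j)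
      (switchNorm N d) (100 * (qval N d)⁻¹) ((N : ℝ) ^ 4)
      (fun A s => ‖(hMat N d A s.2.1 j : ℂ) - hMat N d (A - xiMat N i s.1 s.2.1 s.2.2) s.2.1 j‖)
      (fun _ s => if s.2.2 = j then (qval N d)⁻¹ else 0)
      (fun _ _ => 96 * (qval N d)⁻¹ ^ 3) := by
  have hq := qval_pos hd hdN
  have hn := switchNorm_pos hd hdN
  have hκ1 := inv_qval_le_one hd hdN
  have hκ0 : 0 < (qval N d)⁻¹ := inv_pos.2 hq
  have hN : (4 : ℝ) ≤ N := by exact_mod_cast (by lia : 4 ≤ N)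
  have hK : (2 : ℝ) ≤ (N : ℝ) ^ 4 := by
    have : (N : ℝ) ^ 1 ≤ (N : ℝ) ^ 4 := pow_le_pow_right₀ (by linarith) (by norm_num)
    linarith [pow_one (N : ℝ)]
  have hmv : ∀ A ∈ (regSwitch N d i).pts, ∀ s, (regSwitch N d i).w A s ≠ 0 →
      IsAdjMat N d (A - xiMat N i s.1 s.2.1 s.2.2) := fun A hA s hs =>
    (switchWeight_switch (mem_regPts.1 hA) hs).1
  have hsub : ∀ A ∈ (regSwitch N d i).pts, ∀ s, (regSwitch N d i).w A s ≠ 0 → ∀ k k',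
      ‖(hMat N d A k j : ℂ) - hMat N d (A - xiMat N i s.1 s.2.1 s.2.2) k' j‖ ≤
        2 * (qval N d)⁻¹ := fun A hA s hs k k' => by
    rw [← Complex.ofReal_sub, Complex.norm_real, Real.norm_eq_abs]
    refine (abs_sub _ _).trans ?_
    linarith [abs_hMat_le (mem_regPts.1 hA) hd hdN k j,
      abs_hMat_le (hmv A hA s hs) hd hdN k' j]
  have hΔ : ∀ A ∈ (regSwitch N d i).pts, ∀ s, (regSwitch N d i).w A s ≠ 0 →
      ‖(codegObs N d i j A : ℂ) - codegObs N d i j ((regSwitch N d i).move A s)‖ ≤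
        48 * (qval N d)⁻¹ ^ 2 := fun A hA s hs => by
    rw [← Complex.ofReal_sub, Complex.norm_real, Real.norm_eq_abs]
    exact abs_codegObs_sub_le (mem_regPts.1 hA) hd hdN (hmv A hA s hs) i j
  refine
    { n_pos := hn
      E_pos := by positivity
      one_le_K := by linarith
      antisymm := fun A hA s hs => ?_
      approx := fun A hA _ => ?_
      err_le := fun A hA s hs _ _ => ?_
      b_nonneg := fun A hA s => by split_ifs <;> positivity
      b_sum := fun A hA _ => ?_
      incr_le := fun A hA s hs _ _ => ?_
      c_nonneg := fun A hA s => by positivity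
      c_sum := fun A hA _ => ?_
      Z_move := fun A hA s hs _ _ => (hΔ A hA s hs).trans (by nlinarith)
      Z_le := fun A hA => ?_
      F_le := fun A hA s hs => (hsub A hA s hs _ _).trans (by linarith)
      b'_le := fun A hA s hs => (hsub A hA s hs _ _).trans (by linarith)
      w_sum := fun A hA => regSwitch_sum_le (mem_regPts.1 hA) hd hdN i }
  · have := (regSwitch N d i).move_move A hA s hs
    simp only [regSwitch] at this ⊢
    rw [this]; ring
  · have hA' := mem_regPts.1 hA
    have h := norm_potential_switch_sub_le hA' hd hdN i (fun k => (hMat N d A k j : ℂ))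
      (fun s => (hMat N d (A - xiMat N i s.1 s.2.1 s.2.2) s.2.1 j : ℂ))
      (B := (qval N d)⁻¹) fun k => by
        rw [Complex.norm_real]; exact abs_hMat_le hA' hd hdN k j
    have e : (∑ k, (hMat N d A i k : ℂ) * (hMat N d A k j : ℂ)) +
        (N : ℂ)⁻¹ * ∑ k, (hCube N d A i k : ℂ) * (hMat N d A k j : ℂ) = codegObs N d i j A := by
      have : (hMat N d A * hMat N d A) * (hMat N d A * hMat N d A) =
          hCube N d A * hMat N d A := by simp only [hCube, mul_assoc]
      simp only [codegObs, this, Matrix.mul_apply (M := hCube N d A),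
        Matrix.mul_apply (M := hMat N d A)]
      push_cast
      rfl
    rw [e] at h
    refine h.trans (add_le_add ?_ le_rfl)
    nlinarith
  · have hA' := mem_regPts.1 hA
    obtain ⟨h1, h2, h3, -, h5, -⟩ := (switchWeight_ne_zero hA').1 hs
    obtain ⟨-, hlm, -, hkl⟩ := switch_ne hA' h1 h2 h3
    simp only [regSwitch]
    rw [hMat_switch, Matrix.sub_apply, Matrix.smul_apply, xiMat_apply_third hlm hkl h5 hij,
      ← Complex.ofReal_sub, Complex.norm_real, sub_sub_cancel]
    split_ifs <;> simp [abs_of_pos hq, hκ0.le, *]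
  · have h := sum_switchWeight_mul_le' (mem_regPts.1 hA) i
      (f := fun m => if m = j then (qval N d)⁻¹ else 0) (B := (qval N d)⁻¹)
      (fun m => by split_ifs <;> positivity) (by simp)
    refine h.trans ?_
    have h2 := deg_sq_le hd hdN
    calc (d : ℝ) ^ 2 * (qval N d)⁻¹ ≤ 4 * (qval N d)⁻¹ * (N * qval N d ^ 3) * 1 := by gcongr
      _ = switchNorm N d * (4 * (qval N d)⁻¹) := by rw [switchNorm]; ring
      _ ≤ _ := by gcongr; norm_num
  · calc _ ≤ 2 * (qval N d)⁻¹ * (48 * (qval N d)⁻¹ ^ 2) :=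
          mul_le_mul (hsub A hA s hs _ _) (hΔ A hA s hs) (norm_nonneg _) (by positivity)
      _ = 96 * (qval N d)⁻¹ ^ 3 := by ring
      _ ≤ _ := le_add_of_nonneg_right (by positivity)
  · refine (sum_switchWeight_const_le (mem_regPts.1 hA) hd hdN i (by positivity)).trans ?_
    have : 4 * qval N d * (96 * (qval N d)⁻¹ ^ 3) = 384 * (qval N d)⁻¹ ^ 2 := by
      field_simp; norm_num
    rw [this]
    gcongr
    nlinarith
  · rw [Complex.norm_real]
    exact (abs_codegObs_le (mem_regPts.1 hA) hd hdN i j).trans hK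

end

section

variable {N d : ℕ} {A : Matrix (Fin N) (Fin N) ℝ}

lemma hMat_transpose (hA : IsAdjMat N d A) : (hMat N d A)ᵀ = hMat N d A :=
  Matrix.ext fun i j => hMat_symm hA j i

lemma hMat_sq_symm (hA : IsAdjMat N d A) (i j : Fin N) :
    (hMat N d A * hMat N d A) i j = (hMat N d A * hMat N d A) j i := by
  have h : (hMat N d A * hMat N d A)ᵀ = hMat N d A * hMat N d A := by
    rw [Matrix.transpose_mul, hMat_transpose hA]
  exact congrFun (congrFun h j) i

lemma hCube_symm (hA : IsAdjMat N d A) (i j : Fin N) : hCube N d A i j = hCube N d A j i := by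
  have h : (hCube N d A)ᵀ = hCube N d A := by
    rw [hCube, Matrix.transpose_mul, Matrix.transpose_mul, hMat_transpose hA, mul_assoc]
  exact congrFun (congrFun h j) i

lemma sum_hMat_sq_sq_le (hA : IsAdjMat N d A) (j : Fin N) :
    ∑ l, (hMat N d A * hMat N d A) l j ^ 2 ≤ ∑ l, codegObs N d l j A ^ 2 := by
  set H := hMat N d A
  set M := H * H with hM
  have h1 : ∑ l, M l j * (M * M) l j = ∑ a, hCube N d A a j ^ 2 := by
    have e : M * (M * M) = hCube N d A * hCube N d A := by simp only [hM, hCube, mul_assoc]; rfl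
    have e' := congrFun (congrFun e j) j
    rw [Matrix.mul_apply, Matrix.mul_apply (M := hCube N d A)] at e'
    calc _ = ∑ l, M j l * (M * M) l j :=
          Finset.sum_congr rfl fun l _ => by rw [hM, hMat_sq_symm hA l j]
      _ = _ := e'
      _ = _ := Finset.sum_congr rfl fun l _ => by rw [hCube_symm hA j l, sq]
  have h2 : ∑ l, codegObs N d l j A ^ 2 = ∑ l, M l j ^ 2 +
      2 * (N : ℝ)⁻¹ * ∑ l, M l j * (M * M) l j + ∑ l, ((N : ℝ)⁻¹ * (M * M) l j) ^ 2 := by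
    rw [Finset.mul_sum, ← Finset.sum_add_distrib, ← Finset.sum_add_distrib]
    exact Finset.sum_congr rfl fun l _ => by simp only [codegObs]; ring
  rw [h2, h1]
  have h3 : 0 ≤ 2 * (N : ℝ)⁻¹ * ∑ a, hCube N d A a j ^ 2 := by positivity
  have h4 : 0 ≤ ∑ l, ((N : ℝ)⁻¹ * (M * M) l j) ^ 2 := by positivity
  linarith

lemma abs_hMat_sq_le_of_codegObs (hA : IsAdjMat N d A) (hd : 2 ≤ d) (hdN : 2 * d ≤ N) {T : ℝ}
    (hT : ∀ x y, x ≠ y → |codegObs N d x y A| ≤ T) {i j : Fin N} (hij : i ≠ j) :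
    |(hMat N d A * hMat N d A) i j| ≤ T + (N : ℝ)⁻¹ * (4 + N * T ^ 2) := by
  have hN : (0 : ℝ) < N := by exact_mod_cast (by lia : 0 < N)
  have hS : ∀ y, ∑ l, (hMat N d A * hMat N d A) l y ^ 2 ≤ 4 + N * T ^ 2 := fun y => by
    refine (sum_hMat_sq_sq_le hA y).trans ?_
    calc ∑ l, codegObs N d l y A ^ 2 ≤ ∑ l, ((if l = y then 4 else 0) + T ^ 2) := by
          refine Finset.sum_le_sum fun l _ => ?_
          split_ifs with h
          · have h1 := abs_codegObs_le hA hd hdN l y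
            have h2 := sq_le_sq' (neg_le_of_abs_le h1) (le_of_abs_le h1)
            nlinarith
          · have h1 := hT l y h
            have h2 := sq_le_sq' (neg_le_of_abs_le h1) (le_of_abs_le h1)
            linarith
      _ = _ := by simp [Finset.sum_add_distrib]
  have h1 : |((hMat N d A * hMat N d A) * (hMat N d A * hMat N d A)) i j| ≤ 4 + N * T ^ 2 := by
    rw [Matrix.mul_apply]
    calc _ ≤ ∑ a, ((hMat N d A * hMat N d A) a i ^ 2 / 2 +
            (hMat N d A * hMat N d A) a j ^ 2 / 2) := by
          refine (Finset.abs_sum_le_sum_abs _ _).trans (Finset.sum_le_sum fun a _ => ?_)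
          rw [hMat_sq_symm hA i a]
          generalize (hMat N d A * hMat N d A) a i = x
          generalize (hMat N d A * hMat N d A) a j = y
          exact abs_le.2 ⟨by nlinarith [sq_nonneg (x + y)], by nlinarith [sq_nonneg (x - y)]⟩
      _ ≤ _ := by
          rw [Finset.sum_add_distrib, ← Finset.sum_div, ← Finset.sum_div]
          linarith [hS i, hS j]
  have h2 : (hMat N d A * hMat N d A) i j = codegObs N d i j A -
      (N : ℝ)⁻¹ * ((hMat N d A * hMat N d A) * (hMat N d A * hMat N d A)) i j := by
    simp only [codegObs]; ring
  rw [h2]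
  refine (abs_sub _ _).trans (add_le_add (hT i j hij) ?_)
  rw [abs_mul, abs_of_pos (inv_pos.2 hN)]
  gcongr

lemma abs_hCube_le_of_codegObs (hA : IsAdjMat N d A) (hd : 2 ≤ d) (hdN : 2 * d ≤ N) {t : ℝ}
    (ht : 1 ≤ t) (htq : t * (qval N d)⁻¹ ≤ 1)
    (hT : ∀ x y, x ≠ y → |codegObs N d x y A| ≤ t * (100 * (qval N d)⁻¹)) (i j : Fin N) :
    |hCube N d A i j| ≤ 41000 * t := by
  have hq := qval_pos hd hdN
  have hκ1 := inv_qval_le_one hd hdN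
  have hκ0 : 0 < (qval N d)⁻¹ := inv_pos.2 hq
  have hN : (0 : ℝ) < N := by exact_mod_cast (by lia : 0 < N)
  have hN2 := inv_le_inv_qval_sq hd hdN
  have hM : ∀ k, k ≠ j → |(hMat N d A * hMat N d A) k j| ≤ 10104 * t * (qval N d)⁻¹ :=
    fun k hk => by
      refine (abs_hMat_sq_le_of_codegObs hA hd hdN hT hk).trans ?_
      have e : (N : ℝ)⁻¹ * (4 + N * (t * (100 * (qval N d)⁻¹)) ^ 2) =
          4 * (N : ℝ)⁻¹ + 10000 * (t * (qval N d)⁻¹) * (t * (qval N d)⁻¹) := by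
        field_simp; ring
      rw [e]
      have h0 : 0 ≤ t * (qval N d)⁻¹ := by positivity
      have h1 : (t * (qval N d)⁻¹) * (t * (qval N d)⁻¹) ≤ t * (qval N d)⁻¹ := by nlinarith
      have h2 : (N : ℝ)⁻¹ ≤ t * (qval N d)⁻¹ := by
        refine hN2.trans ?_
        nlinarith
      nlinarith
  have h : ∀ k, |hMat N d A i k * (hMat N d A * hMat N d A) k j| ≤
      |hMat N d A i k| * (10104 * t * (qval N d)⁻¹) + if k = j then 1 else 0 := fun k => by
    rw [abs_mul]
    by_cases hk : k = j
    · have h1 := abs_hMat_sq_le hA hd hdN k j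
      have h2 := (abs_hMat_le hA hd hdN i k).trans hκ1
      rw [if_pos hk]
      have h3 : |hMat N d A i k| * |(hMat N d A * hMat N d A) k j| ≤ 1 :=
        mul_le_one₀ h2 (abs_nonneg _) h1
      have h4 : 0 ≤ |hMat N d A i k| * (10104 * t * (qval N d)⁻¹) := by positivity
      linarith
    · rw [if_neg hk, add_zero]
      gcongr
      exact hM k hk
  rw [hCube, Matrix.mul_apply]
  calc _ ≤ ∑ k, (|hMat N d A i k| * (10104 * t * (qval N d)⁻¹) + if k = j then 1 else 0) :=
        (Finset.abs_sum_le_sum_abs _ _).trans (Finset.sum_le_sum fun k _ => h k)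
    _ = (∑ k, |hMat N d A i k|) * (10104 * t * (qval N d)⁻¹) + 1 := by
        simp [Finset.sum_add_distrib, Finset.sum_mul]
    _ ≤ 4 * qval N d * (10104 * t * (qval N d)⁻¹) + 1 := by
        gcongr; exact sum_abs_hMat_le hA hd hdN i
    _ = 40416 * t + 1 := by field_simp; ring
    _ ≤ _ := by linarith

end

section

variable {N d : ℕ} {A A' : Matrix (Fin N) (Fin N) ℝ} {z : ℂ} {Γ ψ : ℝ}

/-- A priori bounds on the entries of the Green function and on the third power of the
centred adjacency matrix. -/
structure GreenBound (N d : ℕ) (z : ℂ) (Γ ψ : ℝ) (A : Matrix (Fin N) (Fin N) ℝ) : Prop where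
  entry : ∀ a b, ‖greenM N d A z a b‖ ≤ Γ
  row : ∀ b, ∑ a, ‖greenM N d A z a b‖ ^ 2 ≤ N * ψ ^ 2
  cube : ∀ a b, |hCube N d A a b| ≤ Γ

lemma deg_mul_inv_le (hd : 2 ≤ d) (hdN : 2 * d ≤ N) : (d : ℝ) * (qval N d)⁻¹ / N ≤ (qval N d)⁻¹ := by
  have hq := qval_pos hd hdN
  have hN : (0 : ℝ) < N := by exact_mod_cast (by lia : 0 < N)
  have h : (d : ℝ) ≤ N := by exact_mod_cast (by lia : d ≤ N)
  rw [div_le_iff₀ hN, mul_comm]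
  gcongr

lemma norm_greenM_le_card (hA : IsAdjMat N d A) (hz : 0 < z.im) (hNz : 1 ≤ N * z.im) (a b : Fin N) :
    ‖greenM N d A z a b‖ ≤ N :=
  (norm_greenM_le hA hz a b).trans ((div_le_iff₀ hz).2 hNz)

lemma norm_greenM_sub_le (hA : IsAdjMat N d A) (hd : 2 ≤ d) (hdN : 2 * d ≤ N) (hz : 0 < z.im)
    {i k l m : Fin N} (hA' : IsAdjMat N d (A - xiMat N i k l m)) (x y : Fin N) :
    ‖greenM N d A z x y - greenM N d (A - xiMat N i k l m) z x y‖ ≤ (qval N d)⁻¹ *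
      ((‖greenM N d A z x i‖ * ‖greenM N d (A - xiMat N i k l m) z k y‖ +
        ‖greenM N d A z x k‖ * ‖greenM N d (A - xiMat N i k l m) z i y‖) +
      (‖greenM N d A z x l‖ * ‖greenM N d (A - xiMat N i k l m) z m y‖ +
        ‖greenM N d A z x m‖ * ‖greenM N d (A - xiMat N i k l m) z l y‖) +
      (‖greenM N d A z x i‖ * ‖greenM N d (A - xiMat N i k l m) z l y‖ +
        ‖greenM N d A z x l‖ * ‖greenM N d (A - xiMat N i k l m) z i y‖) +
      (‖greenM N d A z x k‖ * ‖greenM N d (A - xiMat N i k l m) z m y‖ +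
        ‖greenM N d A z x m‖ * ‖greenM N d (A - xiMat N i k l m) z k y‖)) := by
  have hq := qval_pos hd hdN
  rw [greenM_switch hA hA' hz, norm_neg, norm_mul, norm_inv, Complex.norm_real,
    Real.norm_of_nonneg hq.le]
  gcongr
  simp only [← norm_mul]
  refine (norm_sub_le _ _).trans (add_le_add ((norm_sub_le _ _).trans
    (add_le_add ((norm_add_le _ _).trans (add_le_add ?_ ?_)) ?_)) ?_) <;>
  exact norm_add_le _ _

lemma GreenBound.norm_sub_le (h : GreenBound N d z Γ ψ A) (hA : IsAdjMat N d A) (hd : 2 ≤ d)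
    (hdN : 2 * d ≤ N) (hz : 0 < z.im) {i k l m : Fin N}
    (hA' : IsAdjMat N d (A - xiMat N i k l m)) (h' : GreenBound N d z Γ ψ (A - xiMat N i k l m))
    (x y : Fin N) :
    ‖greenM N d A z x y - greenM N d (A - xiMat N i k l m) z x y‖ ≤
      8 * (qval N d)⁻¹ * Γ ^ 2 := by
  have hq := inv_pos.2 (qval_pos hd hdN)
  have hΓ : 0 ≤ Γ := (norm_nonneg _).trans (h.entry x y)
  refine (norm_greenM_sub_le hA hd hdN hz hA' x y).trans ?_
  have hp : ∀ a b c e, ‖greenM N d A z a b‖ * ‖greenM N d (A - xiMat N i k l m) z c e‖ ≤ Γ ^ 2 :=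
    fun a b c e => by
      rw [sq]; exact mul_le_mul (h.entry a b) (h'.entry c e) (norm_nonneg _) hΓ
  calc _ ≤ (qval N d)⁻¹ * ((Γ ^ 2 + Γ ^ 2) + (Γ ^ 2 + Γ ^ 2) + (Γ ^ 2 + Γ ^ 2) +
      (Γ ^ 2 + Γ ^ 2)) := by
        gcongr (qval N d)⁻¹ * (?_ + ?_ + ?_ + ?_) <;> exact add_le_add (hp _ _ _ _) (hp _ _ _ _)
    _ = _ := by ring

lemma GreenBound.sum_norm_diag_sub_le (h : GreenBound N d z Γ ψ A) (hA : IsAdjMat N d A)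
    (hd : 2 ≤ d) (hdN : 2 * d ≤ N) (hz : 0 < z.im) {i k l m : Fin N}
    (hA' : IsAdjMat N d (A - xiMat N i k l m)) (h' : GreenBound N d z Γ ψ (A - xiMat N i k l m)) :
    ∑ x, ‖greenM N d A z x x - greenM N d (A - xiMat N i k l m) z x x‖ ≤
      8 * (qval N d)⁻¹ * (N * ψ ^ 2) := by
  have hq := inv_pos.2 (qval_pos hd hdN)
  have hp : ∀ a b, ∑ x, ‖greenM N d A z x a‖ * ‖greenM N d (A - xiMat N i k l m) z b x‖ ≤
      N * ψ ^ 2 := fun a b => by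
    calc _ ≤ ∑ x, (‖greenM N d A z x a‖ ^ 2 + ‖greenM N d (A - xiMat N i k l m) z x b‖ ^ 2) / 2 := by
          refine Finset.sum_le_sum fun x _ => ?_
          rw [greenM_symm hA' b x]
          nlinarith [sq_nonneg (‖greenM N d A z x a‖ - ‖greenM N d (A - xiMat N i k l m) z x b‖)]
      _ ≤ _ := by
          rw [← Finset.sum_div, Finset.sum_add_distrib]
          linarith [h.row a, h'.row b]
  refine (Finset.sum_le_sum fun x _ => norm_greenM_sub_le hA hd hdN hz hA' x x).trans ?_
  rw [← Finset.mul_sum]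
  simp only [Finset.sum_add_distrib]
  calc _ ≤ (qval N d)⁻¹ * ((N * ψ ^ 2 + N * ψ ^ 2) + (N * ψ ^ 2 + N * ψ ^ 2) +
      (N * ψ ^ 2 + N * ψ ^ 2) + (N * ψ ^ 2 + N * ψ ^ 2)) := by
        gcongr (qval N d)⁻¹ * (?_ + ?_ + ?_ + ?_) <;> exact add_le_add (hp _ _) (hp _ _)
    _ = _ := by ring

/-- The fluctuation of the diagonal Green function entries, averaged over the neighbours of a
vertex. -/
def diagObs (N d : ℕ) (z : ℂ) (i : Fin N) (A : Matrix (Fin N) (Fin N) ℝ) : ℂ :=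
  ((d * (qval N d)⁻¹ / N : ℝ) : ℂ) * ∑ l, (hMat N d A i l : ℂ) * greenM N d A z l l

lemma GreenBound.norm_diagObs_sub_le (h : GreenBound N d z Γ ψ A) (hA : IsAdjMat N d A)
    (hd : 2 ≤ d) (hdN : 2 * d ≤ N) (hz : 0 < z.im) {i k l m : Fin N}
    (hA' : IsAdjMat N d (A - xiMat N i k l m)) (h' : GreenBound N d z Γ ψ (A - xiMat N i k l m)) :
    ‖diagObs N d z i A - diagObs N d z i (A - xiMat N i k l m)‖ ≤
      8 * (qval N d)⁻¹ ^ 2 * Γ + 16 * (qval N d)⁻¹ * ψ ^ 2 := by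
  have hs := h.sum_norm_diag_sub_le hA hd hdN hz hA' h'
  have hq := qval_pos hd hdN
  have hN : (0 : ℝ) < N := by exact_mod_cast (by lia : 0 < N)
  have hκ : 0 < (qval N d)⁻¹ := inv_pos.2 hq
  have hΓ : 0 ≤ Γ := (norm_nonneg _).trans (h.entry i i)
  have hdq : (d : ℝ) * (qval N d)⁻¹ ^ 2 ≤ 2 := by
    rw [inv_pow, ← div_eq_mul_inv, div_le_iff₀ (by positivity)]
    exact le_two_mul_qval_sq hd hdN
  have e : diagObs N d z i A - diagObs N d z i (A - xiMat N i k l m) =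
      ((d * (qval N d)⁻¹ / N : ℝ) : ℂ) *
        (∑ a, ((hMat N d A i a - hMat N d (A - xiMat N i k l m) i a : ℝ) : ℂ) * greenM N d A z a a +
        ∑ a, (hMat N d (A - xiMat N i k l m) i a : ℂ) *
          (greenM N d A z a a - greenM N d (A - xiMat N i k l m) z a a)) := by
    rw [diagObs, diagObs, ← mul_sub, ← Finset.sum_sub_distrib, ← Finset.sum_add_distrib]
    congr 1
    refine Finset.sum_congr rfl fun a _ => ?_
    push_cast; ring
  have h1 : ‖∑ a, ((hMat N d A i a - hMat N d (A - xiMat N i k l m) i a : ℝ) : ℂ) *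
      greenM N d A z a a‖ ≤ (qval N d)⁻¹ * 8 * Γ := by
    calc _ ≤ ∑ a, (qval N d)⁻¹ * |xiMat N i k l m i a| * Γ := by
          refine (norm_sum_le _ _).trans (Finset.sum_le_sum fun a _ => ?_)
          rw [norm_mul, Complex.norm_real, hMat_switch, Matrix.sub_apply, sub_sub_cancel,
            Matrix.smul_apply, smul_eq_mul, Real.norm_eq_abs, abs_mul, abs_of_pos hκ]
          exact mul_le_mul_of_nonneg_left (h.entry a a) (by positivity)
      _ ≤ _ := by
          rw [← Finset.sum_mul, ← Finset.mul_sum]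
          gcongr
          exact sum_abs_xiMat_le N i k l m i
  have h2 : ‖∑ a, (hMat N d (A - xiMat N i k l m) i a : ℂ) *
      (greenM N d A z a a - greenM N d (A - xiMat N i k l m) z a a)‖ ≤
        (qval N d)⁻¹ * (8 * (qval N d)⁻¹ * (N * ψ ^ 2)) := by
    calc _ ≤ ∑ a, (qval N d)⁻¹ *
          ‖greenM N d A z a a - greenM N d (A - xiMat N i k l m) z a a‖ := by
          refine (norm_sum_le _ _).trans (Finset.sum_le_sum fun a _ => ?_)
          rw [norm_mul, Complex.norm_real]
          gcongr
          exact abs_hMat_le hA' hd hdN i a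
      _ ≤ _ := by rw [← Finset.mul_sum]; gcongr
  rw [e, norm_mul, Complex.norm_real, Real.norm_of_nonneg (by positivity)]
  calc _ ≤ (d * (qval N d)⁻¹ / N) * ((qval N d)⁻¹ * 8 * Γ +
        (qval N d)⁻¹ * (8 * (qval N d)⁻¹ * (N * ψ ^ 2))) := by
        gcongr
        exact (norm_add_le _ _).trans (add_le_add h1 h2)
    _ = (d * (qval N d)⁻¹ / N) * ((qval N d)⁻¹ * 8 * Γ) +
        (d * (qval N d)⁻¹ ^ 2) * (8 * (qval N d)⁻¹ * ψ ^ 2) := by field_simp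
    _ ≤ (qval N d)⁻¹ * ((qval N d)⁻¹ * 8 * Γ) + 2 * (8 * (qval N d)⁻¹ * ψ ^ 2) := by
        gcongr
        exact deg_mul_inv_le hd hdN
    _ = _ := by ring

/-- Concentration input for `diagObs`. -/
lemma diag_switchBound (hd : 2 ≤ d) (hdN : 2 * d ≤ N) (hz : 0 < z.im) (hNz : 1 ≤ N * z.im)
    (hΓ : 1 ≤ Γ) (hψ : 0 ≤ ψ) (hψΓ : ψ ≤ Γ) (i : Fin N) :
    SwitchBound (regSwitch N d i) (GreenBound N d z Γ ψ) (diagObs N d z i)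
      (fun A s => ((d * (qval N d)⁻¹ / N : ℝ) : ℂ) * greenM N d A z s.1 s.1 -
        ((d * (qval N d)⁻¹ / N : ℝ) : ℂ) *
          greenM N d (A - xiMat N i s.1 s.2.1 s.2.2) z s.2.1 s.2.1)
      (switchNorm N d) (100 * (ψ + (qval N d)⁻¹ * Γ ^ 2)) ((N : ℝ) ^ 4)
      (fun A s => ‖((d * (qval N d)⁻¹ / N : ℝ) : ℂ) * greenM N d A z s.2.1 s.2.1 -
        ((d * (qval N d)⁻¹ / N : ℝ) : ℂ) *
          greenM N d (A - xiMat N i s.1 s.2.1 s.2.2) z s.2.1 s.2.1‖)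
      (fun _ _ => 8 * (qval N d)⁻¹ ^ 2 * Γ ^ 2)
      (fun _ _ => 16 * (qval N d)⁻¹ ^ 3 * Γ ^ 2 + 32 * (qval N d)⁻¹ ^ 2 * Γ * ψ ^ 2) := by
  have hq := qval_pos hd hdN
  have hn := switchNorm_pos hd hdN
  have hκ1 := inv_qval_le_one hd hdN
  have hκ0 : 0 < (qval N d)⁻¹ := inv_pos.2 hq
  have hN : (4 : ℝ) ≤ N := by exact_mod_cast (by lia : 4 ≤ N)
  have hK2 : (N : ℝ) ^ 2 ≤ (N : ℝ) ^ 4 := pow_le_pow_right₀ (by linarith) (by norm_num)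
  have hp := deg_mul_inv_le hd hdN
  have hp0 : 0 ≤ (d : ℝ) * (qval N d)⁻¹ / N := by positivity
  have hΓ0 : 0 ≤ Γ := by linarith
  have hmv : ∀ A ∈ (regSwitch N d i).pts, ∀ s, (regSwitch N d i).w A s ≠ 0 →
      IsAdjMat N d (A - xiMat N i s.1 s.2.1 s.2.2) := fun A hA s hs =>
    (switchWeight_switch (mem_regPts.1 hA) hs).1
  have hsub : ∀ A ∈ (regSwitch N d i).pts, ∀ s, (regSwitch N d i).w A s ≠ 0 → ∀ k k' : Fin N,
      ‖((d * (qval N d)⁻¹ / N : ℝ) : ℂ) * greenM N d A z k k - ((d * (qval N d)⁻¹ / N : ℝ) : ℂ) *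
        greenM N d (A - xiMat N i s.1 s.2.1 s.2.2) z k' k'‖ ≤ (N : ℝ) ^ 4 :=
    fun A hA s hs k k' => by
      rw [← mul_sub, norm_mul, Complex.norm_real, Real.norm_of_nonneg hp0]
      have h1 := norm_greenM_le_card (mem_regPts.1 hA) hz hNz k k
      have h2 := norm_greenM_le_card (hmv A hA s hs) hz hNz k' k'
      calc _ ≤ 1 * ((N : ℝ) + N) := by
            gcongr
            · linarith
            · exact (norm_sub_le _ _).trans (add_le_add h1 h2)
        _ ≤ _ := by nlinarith
  have hsum : ∀ A ∈ (regSwitch N d i).pts, ∀ C : ℝ, 0 ≤ C →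
      ∑ s, (regSwitch N d i).w A s * C ≤ switchNorm N d * (4 * qval N d * C) :=
    fun A hA C hC => sum_switchWeight_const_le (mem_regPts.1 hA) hd hdN i hC
  refine
    { n_pos := hn
      E_pos := by positivity
      one_le_K := by nlinarith
      antisymm := fun A hA s hs => ?_
      approx := fun A hA h => ?_
      err_le := fun A hA s hs h h' => ?_
      b_nonneg := fun A hA s => by positivity
      b_sum := fun A hA _ => ?_
      incr_le := fun A hA s hs h h' => ?_
      c_nonneg := fun A hA s => by positivity
      c_sum := fun A hA _ => ?_
      Z_move := fun A hA s hs h h' => ?_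
      Z_le := fun A hA => ?_
      F_le := fun A hA s hs => hsub A hA s hs _ _
      b'_le := fun A hA s hs => hsub A hA s hs _ _
      w_sum := fun A hA => regSwitch_sum_le (mem_regPts.1 hA) hd hdN i }
  · have := (regSwitch N d i).move_move A hA s hs
    simp only [regSwitch] at this ⊢
    rw [this]; ring
  · have hA' := mem_regPts.1 hA
    have hY : ∀ k, ‖((d * (qval N d)⁻¹ / N : ℝ) : ℂ) * greenM N d A z k k‖ ≤
        (qval N d)⁻¹ * Γ := fun k => by
      rw [norm_mul, Complex.norm_real, Real.norm_of_nonneg hp0]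
      exact mul_le_mul hp (h.entry k k) (norm_nonneg _) hκ0.le
    have hB := norm_potential_switch_sub_le hA' hd hdN i
      (fun k => ((d * (qval N d)⁻¹ / N : ℝ) : ℂ) * greenM N d A z k k)
      (fun s => ((d * (qval N d)⁻¹ / N : ℝ) : ℂ) *
          greenM N d (A - xiMat N i s.1 s.2.1 s.2.2) z s.2.1 s.2.1) hY
    have e : ∑ k, (hMat N d A i k : ℂ) * (((d * (qval N d)⁻¹ / N : ℝ) : ℂ) * greenM N d A z k k) =
        diagObs N d z i A := by
      rw [diagObs, Finset.mul_sum]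
      exact Finset.sum_congr rfl fun k _ => by ring
    have hc : ‖(N : ℂ)⁻¹ * ∑ k, (hCube N d A i k : ℂ) *
        (((d * (qval N d)⁻¹ / N : ℝ) : ℂ) * greenM N d A z k k)‖ ≤ (qval N d)⁻¹ * Γ ^ 2 := by
      rw [norm_mul, norm_inv, Complex.norm_natCast, inv_mul_le_iff₀ (by linarith)]
      refine (norm_sum_le _ _).trans ((Finset.sum_le_sum (g := fun _ => (qval N d)⁻¹ * Γ ^ 2)
        fun k _ => ?_).trans (by simp))
      rw [norm_mul, Complex.norm_real]
      calc _ ≤ Γ * ((qval N d)⁻¹ * Γ) := mul_le_mul (h.cube i k) (hY k) (norm_nonneg _) hΓ0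
        _ = _ := by ring
    rw [e] at hB
    dsimp only [regSwitch]
    set T := (N : ℂ)⁻¹ * ∑ k, (hCube N d A i k : ℂ) *
        (((d * (qval N d)⁻¹ / N : ℝ) : ℂ) * greenM N d A z k k)
    have e2 : ∀ a b : ℂ, a - b = (a + T - b) - T := fun a b => by ring
    rw [e2]
    refine (norm_sub_le _ _).trans ?_
    have : 16 * (qval N d)⁻¹ * ((qval N d)⁻¹ * Γ) ≤ 16 * 1 * ((qval N d)⁻¹ * Γ ^ 2) := by
      gcongr; nlinarith
    have : 0 ≤ (qval N d)⁻¹ * Γ ^ 2 := by positivity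
    linarith
  · have hA' := mem_regPts.1 hA
    have hd' := h.norm_sub_le hA' hd hdN hz (hmv A hA s hs) h' s.2.1 s.2.1
    rw [← mul_sub, norm_mul, Complex.norm_real, Real.norm_of_nonneg hp0]
    refine le_trans ?_ (le_add_of_nonneg_right (by positivity))
    calc _ ≤ (qval N d)⁻¹ * (8 * (qval N d)⁻¹ * Γ ^ 2) :=
          mul_le_mul hp hd' (norm_nonneg _) hκ0.le
      _ = _ := by ring
  · refine (hsum A hA _ (by positivity)).trans ?_
    have : 4 * qval N d * (8 * (qval N d)⁻¹ ^ 2 * Γ ^ 2) = 32 * ((qval N d)⁻¹ * Γ ^ 2) := by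
      field_simp; norm_num
    rw [this]
    have : 0 ≤ (qval N d)⁻¹ * Γ ^ 2 := by positivity
    exact mul_le_mul_of_nonneg_left (by linarith) hn.le
  · have hA' := mem_regPts.1 hA
    have hd' := h.norm_diagObs_sub_le hA' hd hdN hz (hmv A hA s hs) h'
    have hF : ‖((d * (qval N d)⁻¹ / N : ℝ) : ℂ) * greenM N d A z s.1 s.1 -
        ((d * (qval N d)⁻¹ / N : ℝ) : ℂ) *
          greenM N d (A - xiMat N i s.1 s.2.1 s.2.2) z s.2.1 s.2.1‖ ≤ (qval N d)⁻¹ * (Γ + Γ) := by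
      rw [← mul_sub, norm_mul, Complex.norm_real, Real.norm_of_nonneg hp0]
      exact mul_le_mul hp ((_root_.norm_sub_le _ _).trans (add_le_add (h.entry _ _) (h'.entry _ _)))
        (norm_nonneg _) hκ0.le
    refine le_trans ?_ (le_add_of_nonneg_right (by positivity))
    calc _ ≤ (qval N d)⁻¹ * (Γ + Γ) *
          (8 * (qval N d)⁻¹ ^ 2 * Γ + 16 * (qval N d)⁻¹ * ψ ^ 2) :=
          mul_le_mul hF hd' (norm_nonneg _) (by positivity)
      _ = _ := by ring
  · refine (hsum A hA _ (by positivity)).trans ?_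
    have : 4 * qval N d * (16 * (qval N d)⁻¹ ^ 3 * Γ ^ 2 + 32 * (qval N d)⁻¹ ^ 2 * Γ * ψ ^ 2) =
        64 * (qval N d)⁻¹ ^ 2 * Γ ^ 2 + 128 * ((qval N d)⁻¹ * Γ) * ψ * ψ := by
      field_simp; ring
    rw [this]
    gcongr
    have h1 : (qval N d)⁻¹ * Γ ≤ (qval N d)⁻¹ * Γ ^ 2 := by gcongr; nlinarith
    have h2 : 64 * (qval N d)⁻¹ ^ 2 * Γ ^ 2 ≤ 64 * ((qval N d)⁻¹ * Γ ^ 2) ^ 2 := by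
      have := pow_le_pow_left₀ (by positivity) h1 2
      nlinarith
    have h3 : 128 * ((qval N d)⁻¹ * Γ) * ψ * ψ ≤ 128 * ((qval N d)⁻¹ * Γ) * Γ * ψ := by
      gcongr
    have h4 : 0 ≤ (qval N d)⁻¹ * Γ ^ 2 := by positivity
    nlinarith [mul_nonneg h4 hψ]
  · refine (h.norm_diagObs_sub_le (mem_regPts.1 hA) hd hdN hz (hmv A hA s hs) h').trans ?_
    have h1 : 8 * (qval N d)⁻¹ ^ 2 * Γ ≤ 8 * ((qval N d)⁻¹ * Γ ^ 2) := by
      have : (qval N d)⁻¹ ^ 2 * Γ ≤ (qval N d)⁻¹ * Γ ^ 2 := by gcongr <;> nlinarith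
      linarith
    have h3 : 16 * (qval N d)⁻¹ * ψ ^ 2 ≤ 16 * (qval N d)⁻¹ * Γ ^ 2 := by gcongr
    have h4 : 0 ≤ (qval N d)⁻¹ * Γ ^ 2 := by positivity
    linarith
  · rw [diagObs, norm_mul, Complex.norm_real, Real.norm_of_nonneg hp0]
    have hs : ‖∑ l, (hMat N d A i l : ℂ) * greenM N d A z l l‖ ≤ N * N := by
      refine (norm_sum_le _ _).trans ((Finset.sum_le_sum (g := fun _ => (N : ℝ))
        fun k _ => ?_).trans (by simp))
      rw [norm_mul, Complex.norm_real]
      calc _ ≤ 1 * (N : ℝ) := mul_le_mul ((abs_hMat_le (mem_regPts.1 hA) hd hdN i k).trans hκ1)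
            (norm_greenM_le_card (mem_regPts.1 hA) hz hNz k k) (norm_nonneg _) zero_le_one
        _ = _ := one_mul _
    calc _ ≤ 1 * ((N : ℝ) * N) := mul_le_mul (hp.trans hκ1) hs (norm_nonneg _) zero_le_one
      _ ≤ _ := by nlinarith

end

section

variable {N d : ℕ} {A A' : Matrix (Fin N) (Fin N) ℝ} {z : ℂ} {Γ ψ L : ℝ}

/-- The error in the self-consistent equation at the entry `(i, j)`. -/
def selfObs (N d : ℕ) (z : ℂ) (i j : Fin N) (A : Matrix (Fin N) (Fin N) ℝ) : ℂ :=
  (if i = j then 1 else 0) + z * greenM N d A z i j + gbar N d A z * greenM N d A z i j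

lemma gbar_eq : gbar N d A z = (N : ℂ)⁻¹ * ∑ x, greenM N d A z x x := rfl

lemma norm_gbar_le (hN : 0 < N) {B : ℝ} (h : ∀ x, ‖greenM N d A z x x‖ ≤ B) :
    ‖gbar N d A z‖ ≤ B := by
  have hN' : (0 : ℝ) < N := by exact_mod_cast hN
  rw [gbar_eq, norm_mul, norm_inv, Complex.norm_natCast, inv_mul_le_iff₀ hN']
  exact (norm_sum_le _ _).trans ((Finset.sum_le_sum fun x _ => h x).trans (by simp))

lemma GreenBound.norm_gbar_sub_le (h : GreenBound N d z Γ ψ A) (hA : IsAdjMat N d A)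
    (hd : 2 ≤ d) (hdN : 2 * d ≤ N) (hz : 0 < z.im) {i k l m : Fin N}
    (hA' : IsAdjMat N d (A - xiMat N i k l m)) (h' : GreenBound N d z Γ ψ (A - xiMat N i k l m)) :
    ‖gbar N d A z - gbar N d (A - xiMat N i k l m) z‖ ≤ 8 * (qval N d)⁻¹ * ψ ^ 2 := by
  have hN : (0 : ℝ) < N := by exact_mod_cast (by lia : 0 < N)
  rw [gbar_eq, gbar_eq, ← mul_sub, ← Finset.sum_sub_distrib, norm_mul, norm_inv,
    Complex.norm_natCast, inv_mul_le_iff₀ hN]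
  refine (norm_sum_le _ _).trans ((h.sum_norm_diag_sub_le hA hd hdN hz hA' h').trans_eq ?_)
  ring

lemma GreenBound.sum_norm_le (h : GreenBound N d z Γ ψ A) (hψ : 0 ≤ ψ) (b : Fin N) :
    ∑ a, ‖greenM N d A z a b‖ ≤ N * ψ := by
  refine le_of_sq_le_sq ?_ (by positivity)
  have := sq_sum_le_card_mul_sum_sq (s := Finset.univ) (f := fun a => ‖greenM N d A z a b‖)
  rw [Finset.card_univ, Fintype.card_fin] at this
  calc _ ≤ _ := this
    _ ≤ (N : ℝ) * (N * ψ ^ 2) := by gcongr; exact h.row b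
    _ = _ := by ring

lemma norm_selfObs_sub_le (hzΓ : ‖z‖ ≤ Γ) (h : GreenBound N d z Γ ψ A)
    (hA : IsAdjMat N d A) (hd : 2 ≤ d) (hdN : 2 * d ≤ N) (hz : 0 < z.im) {i k l m : Fin N}
    (hA' : IsAdjMat N d (A - xiMat N i k l m)) (h' : GreenBound N d z Γ ψ (A - xiMat N i k l m))
    (j : Fin N) :
    ‖selfObs N d z i j A - selfObs N d z i j (A - xiMat N i k l m)‖ ≤
      2 * Γ * ‖greenM N d A z i j - greenM N d (A - xiMat N i k l m) z i j‖ +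
        8 * (qval N d)⁻¹ * ψ ^ 2 * Γ := by
  have hκ : 0 < (qval N d)⁻¹ := inv_pos.2 (qval_pos hd hdN)
  have hΓ : 0 ≤ Γ := (norm_nonneg _).trans (h.entry i j)
  have e : selfObs N d z i j A - selfObs N d z i j (A - xiMat N i k l m) =
      (z + gbar N d A z) * (greenM N d A z i j - greenM N d (A - xiMat N i k l m) z i j) +
        (gbar N d A z - gbar N d (A - xiMat N i k l m) z) *
          greenM N d (A - xiMat N i k l m) z i j := by
    simp only [selfObs]; ring
  rw [e]
  refine (norm_add_le _ _).trans ?_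
  rw [norm_mul, norm_mul]
  have h1 := (norm_add_le z (gbar N d A z)).trans
    (add_le_add hzΓ (norm_gbar_le (by lia) fun x => h.entry x x))
  gcongr
  · linarith
  · exact h.norm_gbar_sub_le hA hd hdN hz hA' h'
  · exact h'.entry i j

/-- The increments of `selfObs`, in terms of entries in the rows of the vertices moved. -/
lemma norm_greenM_sub_row_le (h : GreenBound N d z Γ ψ A)
    (hA : IsAdjMat N d A) (hd : 2 ≤ d) (hdN : 2 * d ≤ N) (hz : 0 < z.im) {i k l m : Fin N}
    (hA' : IsAdjMat N d (A - xiMat N i k l m)) (h' : GreenBound N d z Γ ψ (A - xiMat N i k l m))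
    (j : Fin N) :
    ‖greenM N d A z i j - greenM N d (A - xiMat N i k l m) z i j‖ ≤ (qval N d)⁻¹ * (2 * Γ *
      (‖greenM N d A z l j‖ + ‖greenM N d A z l i‖ +
        (‖greenM N d (A - xiMat N i k l m) z k j‖ + ‖greenM N d (A - xiMat N i k l m) z k i‖) +
        16 * (qval N d)⁻¹ * Γ ^ 2)) := by
  have hκ : 0 < (qval N d)⁻¹ := inv_pos.2 (qval_pos hd hdN)
  refine (norm_greenM_sub_le hA hd hdN hz hA' i j).trans (mul_le_mul_of_nonneg_left ?_ hκ.le)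
  have hΓ : 0 ≤ Γ := (norm_nonneg _).trans (h.entry i i)
  have s1 := h.norm_sub_le hA hd hdN hz hA' h' k i
  have s2 := h.norm_sub_le hA hd hdN hz hA' h' l j
  have t1 := norm_sub_norm_le (greenM N d A z k i) (greenM N d (A - xiMat N i k l m) z k i)
  have t2 := norm_sub_norm_le (greenM N d (A - xiMat N i k l m) z l j) (greenM N d A z l j)
  rw [norm_sub_rev] at t2
  have e1 := h.entry
  have e2 := h'.entry
  rw [greenM_symm hA i k, greenM_symm hA i l]
  have p1 := mul_le_mul_of_nonneg_right (e1 i i) (norm_nonneg (greenM N d (A - xiMat N i k l m) z k j))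
  have p2 := mul_le_mul_of_nonneg_left (e2 i j) (norm_nonneg (greenM N d A z k i))
  have p3 := mul_le_mul_of_nonneg_left (e2 m j) (norm_nonneg (greenM N d A z l i))
  have p4 := mul_le_mul_of_nonneg_right (e1 i m) (norm_nonneg (greenM N d (A - xiMat N i k l m) z l j))
  have p5 := mul_le_mul_of_nonneg_right (e1 i i) (norm_nonneg (greenM N d (A - xiMat N i k l m) z l j))
  have p6 := mul_le_mul_of_nonneg_left (e2 i j) (norm_nonneg (greenM N d A z l i))
  have p7 := mul_le_mul_of_nonneg_left (e2 m j) (norm_nonneg (greenM N d A z k i))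
  have p8 := mul_le_mul_of_nonneg_right (e1 i m) (norm_nonneg (greenM N d (A - xiMat N i k l m) z k j))
  have q1 := mul_le_mul_of_nonneg_left (t1.trans s1) hΓ
  have q2 := mul_le_mul_of_nonneg_left (t2.trans s2) hΓ
  linarith

/-- The second order remainder in the expansion of `G` under a switch. -/
lemma norm_greenM_remainder_le (h : GreenBound N d z Γ ψ A)
    (hA : IsAdjMat N d A) (hd : 2 ≤ d) (hdN : 2 * d ≤ N) (hz : 0 < z.im) {i k l m : Fin N}
    (hA' : IsAdjMat N d (A - xiMat N i k l m)) (h' : GreenBound N d z Γ ψ (A - xiMat N i k l m))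
    (j : Fin N) :
    ‖greenM N d A z l j - greenM N d (A - xiMat N i k l m) z l j -
      ((qval N d)⁻¹ : ℝ) * greenM N d A z l l * greenM N d A z i j‖ ≤ (qval N d)⁻¹ * (Γ *
      (2 * ‖greenM N d A z l i‖ + 2 * ‖greenM N d A z l k‖ + ‖greenM N d A z l j‖ +
        ‖greenM N d (A - xiMat N i k l m) z m j‖ + ‖greenM N d (A - xiMat N i k l m) z k j‖ +
        16 * (qval N d)⁻¹ * Γ ^ 2)) := by
  have hκ : 0 < (qval N d)⁻¹ := inv_pos.2 (qval_pos hd hdN)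
  have hΓ : 0 ≤ Γ := (norm_nonneg _).trans (h.entry i i)
  have s1 := h.norm_sub_le hA hd hdN hz hA' h' i j
  have s2 := h.norm_sub_le hA hd hdN hz hA' h' l j
  have t2 := norm_sub_norm_le (greenM N d (A - xiMat N i k l m) z l j) (greenM N d A z l j)
  rw [norm_sub_rev] at t2
  have e1 := h.entry
  have e2 := h'.entry
  have e := greenM_switch hA hA' hz l j
  set G := greenM N d A z
  set G' := greenM N d (A - xiMat N i k l m) z
  have e' : G l j - G' l j - ((qval N d)⁻¹ : ℝ) * G l l * G i j = -(((qval N d)⁻¹ : ℝ) : ℂ) *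
      (G l i * G' k j + G l k * G' i j + G l l * G' m j + G l m * G' l j - G l i * G' l j
        + G l l * (G i j - G' i j) - G l k * G' m j - G l m * G' k j) := by
    rw [e]; push_cast; ring
  rw [e', norm_mul, norm_neg, Complex.norm_real, Real.norm_of_nonneg hκ.le]
  refine mul_le_mul_of_nonneg_left ?_ hκ.le
  have tri : ‖G l i * G' k j + G l k * G' i j + G l l * G' m j + G l m * G' l j - G l i * G' l j
        + G l l * (G i j - G' i j) - G l k * G' m j - G l m * G' k j‖ ≤
      ‖G l i‖ * ‖G' k j‖ + ‖G l k‖ * ‖G' i j‖ + ‖G l l‖ * ‖G' m j‖ + ‖G l m‖ * ‖G' l j‖ +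
        ‖G l i‖ * ‖G' l j‖ + ‖G l l‖ * ‖G i j - G' i j‖ + ‖G l k‖ * ‖G' m j‖ +
        ‖G l m‖ * ‖G' k j‖ := by
    simp only [← norm_mul]
    refine (norm_sub_le _ _).trans (add_le_add ?_ le_rfl)
    refine (norm_sub_le _ _).trans (add_le_add ?_ le_rfl)
    refine (norm_add_le _ _).trans (add_le_add ?_ le_rfl)
    refine (norm_sub_le _ _).trans (add_le_add ?_ le_rfl)
    refine (norm_add_le _ _).trans (add_le_add ?_ le_rfl)
    refine (norm_add_le _ _).trans (add_le_add ?_ le_rfl)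
    exact norm_add_le _ _
  refine tri.trans ?_
  have p1 := mul_le_mul_of_nonneg_left (e2 k j) (norm_nonneg (G l i))
  have p2 := mul_le_mul_of_nonneg_left (e2 i j) (norm_nonneg (G l k))
  have p3 := mul_le_mul_of_nonneg_right (e1 l l) (norm_nonneg (G' m j))
  have p4 := mul_le_mul_of_nonneg_right (e1 l m) (norm_nonneg (G' l j))
  have p5 := mul_le_mul_of_nonneg_left (e2 l j) (norm_nonneg (G l i))
  have p6 := mul_le_mul (e1 l l) s1 (norm_nonneg _) hΓ
  have p7 := mul_le_mul_of_nonneg_left (e2 m j) (norm_nonneg (G l k))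
  have p8 := mul_le_mul_of_nonneg_right (e1 l m) (norm_nonneg (G' k j))
  have q2 := mul_le_mul_of_nonneg_left (t2.trans s2) hΓ
  linarith

end

section

variable {N d : ℕ} {A A' : Matrix (Fin N) (Fin N) ℝ} {z : ℂ} {Γ ψ L : ℝ}

lemma mul_le_of_sum_bounds {u v u' v' r p a f g : ℝ} (ha : 0 ≤ a) (hg0 : 0 ≤ g)
    (h0 : 0 ≤ u + v + (u' + v') + r) (hf : f ≤ u + v + (u' + v') + r)
    (hg : g ≤ a * (4 * (u + v + (u' + v') + r) + 8 * p)) :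
    f * g ≤ a * (40 * (u ^ 2 + v ^ 2 + (u' ^ 2 + v' ^ 2) + r ^ 2) + 4 * p ^ 2) := by
  have hS2 : (u + v + (u' + v') + r) ^ 2 ≤
      5 * (u ^ 2 + v ^ 2 + (u' ^ 2 + v' ^ 2) + r ^ 2) := by
    linarith [sq_nonneg (u - v), sq_nonneg (u - u'), sq_nonneg (u - v'), sq_nonneg (u - r),
      sq_nonneg (v - u'), sq_nonneg (v - v'), sq_nonneg (v - r), sq_nonneg (u' - v'),
      sq_nonneg (u' - r), sq_nonneg (v' - r)]
  set S := u + v + (u' + v') + r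
  calc f * g ≤ S * (a * (4 * S + 8 * p)) := mul_le_mul hf hg hg0 h0
    _ = a * (4 * S ^ 2 + 8 * (S * p)) := by ring
    _ ≤ _ := by
        refine mul_le_mul_of_nonneg_left ?_ ha
        linarith [sq_nonneg (S - p)]

/-- `selfObs` as an average over switches. -/
lemma norm_selfObs_sub_average_le (h : GreenBound N d z Γ ψ A) (hA : IsAdjMat N d A) (hd : 2 ≤ d)
    (hdN : 2 * d ≤ N) (hz : 0 < z.im) (hΓ : 1 ≤ Γ) (hψ : 0 ≤ ψ) (hL : 1 ≤ L) {i : Fin N}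
    (hX : ‖diagObs N d z i A‖ ≤ L * (100 * (ψ + (qval N d)⁻¹ * Γ ^ 2))) (j : Fin N) :
    ‖selfObs N d z i j A - ((switchNorm N d : ℝ) : ℂ)⁻¹ * ∑ s, (switchWeight i A s : ℂ) *
      (greenM N d A z s.1 j - greenM N d (A - xiMat N i s.1 s.2.1 s.2.2) z s.2.1 j)‖ ≤
      200 * L * (Γ * ψ + (qval N d)⁻¹ * Γ ^ 3) + (switchNorm N d)⁻¹ * ∑ s, switchWeight i A s *
        ‖greenM N d A z s.2.1 j - greenM N d (A - xiMat N i s.1 s.2.1 s.2.2) z s.2.1 j -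
          ((qval N d)⁻¹ : ℝ) * greenM N d A z s.2.1 s.2.1 * greenM N d A z i j‖ := by
  have hκ : 0 < (qval N d)⁻¹ := inv_pos.2 (qval_pos hd hdN)
  have hκ1 := inv_qval_le_one hd hdN
  have hn := switchNorm_pos hd hdN
  have hN : (0 : ℝ) < N := by exact_mod_cast (by lia : 0 < N)
  have hΓ0 : 0 ≤ Γ := by linarith
  have h1 := norm_potential_sub_le hA hd hdN i (fun k => greenM N d A z k j)
    fun k => h.entry k j
  have h2 := norm_average_sub_le hA hd hdN i (fun k => greenM N d A z k k)
    (fun k => h.entry k k) (h.cube i)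
  have h3 : ‖(N : ℂ)⁻¹ * ∑ k, (hCube N d A i k : ℂ) * greenM N d A z k j‖ ≤ Γ * ψ := by
    rw [norm_mul, norm_inv, Complex.norm_natCast, inv_mul_le_iff₀ hN]
    calc _ ≤ ∑ k, Γ * ‖greenM N d A z k j‖ := by
          refine (norm_sum_le _ _).trans (Finset.sum_le_sum fun k _ => ?_)
          rw [norm_mul, Complex.norm_real]
          exact mul_le_mul_of_nonneg_right (h.cube i k) (norm_nonneg _)
      _ ≤ Γ * (N * ψ) := by rw [← Finset.mul_sum]; gcongr; exact h.sum_norm_le hψ j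
      _ = _ := by ring
  have h4 : ‖(N : ℂ)⁻¹‖ ≤ (qval N d)⁻¹ := by
    rw [norm_inv, Complex.norm_natCast]
    refine (inv_le_inv_qval_sq hd hdN).trans ?_
    nlinarith
  have h5 : ‖((switchNorm N d : ℝ) : ℂ)⁻¹ * ∑ s, (switchWeight i A s : ℂ) *
        (greenM N d A z s.2.1 j - greenM N d (A - xiMat N i s.1 s.2.1 s.2.2) z s.2.1 j -
          ((qval N d)⁻¹ : ℝ) * greenM N d A z s.2.1 s.2.1 * greenM N d A z i j)‖ ≤
      (switchNorm N d)⁻¹ * ∑ s, switchWeight i A s *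
        ‖greenM N d A z s.2.1 j - greenM N d (A - xiMat N i s.1 s.2.1 s.2.2) z s.2.1 j -
          ((qval N d)⁻¹ : ℝ) * greenM N d A z s.2.1 s.2.1 * greenM N d A z i j‖ := by
    rw [norm_mul, norm_inv, Complex.norm_real, Real.norm_of_nonneg hn.le]
    gcongr
    refine (norm_sum_le _ _).trans (Finset.sum_le_sum fun s _ => ?_)
    rw [norm_mul, Complex.norm_real, Real.norm_of_nonneg (switchWeight_nonneg hA s)]
  rw [sum_hMat_mul_greenM hA hz] at h1
  rw [← gbar_eq] at h2
  change ‖_ - (_ - diagObs N d z i A)‖ ≤ _ at h2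
  set W := ∑ s, (switchWeight i A s : ℂ) *
    (greenM N d A z s.1 j - greenM N d (A - xiMat N i s.1 s.2.1 s.2.2) z s.2.1 j) with hW
  set R := ∑ s, (switchWeight i A s : ℂ) *
    (greenM N d A z s.2.1 j - greenM N d (A - xiMat N i s.1 s.2.1 s.2.2) z s.2.1 j -
      ((qval N d)⁻¹ : ℝ) * greenM N d A z s.2.1 s.2.1 * greenM N d A z i j) with hR
  set Y := ∑ s, (switchWeight i A s : ℂ) * (greenM N d A z s.1 j - greenM N d A z s.2.1 j) with hY
  set D := ∑ s, (switchWeight i A s : ℂ) * greenM N d A z s.2.1 s.2.1 with hD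
  have hWR : W = Y + R + ((qval N d)⁻¹ : ℝ) * D * greenM N d A z i j := by
    rw [hW, hY, hR, hD, Finset.mul_sum, Finset.sum_mul, ← Finset.sum_add_distrib,
      ← Finset.sum_add_distrib]
    exact Finset.sum_congr rfl fun s _ => by ring
  set C := (N : ℂ)⁻¹ * ∑ k, (hCube N d A i k : ℂ) * greenM N d A z k j
  set X := diagObs N d z i A
  set T := (((qval N d)⁻¹ * (switchNorm N d)⁻¹ : ℝ) : ℂ) * D - (gbar N d A z - X) with hT
  set P := z * greenM N d A z i j + (if i = j then 1 else 0) - (N : ℂ)⁻¹ + C -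
    ((switchNorm N d : ℝ) : ℂ)⁻¹ * Y with hP
  have e : selfObs N d z i j A - ((switchNorm N d : ℝ) : ℂ)⁻¹ * W =
      P - C + (N : ℂ)⁻¹ - T * greenM N d A z i j + X * greenM N d A z i j -
        ((switchNorm N d : ℝ) : ℂ)⁻¹ * R := by
    rw [hWR, hP, hT, selfObs]; push_cast; ring
  have tri : ‖P - C + (N : ℂ)⁻¹ - T * greenM N d A z i j + X * greenM N d A z i j -
        ((switchNorm N d : ℝ) : ℂ)⁻¹ * R‖ ≤ ‖P‖ + ‖C‖ + ‖(N : ℂ)⁻¹‖ +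
        ‖T‖ * ‖greenM N d A z i j‖ + ‖X‖ * ‖greenM N d A z i j‖ +
        ‖((switchNorm N d : ℝ) : ℂ)⁻¹ * R‖ := by
    rw [← norm_mul, ← norm_mul]
    refine (norm_sub_le _ _).trans (add_le_add ?_ le_rfl)
    refine (norm_add_le _ _).trans (add_le_add ?_ le_rfl)
    refine (norm_sub_le _ _).trans (add_le_add ?_ le_rfl)
    refine (norm_add_le _ _).trans (add_le_add ?_ le_rfl)
    exact norm_sub_le _ _
  have hG := h.entry i j
  have hTG := mul_le_mul h2 hG (norm_nonneg _) (by positivity)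
  have hXG := mul_le_mul hX hG (norm_nonneg _) (by positivity)
  rw [e]
  refine tri.trans ?_
  have b1 : 16 * (qval N d)⁻¹ * Γ ≤ 16 * (qval N d)⁻¹ * Γ ^ 3 := by
    gcongr; exact le_self_pow₀ hΓ (by norm_num)
  have b2 : (qval N d)⁻¹ ≤ (qval N d)⁻¹ * Γ ^ 3 := le_mul_of_one_le_right hκ.le (one_le_pow₀ hΓ)
  have b3 : (8 * (qval N d)⁻¹ ^ 2 + 2 * (qval N d)⁻¹ * Γ) * Γ * Γ ≤
      10 * ((qval N d)⁻¹ * Γ ^ 3) := by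
    have : (qval N d)⁻¹ ^ 2 * Γ ^ 2 ≤ (qval N d)⁻¹ * Γ ^ 3 := by
      gcongr
      · nlinarith
      · norm_num
    linarith
  have b4 : Γ * ψ + (qval N d)⁻¹ * Γ ^ 3 ≤ L * (Γ * ψ + (qval N d)⁻¹ * Γ ^ 3) :=
    le_mul_of_one_le_left (by positivity) hL
  have b5 : 0 ≤ Γ * ψ := by positivity
  have b6 : 0 ≤ L * (Γ * ψ + (qval N d)⁻¹ * Γ ^ 3) := by positivity
  linarith

/-- Concentration input for `selfObs`. -/
lemma self_switchBound (hd : 2 ≤ d) (hdN : 2 * d ≤ N) (hz : 0 < z.im) (hNz : 1 ≤ N * z.im)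
    (hzN : ‖z‖ ≤ N) (hzΓ : ‖z‖ ≤ Γ) (hΓ : 1 ≤ Γ) (hψ : 0 ≤ ψ) (hψΓ : ψ ≤ Γ) (hL : 1 ≤ L)
    (i j : Fin N) :
    SwitchBound (regSwitch N d i)
      (fun A => GreenBound N d z Γ ψ A ∧
        ‖diagObs N d z i A‖ ≤ L * (100 * (ψ + (qval N d)⁻¹ * Γ ^ 2)))
      (selfObs N d z i j)
      (fun A s => greenM N d A z s.1 j - greenM N d (A - xiMat N i s.1 s.2.1 s.2.2) z s.2.1 j)
      (switchNorm N d) (200 * L * (Γ * ψ + (qval N d)⁻¹ * Γ ^ 3)) ((N : ℝ) ^ 4)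
      (fun A s => ‖greenM N d A z s.2.1 j -
        greenM N d (A - xiMat N i s.1 s.2.1 s.2.2) z s.2.1 j -
          ((qval N d)⁻¹ : ℝ) * greenM N d A z s.2.1 s.2.1 * greenM N d A z i j‖)
      (fun A s => (qval N d)⁻¹ * Γ * (2 * ‖greenM N d A z s.2.1 i‖ +
        2 * ‖greenM N d A z s.2.1 s.1‖ + ‖greenM N d A z s.2.2 j‖ + ‖greenM N d A z s.2.1 j‖ +
        8 * (qval N d)⁻¹ * Γ ^ 2))
      (fun A s => (qval N d)⁻¹ * Γ ^ 2 * (40 * ‖greenM N d A z s.2.1 j‖ ^ 2 +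
        40 * ‖greenM N d A z s.2.1 i‖ ^ 2 + 5120 * (qval N d)⁻¹ ^ 2 * Γ ^ 4 + 2 * ψ ^ 2)) := by
  have hq := qval_pos hd hdN
  have hn := switchNorm_pos hd hdN
  have hκ1 := inv_qval_le_one hd hdN
  have hκ0 : 0 < (qval N d)⁻¹ := inv_pos.2 hq
  have hN : (4 : ℝ) ≤ N := by exact_mod_cast (by lia : 4 ≤ N)
  have hK2 : 16 * (N : ℝ) ^ 2 ≤ (N : ℝ) ^ 4 := by
    nlinarith [mul_self_le_mul_self (by norm_num) hN, sq_nonneg (N : ℝ)]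
  have hΓ0 : 0 ≤ Γ := by linarith
  have hL0 : 0 < L := by linarith
  have hΓψ : 0 ≤ Γ * ψ := by positivity
  have hmv : ∀ A ∈ (regSwitch N d i).pts, ∀ s, (regSwitch N d i).w A s ≠ 0 →
      IsAdjMat N d (A - xiMat N i s.1 s.2.1 s.2.2) := fun A hA s hs =>
    (switchWeight_switch (mem_regPts.1 hA) hs).1
  have hE : Γ * ψ + (qval N d)⁻¹ * Γ ^ 3 ≤ L * (Γ * ψ + (qval N d)⁻¹ * Γ ^ 3) :=
    le_mul_of_one_le_left (by positivity) hL
  have hgr : ∀ A ∈ (regSwitch N d i).pts, ∀ a b, ‖greenM N d A z a b‖ ≤ N := fun A hA =>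
    norm_greenM_le_card (mem_regPts.1 hA) hz hNz
  have hsub : ∀ A ∈ (regSwitch N d i).pts, ∀ s, (regSwitch N d i).w A s ≠ 0 → ∀ k k' : Fin N,
      ‖greenM N d A z k j - greenM N d (A - xiMat N i s.1 s.2.1 s.2.2) z k' j‖ ≤ (N : ℝ) + N :=
    fun A hA s hs k k' => (norm_sub_le _ _).trans (add_le_add (hgr A hA k j)
      (norm_greenM_le_card (hmv A hA s hs) hz hNz k' j))
  have hs1 : ∀ A, GreenBound N d z Γ ψ A → ∀ a, ∑ l, ‖greenM N d A z l a‖ ≤ N * ψ :=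
    fun A h a => h.sum_norm_le hψ a
  refine
    { n_pos := hn
      E_pos := by positivity
      one_le_K := by nlinarith
      antisymm := fun A hA s hs => ?_
      approx := fun A hA h => norm_selfObs_sub_average_le h.1 (mem_regPts.1 hA) hd hdN hz hΓ hψ hL
        h.2 j
      err_le := fun A hA s hs h h' => ?_
      b_nonneg := fun A hA s => by positivity
      b_sum := fun A hA h => ?_
      incr_le := fun A hA s hs h h' => ?_
      c_nonneg := fun A hA s => by positivity
      c_sum := fun A hA h => ?_
      Z_move := fun A hA s hs h h' => ?_
      Z_le := fun A hA => ?_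
      F_le := fun A hA s hs => (hsub A hA s hs _ _).trans (by nlinarith)
      b'_le := fun A hA s hs => ?_
      w_sum := fun A hA => regSwitch_sum_le (mem_regPts.1 hA) hd hdN i }
  · have := (regSwitch N d i).move_move A hA s hs
    simp only [regSwitch] at this ⊢
    rw [this]; ring
  · refine (norm_greenM_remainder_le h.1 (mem_regPts.1 hA) hd hdN hz (hmv A hA s hs) h'.1 j).trans ?_
    dsimp only [regSwitch]
    have : 0 ≤ (qval N d)⁻¹ * Γ * (2 * ‖greenM N d (A - xiMat N i s.1 s.2.1 s.2.2) z s.1 i‖ +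
      2 * ‖greenM N d (A - xiMat N i s.1 s.2.1 s.2.2) z s.1 s.2.1‖ +
      ‖greenM N d A z s.2.2 j‖) := by positivity
    linarith
  · have hA' := mem_regPts.1 hA
    have t1 := sum_switchWeight_mul_le hA' i (f := fun _ l => ‖greenM N d A z l i‖)
      (fun _ _ => norm_nonneg _) fun _ => hs1 A h.1 i
    have t2 := sum_switchWeight_mul_le hA' i (f := fun k l => ‖greenM N d A z l k‖)
      (fun _ _ => norm_nonneg _) fun k => hs1 A h.1 k
    have t3 := sum_switchWeight_mul_le' hA' i (f := fun m => ‖greenM N d A z m j‖)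
      (fun _ => norm_nonneg _) (hs1 A h.1 j)
    have t4 := sum_switchWeight_mul_le hA' i (f := fun _ l => ‖greenM N d A z l j‖)
      (fun _ _ => norm_nonneg _) fun _ => hs1 A h.1 j
    have t5 := sum_switchWeight_le hA' i
    have e : ∑ s, (regSwitch N d i).w A s * ((qval N d)⁻¹ * Γ * (2 * ‖greenM N d A z s.2.1 i‖ +
        2 * ‖greenM N d A z s.2.1 s.1‖ + ‖greenM N d A z s.2.2 j‖ + ‖greenM N d A z s.2.1 j‖ +
        8 * (qval N d)⁻¹ * Γ ^ 2)) = (qval N d)⁻¹ * Γ *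
        (2 * ∑ s, switchWeight i A s * ‖greenM N d A z s.2.1 i‖ +
        2 * ∑ s, switchWeight i A s * ‖greenM N d A z s.2.1 s.1‖ +
        ∑ s, switchWeight i A s * ‖greenM N d A z s.2.2 j‖ +
        ∑ s, switchWeight i A s * ‖greenM N d A z s.2.1 j‖ +
        8 * (qval N d)⁻¹ * Γ ^ 2 * ∑ s, switchWeight i A s) := by
      simp only [Finset.mul_sum, ← Finset.sum_add_distrib]
      refine Finset.sum_congr rfl fun s _ => ?_
      dsimp only [regSwitch]; ring
    rw [e]
    have t6 := mul_le_mul_of_nonneg_left t5 (by positivity : 0 ≤ 8 * (qval N d)⁻¹ * Γ ^ 2)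
    calc _ ≤ (qval N d)⁻¹ * Γ * (d ^ 2 * N * (6 * ψ + 8 * (qval N d)⁻¹ * Γ ^ 2)) := by
          refine mul_le_mul_of_nonneg_left ?_ (by positivity)
          linarith
      _ ≤ (qval N d)⁻¹ * Γ * (4 * qval N d * switchNorm N d *
            (6 * ψ + 8 * (qval N d)⁻¹ * Γ ^ 2)) := by
          refine mul_le_mul_of_nonneg_left (mul_le_mul_of_nonneg_right ?_ (by positivity))
            (by positivity)
          exact deg_sq_mul_le hd hdN
      _ = switchNorm N d * (24 * (Γ * ψ) + 32 * ((qval N d)⁻¹ * Γ ^ 3)) := by field_simp; ring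
      _ ≤ _ := by
          refine mul_le_mul_of_nonneg_left ?_ hn.le
          have : 0 ≤ (qval N d)⁻¹ * Γ ^ 3 := by positivity
          linarith
  · have hA' := mem_regPts.1 hA
    have hA'' := hmv A hA s hs
    dsimp only [regSwitch] at h' ⊢
    have r0 := norm_selfObs_sub_le hzΓ h.1 hA' hd hdN hz hA'' h'.1 j
    have r1 := norm_greenM_sub_row_le h.1 hA' hd hdN hz hA'' h'.1 j
    have r2 := h.1.norm_sub_le hA' hd hdN hz hA'' h'.1 s.1 j
    have r3 := h.1.norm_sub_le hA' hd hdN hz hA'' h'.1 s.2.1 j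
    set G := greenM N d A z
    set G' := greenM N d (A - xiMat N i s.1 s.2.1 s.2.2) z
    set u := ‖G s.2.1 j‖ with hu
    set v := ‖G s.2.1 i‖
    set u' := ‖G' s.1 j‖ with hu'
    set v' := ‖G' s.1 i‖
    set κ := (qval N d)⁻¹
    have hu0 : 0 ≤ u := norm_nonneg _
    have hv0 : 0 ≤ v := norm_nonneg _
    have hu'0 : 0 ≤ u' := norm_nonneg _
    have hv'0 : 0 ≤ v' := norm_nonneg _
    have hF : ‖G s.1 j - G' s.2.1 j‖ ≤ u + v + (u' + v') + 16 * κ * Γ ^ 2 := by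
      have e : G s.1 j - G' s.2.1 j = (G s.1 j - G' s.1 j) + G' s.1 j +
        (-G s.2.1 j + (G s.2.1 j - G' s.2.1 j)) := by ring
      rw [e]
      refine (norm_add_le _ _).trans ((add_le_add (norm_add_le _ _) (norm_add_le _ _)).trans ?_)
      rw [norm_neg]
      linarith
    set S := u + v + (u' + v') + 16 * κ * Γ ^ 2
    have hS0 : 0 ≤ S := by positivity
    have hZ : ‖selfObs N d z i j A - selfObs N d z i j (A - xiMat N i s.1 s.2.1 s.2.2)‖ ≤
        κ * Γ ^ 2 * (4 * S + 8 * ψ) := by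
      have w1 := mul_le_mul_of_nonneg_left r1 (by positivity : 0 ≤ 2 * Γ)
      have w2 : 8 * κ * ψ ^ 2 * Γ ≤ 8 * κ * (ψ * Γ) * Γ := by
        rw [sq]; gcongr
      linarith
    refine (mul_le_of_sum_bounds (by positivity) (norm_nonneg _) hS0 hF hZ).trans_eq ?_
    ring
  · have hA' := mem_regPts.1 hA
    have t1 := sum_switchWeight_mul_le hA' i (f := fun _ l => ‖greenM N d A z l i‖ ^ 2)
      (fun _ _ => by positivity) fun _ => h.1.row i
    have t4 := sum_switchWeight_mul_le hA' i (f := fun _ l => ‖greenM N d A z l j‖ ^ 2)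
      (fun _ _ => by positivity) fun _ => h.1.row j
    have t5 := sum_switchWeight_le hA' i
    have e : ∑ s, (regSwitch N d i).w A s * ((qval N d)⁻¹ * Γ ^ 2 *
        (40 * ‖greenM N d A z s.2.1 j‖ ^ 2 +
        40 * ‖greenM N d A z s.2.1 i‖ ^ 2 + 5120 * (qval N d)⁻¹ ^ 2 * Γ ^ 4 + 2 * ψ ^ 2)) =
        (qval N d)⁻¹ * Γ ^ 2 *
        (40 * ∑ s, switchWeight i A s * ‖greenM N d A z s.2.1 j‖ ^ 2 +
        40 * ∑ s, switchWeight i A s * ‖greenM N d A z s.2.1 i‖ ^ 2 +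
        (5120 * (qval N d)⁻¹ ^ 2 * Γ ^ 4 + 2 * ψ ^ 2) * ∑ s, switchWeight i A s) := by
      simp only [Finset.mul_sum, ← Finset.sum_add_distrib]
      refine Finset.sum_congr rfl fun s _ => ?_
      dsimp only [regSwitch]; ring
    rw [e]
    have t6 := mul_le_mul_of_nonneg_left t5
      (by positivity : 0 ≤ 5120 * (qval N d)⁻¹ ^ 2 * Γ ^ 4 + 2 * ψ ^ 2)
    calc _ ≤ (qval N d)⁻¹ * Γ ^ 2 * (d ^ 2 * N * (82 * ψ ^ 2 + 5120 * (qval N d)⁻¹ ^ 2 * Γ ^ 4)) := by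
          refine mul_le_mul_of_nonneg_left ?_ (by positivity)
          linarith
      _ ≤ (qval N d)⁻¹ * Γ ^ 2 * (4 * qval N d * switchNorm N d *
            (82 * ψ ^ 2 + 5120 * (qval N d)⁻¹ ^ 2 * Γ ^ 4)) := by
          refine mul_le_mul_of_nonneg_left (mul_le_mul_of_nonneg_right ?_ (by positivity))
            (by positivity)
          exact deg_sq_mul_le hd hdN
      _ = switchNorm N d * (328 * (Γ * ψ) ^ 2 + 20480 * ((qval N d)⁻¹ * Γ ^ 3) ^ 2) := by
          field_simp; ring
      _ ≤ switchNorm N d * (200 * (Γ * ψ + (qval N d)⁻¹ * Γ ^ 3)) ^ 2 := by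
          refine mul_le_mul_of_nonneg_left ?_ hn.le
          have : 0 ≤ (qval N d)⁻¹ * Γ ^ 3 := by positivity
          nlinarith [mul_nonneg hΓψ this]
      _ ≤ _ := by
          refine mul_le_mul_of_nonneg_left (pow_le_pow_left₀ (by positivity) ?_ 2) hn.le
          linarith
  · have hA' := mem_regPts.1 hA
    have hA'' := hmv A hA s hs
    have r0 := norm_selfObs_sub_le hzΓ h.1 hA' hd hdN hz hA'' h'.1 j
    have r2 := mul_le_mul_of_nonneg_left (h.1.norm_sub_le hA' hd hdN hz hA'' h'.1 i j)
      (by positivity : 0 ≤ 2 * Γ)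
    have r3 : 8 * (qval N d)⁻¹ * ψ ^ 2 * Γ ≤ 8 * (qval N d)⁻¹ * Γ ^ 2 * Γ := by gcongr
    refine r0.trans ?_
    have : 0 ≤ (qval N d)⁻¹ * Γ ^ 3 := by positivity
    linarith
  · have g1 := hgr A hA
    have g2 : ‖gbar N d A z‖ ≤ N := norm_gbar_le (by lia) fun x => g1 x x
    rw [selfObs]
    have n1 : ‖(if i = j then 1 else 0 : ℂ)‖ ≤ 1 := by split_ifs <;> simp
    calc _ ≤ 1 + (N : ℝ) * N + N * N := by
          refine norm_add₃_le.trans (add_le_add (add_le_add n1 ?_) ?_) <;> rw [norm_mul]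
          · exact mul_le_mul hzN (g1 i j) (norm_nonneg _) (by positivity)
          · exact mul_le_mul g2 (g1 i j) (norm_nonneg _) (by positivity)
      _ ≤ _ := by nlinarith
  · refine (norm_sub_le _ _).trans ((add_le_add (hsub A hA s hs _ _) le_rfl).trans ?_)
    rw [norm_mul, norm_mul, Complex.norm_real, Real.norm_of_nonneg hκ0.le]
    have : (qval N d)⁻¹ * ‖greenM N d A z s.2.1 s.2.1‖ * ‖greenM N d A z i j‖ ≤ 1 * N * N := by
      gcongr
      · exact hgr A hA _ _
      · exact hgr A hA _ _
    nlinarith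

end

section

variable {z : ℂ}

lemma continuous_semicircle_integrand (hz : 0 < z.im) :
    Continuous fun x : ℝ =>
      ((Real.sqrt (4 - x ^ 2) / (2 * Real.pi) : ℝ) : ℂ) / ((x : ℂ) - z) := by
  refine Continuous.div (by fun_prop) (by fun_prop) fun x h => ?_
  have := congrArg Complex.im h
  simp at this
  linarith

lemma mSC_im_nonneg (hz : 0 < z.im) : 0 ≤ (mSC z).im := by
  have h := Complex.imCLM.intervalIntegral_comp_comm
    ((continuous_semicircle_integrand hz).intervalIntegrable (μ := volume) (-2) 2)
  simp only [Complex.imCLM_apply] at h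
  rw [mSC, ← h]
  refine intervalIntegral.integral_nonneg (by norm_num) fun x _ => ?_
  rw [div_eq_mul_inv, Complex.im_ofReal_mul, Complex.inv_im]
  refine mul_nonneg (by positivity) (div_nonneg ?_ (Complex.normSq_nonneg _))
  simpa using hz.le

lemma abs_arsinh_le (y : ℝ) : |Real.arsinh y| ≤ Real.log (1 + 2 * |y|) := by
  wlog hy : 0 ≤ y generalizing y
  · simpa [Real.arsinh_neg] using this (-y) (by linarith)
  rw [abs_of_nonneg (Real.arsinh_nonneg_iff.2 hy), abs_of_nonneg hy, Real.arsinh]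
  refine Real.log_le_log (by positivity) ?_
  have : Real.sqrt (1 + y ^ 2) ≤ 1 + y := Real.sqrt_le_iff.2 ⟨by linarith, by nlinarith⟩
  linarith

lemma norm_mSC_le (hz : 0 < z.im) :
    ‖mSC z‖ ≤ 2 * Real.log (1 + 2 * ((2 + |z.re|) / z.im)) := by
  have hn : ∀ x : ℝ, ‖(x : ℂ) - z‖ = z.im * Real.sqrt (1 + ((x - z.re) / z.im) ^ 2) := fun x => by
    rw [Complex.norm_eq_sqrt_sq_add_sq, ← Real.sqrt_sq hz.le, ← Real.sqrt_mul (by positivity),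
      Real.sqrt_sq hz.le]
    congr 1
    simp
    field_simp
    ring
  have hd : ∀ x : ℝ, HasDerivAt (fun x : ℝ => Real.arsinh ((x - z.re) / z.im))
      (‖(x : ℂ) - z‖⁻¹) x := fun x => by
    have h := (((hasDerivAt_id x).sub_const z.re).div_const z.im).arsinh
    rw [hn, mul_inv]
    rw [smul_eq_mul, one_div, mul_comm] at h
    exact h
  have hne : ∀ x : ℝ, ‖(x : ℂ) - z‖ ≠ 0 := fun x => by
    rw [hn]; positivity
  have hintegrable : IntervalIntegrable (fun x : ℝ => ‖(x : ℂ) - z‖⁻¹) volume (-2) 2 :=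
    (Continuous.inv₀ (by fun_prop) hne).intervalIntegrable _ _
  have hI := intervalIntegral.integral_eq_sub_of_hasDerivAt (fun x _ => hd x) hintegrable
  have hb : ∀ y : ℝ, |y| = 2 → |Real.arsinh ((y - z.re) / z.im)| ≤
      Real.log (1 + 2 * ((2 + |z.re|) / z.im)) := fun y hy => by
    refine (abs_arsinh_le _).trans (Real.log_le_log (by positivity) ?_)
    rw [abs_div, abs_of_pos hz]
    gcongr
    exact (abs_sub _ _).trans (by rw [hy])
  calc ‖mSC z‖ ≤ ∫ x in (-2 : ℝ)..2, ‖(x : ℂ) - z‖⁻¹ := by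
        refine (intervalIntegral.norm_integral_le_integral_norm (by norm_num)).trans ?_
        refine intervalIntegral.integral_mono_on (by norm_num)
          ((continuous_semicircle_integrand hz).norm.intervalIntegrable (-2) 2) hintegrable fun x _ => ?_
        rw [norm_div, Complex.norm_real, Real.norm_of_nonneg (by positivity), div_eq_mul_inv]
        refine mul_le_of_le_one_left (by positivity) ?_
        rw [div_le_one (by positivity)]
        have h1 : Real.sqrt (4 - x ^ 2) ≤ 2 := Real.sqrt_le_iff.2 ⟨by norm_num, by nlinarith [sq_nonneg x]⟩
        linarith [Real.pi_gt_three]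
    _ ≤ _ := by
        rw [hI]
        have h1 := hb 2 (by norm_num)
        have h2 := hb (-2) (by norm_num)
        linarith [abs_le.1 h1, abs_le.1 h2, (abs_le.1 h1).2, (abs_le.1 h2).1]

end

section

variable {N d : ℕ}

lemma PrReg_mono {E E' : Matrix (Fin N) (Fin N) ℝ → Prop}
    (h : ∀ A, IsAdjMat N d A → E A → E' A) : PrReg N d E ≤ PrReg N d E' := by
  classical
  rw [PrReg_eq, PrReg_eq]
  gcongr with A hA
  exact h A (mem_regPts.1 hA)

lemma PrReg_exists_le {ι : Type} [Fintype ι] (E : ι → Matrix (Fin N) (Fin N) ℝ → Prop) :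
    PrReg N d (fun A => ∃ x, E x A) ≤ ∑ x, PrReg N d (E x) := by
  classical
  simp only [PrReg_eq]
  rw [← Finset.sum_div]
  gcongr
  have : (regPts N d).filter (fun A => ∃ x, E x A) ⊆
      Finset.univ.biUnion fun x => (regPts N d).filter (E x) := fun A hA => by
    simp only [Finset.mem_filter, Finset.mem_biUnion, Finset.mem_univ, true_and] at hA ⊢
    obtain ⟨h, x, hx⟩ := hA
    exact ⟨x, h, hx⟩
  have := (Finset.card_le_card this).trans Finset.card_biUnion_le
  norm_cast
  convert this
  rfl

lemma PrReg_or_le (E E' : Matrix (Fin N) (Fin N) ℝ → Prop) :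
    PrReg N d (fun A => E A ∨ E' A) ≤ PrReg N d E + PrReg N d E' := by
  classical
  simp only [PrReg_eq]
  rw [← add_div]
  gcongr
  have := Finset.card_union_le ((regPts N d).filter E) ((regPts N d).filter E')
  rw [← Finset.filter_or] at this
  norm_cast
  convert this

lemma tailConst_nonneg (k : ℕ) : 0 ≤ tailConst k := by
  unfold tailConst
  positivity

lemma SwitchBound.prReg_le {i : Fin N} {good : Matrix (Fin N) (Fin N) ℝ → Prop}
    {Z : Matrix (Fin N) (Fin N) ℝ → ℂ}
    {F : Matrix (Fin N) (Fin N) ℝ → Fin N × Fin N × Fin N → ℂ} {n E : ℝ}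
    {b' b c : Matrix (Fin N) (Fin N) ℝ → Fin N × Fin N × Fin N → ℝ}
    (h : SwitchBound (regSwitch N d i) good Z F n E ((N : ℝ) ^ 4) b' b c)
    (hE : (N : ℝ)⁻¹ ≤ E) (k : ℕ) (hbad : PrReg N d (fun A => ¬good A) ≤ ((N : ℝ) ^ (5 * k + 14))⁻¹)
    {t : ℝ} (ht : 0 < t) :
    PrReg N d (fun A => t * E ≤ ‖Z A‖) ≤ tailConst k * (t ^ (k + 2))⁻¹ * 2 := by
  classical
  have hN : (0 : ℝ) < N := by
    have : 0 < N := i.pos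
    exact_mod_cast this
  have hC := tailConst_nonneg k
  rw [PrReg_eq] at hbad ⊢
  rcases (regPts N d).card.eq_zero_or_pos with h0 | h0
  · rw [h0]; simp; positivity
  have h0' : (0 : ℝ) < (regPts N d).card := by exact_mod_cast h0
  have hm := h.card_large_le k ht
  change (((regPts N d).filter fun A => t * E ≤ ‖Z A‖).card : ℝ) ≤ _ * _ * ((regPts N d).card + _ *
    ((regPts N d).filter fun A => ¬good A).card) at hm
  rw [div_le_iff₀ h0'] at hbad ⊢
  refine hm.trans ?_
  rw [mul_assoc _ 2]
  refine mul_le_mul_of_nonneg_left ?_ (by positivity)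
  have hEk : (E ^ (k + 2))⁻¹ ≤ (N : ℝ) ^ (k + 2) := by
    rw [← inv_pow]
    exact pow_le_pow_left₀ (inv_nonneg.2 h.E_pos.le) (inv_le_of_inv_le₀ hN hE) _
  have : ((N : ℝ) ^ 4) ^ (k + 3) * (E ^ (k + 2))⁻¹ *
      ((regPts N d).filter fun A => ¬good A).card ≤ (regPts N d).card := by
    calc _ ≤ ((N : ℝ) ^ 4) ^ (k + 3) * (N : ℝ) ^ (k + 2) *
          (((N : ℝ) ^ (5 * k + 14))⁻¹ * (regPts N d).card) := by
          gcongr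
          convert hbad
      _ = (N : ℝ) ^ (5 * k + 14) * ((N : ℝ) ^ (5 * k + 14))⁻¹ * (regPts N d).card := by ring
      _ = _ := by rw [mul_inv_cancel₀ (by positivity), one_mul]
  linarith

/-- A sequence of events whose probability decays faster than any power of `N`. -/
def Rare (d : ℕ → ℕ) (E : ∀ N, Matrix (Fin N) (Fin N) ℝ → Prop) : Prop :=
  ∀ D > (0 : ℝ), ∀ᶠ N : ℕ in atTop, PrReg N (d N) (E N) ≤ (N : ℝ) ^ (-D)

lemma Rare.mono {d : ℕ → ℕ} {E E' : ∀ N, Matrix (Fin N) (Fin N) ℝ → Prop} (h : Rare d E')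
    (hEE' : ∀ᶠ N : ℕ in atTop, ∀ A, IsAdjMat N (d N) A → E N A → E' N A) : Rare d E := fun D hD => by
  filter_upwards [h D hD, hEE'] with N h1 h2
  exact (PrReg_mono h2).trans h1

lemma Rare.or {d : ℕ → ℕ} {E E' : ∀ N, Matrix (Fin N) (Fin N) ℝ → Prop} (h : Rare d E)
    (h' : Rare d E') : Rare d fun N A => E N A ∨ E' N A := fun D hD => by
  filter_upwards [h (D + 1) (by linarith), h' (D + 1) (by linarith), eventually_ge_atTop 2]
    with N h1 h2 hN
  have hN' : (2 : ℝ) ≤ N := by exact_mod_cast hN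
  refine (PrReg_or_le _ _).trans ?_
  have : (N : ℝ) ^ (-D) = (N : ℝ) ^ (-(D + 1)) * N := by
    rw [← Real.rpow_add_one (by positivity)]; ring_nf
  rw [this]
  have : 0 ≤ (N : ℝ) ^ (-(D + 1)) := by positivity
  nlinarith

lemma rare_of_switchBound {d : ℕ → ℕ} {ι : ℕ → Type} [∀ N, Fintype (ι N)]
    (hι : ∀ N, Fintype.card (ι N) ≤ N ^ 2) (v : ∀ N, ι N → Fin N)
    {good : ∀ N, ι N → Matrix (Fin N) (Fin N) ℝ → Prop}
    {Z : ∀ N, ι N → Matrix (Fin N) (Fin N) ℝ → ℂ} {E : ℕ → ℝ}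
    (h : ∀ᶠ N : ℕ in atTop, (N : ℝ)⁻¹ ≤ E N ∧ ∀ x : ι N, ∃ F n b' b c,
      SwitchBound (regSwitch N (d N) (v N x)) (good N x) (Z N x) F n (E N) ((N : ℝ) ^ 4) b' b c)
    (hbad : Rare d fun N A => ∃ x, ¬good N x A) {a : ℝ} (ha : 0 < a) :
    Rare d fun N A => ∃ x, (N : ℝ) ^ a * E N ≤ ‖Z N x A‖ := fun D hD => by
  obtain ⟨k, hk⟩ := exists_nat_ge ((D + 3) / a)
  rw [div_le_iff₀ ha] at hk
  have hc : ∀ᶠ N : ℕ in atTop, tailConst k * 2 ≤ (N : ℝ) :=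
    tendsto_natCast_atTop_atTop.eventually_ge_atTop _
  filter_upwards [h, hbad (5 * k + 14) (by positivity), hc, eventually_ge_atTop 1]
    with N ⟨hE, hS⟩ hb hc hN
  have hN' : (1 : ℝ) ≤ N := by exact_mod_cast hN
  have hC := tailConst_nonneg k
  have hx : ∀ x : ι N, PrReg N (d N) (fun A => (N : ℝ) ^ a * E N ≤ ‖Z N x A‖) ≤
      (N : ℝ) * ((N : ℝ) ^ (D + 3))⁻¹ := fun x => by
    obtain ⟨F, n, b', b, c, hSx⟩ := hS x
    have hbx : PrReg N (d N) (fun A => ¬good N x A) ≤ ((N : ℝ) ^ (5 * k + 14))⁻¹ := by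
      refine (PrReg_mono fun A _ hA => ⟨x, hA⟩).trans (hb.trans_eq ?_)
      rw [Real.rpow_neg (by positivity), ← Real.rpow_natCast]
      push_cast; rfl
    refine (hSx.prReg_le hE k hbx (t := (N : ℝ) ^ a) (by positivity)).trans ?_
    rw [mul_right_comm]
    gcongr
    rw [← Real.rpow_natCast, ← Real.rpow_mul (by positivity)]
    refine Real.rpow_le_rpow_of_exponent_le hN' ?_
    push_cast
    linarith
  refine (PrReg_exists_le _).trans ((Finset.sum_le_sum fun x _ => hx x).trans ?_)
  rw [Finset.sum_const, nsmul_eq_mul, Finset.card_univ]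
  have hcard : (Fintype.card (ι N) : ℝ) ≤ (N : ℝ) ^ 2 := by exact_mod_cast hι N
  calc _ ≤ (N : ℝ) ^ 2 * ((N : ℝ) * ((N : ℝ) ^ (D + 3))⁻¹) := by gcongr
    _ = (N : ℝ) ^ 3 * ((N : ℝ) ^ (D + 3))⁻¹ := by ring
    _ = _ := by
        rw [← Real.rpow_neg (by positivity), ← Real.rpow_natCast, ← Real.rpow_add (by positivity)]
        congr 1; push_cast; ring

end

/-- The deterministic conditions on the parameters, at control level `T`, that hold for all
large `N`. -/
structure Admissible (N d : ℕ) (z : ℂ) (φ T : ℝ) : Prop where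
  two_le_deg : 2 ≤ d
  two_mul_deg_le : 2 * d ≤ N
  im_pos : 0 < z.im
  one_le_mul_im : 1 ≤ N * z.im
  norm_le_card : ‖z‖ ≤ N
  norm_le : ‖z‖ ≤ T
  const_le : 41000 ≤ T
  norm_mSC_le : ‖mSC z‖ ≤ T
  mul_inv_qval_le : T * (qval N d)⁻¹ ≤ 1
  error_nonneg : 0 ≤ φ

/-- A priori bound on the Green function entries. -/
def entryScale (φ T : ℝ) : ℝ := T ^ 2 * (1 + φ)

/-- A priori bound on the root mean square of a row of the Green function. -/
def rowScale (N : ℕ) (z : ℂ) (φ T : ℝ) : ℝ :=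
  √(T * ((φ + (mSC z).im) / (N * z.im)))

namespace Admissible

variable {N d : ℕ} {z : ℂ} {φ T : ℝ} {A : Matrix (Fin N) (Fin N) ℝ}

lemma one_le_entryScale (h : Admissible N d z φ T) : 1 ≤ entryScale φ T := by
  have h1 := h.const_le
  have h2 := h.error_nonneg
  unfold entryScale
  nlinarith [mul_nonneg (sq_nonneg T) h2]

lemma le_entryScale (h : Admissible N d z φ T) : T ≤ entryScale φ T := by
  have h1 := h.const_le
  have h2 := h.error_nonneg
  unfold entryScale
  nlinarith [mul_nonneg (sq_nonneg T) h2]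

lemma im_term_nonneg (h : Admissible N d z φ T) :
    0 ≤ (φ + (mSC z).im) / (N * z.im) := by
  have h1 := mSC_im_nonneg h.im_pos
  have h2 := h.error_nonneg
  have h3 := h.one_le_mul_im
  positivity

lemma rowScale_sq (h : Admissible N d z φ T) :
    rowScale N z φ T ^ 2 = T * ((φ + (mSC z).im) / (N * z.im)) :=
  Real.sq_sqrt (mul_nonneg (by linarith [h.const_le]) h.im_term_nonneg)

lemma rowScale_le_entryScale (h : Admissible N d z φ T) : rowScale N z φ T ≤ entryScale φ T := by
  have h1 := h.const_le
  have h2 := h.error_nonneg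
  have h3 := h.one_le_mul_im
  have h4 : (mSC z).im ≤ T :=
    ((le_abs_self _).trans (Complex.abs_im_le_norm _)).trans h.norm_mSC_le
  have h5 := mSC_im_nonneg h.im_pos
  refine le_of_sq_le_sq ?_ (zero_le_one.trans h.one_le_entryScale)
  rw [h.rowScale_sq]
  calc T * ((φ + (mSC z).im) / (N * z.im)) ≤ T * (φ + T) := by
        gcongr
        exact (div_le_self (by positivity) h3).trans (by linarith)
    _ ≤ entryScale φ T := by unfold entryScale; nlinarith [mul_nonneg h2 (by linarith : 0 ≤ T)]
    _ ≤ entryScale φ T ^ 2 := le_self_pow₀ h.one_le_entryScale two_ne_zero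

lemma greenBound (h : Admissible N d z φ T) (hA : IsAdjMat N d A)
    (hG : ∀ i j, ‖greenM N d A z i j - if i = j then mSC z else 0‖ ≤ T * φ)
    (hT : ∀ x y, x ≠ y → |codegObs N d x y A| ≤ T * (100 * (qval N d)⁻¹)) :
    GreenBound N d z (entryScale φ T) (rowScale N z φ T) A := by
  have h1 := h.const_le
  have h2 := h.error_nonneg
  have h3 := h.one_le_mul_im
  have hη := h.im_pos
  refine ⟨fun a b => ?_, fun b => ?_, fun a b => ?_⟩
  · have hm : ‖(if a = b then mSC z else 0 : ℂ)‖ ≤ T := by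
      split_ifs
      · exact h.norm_mSC_le
      · simpa using (by linarith : 0 ≤ T)
    calc ‖greenM N d A z a b‖ = ‖(greenM N d A z a b - if a = b then mSC z else 0) +
          if a = b then mSC z else 0‖ := by rw [sub_add_cancel]
      _ ≤ T * φ + T := (norm_add_le _ _).trans (add_le_add (hG a b) hm)
      _ ≤ _ := by unfold entryScale; nlinarith [mul_nonneg h2 (by linarith : 0 ≤ T)]
  · rw [sum_norm_sq_greenM hA hη, h.rowScale_sq]
    have hb := (Complex.abs_im_le_norm _).trans (hG b b)
    simp only [if_true, Complex.sub_im] at hb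
    have him : (greenM N d A z b b).im ≤ T * (φ + (mSC z).im) := by
      have := (abs_le.1 hb).2
      nlinarith [mSC_im_nonneg hη]
    have hN : (N : ℝ) ≠ 0 := by
      have := h.two_le_deg.trans ((Nat.le_mul_of_pos_left d two_pos).trans h.two_mul_deg_le)
      exact_mod_cast (by lia : N ≠ 0)
    calc (greenM N d A z b b).im / z.im ≤ T * (φ + (mSC z).im) / z.im := by gcongr
      _ = _ := by field_simp
  · refine (abs_hCube_le_of_codegObs hA h.two_le_deg h.two_mul_deg_le (by linarith)
      h.mul_inv_qval_le hT a b).trans ?_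
    unfold entryScale
    nlinarith [mul_nonneg (sq_nonneg T) h2]

lemma selfScale_le (h : Admissible N d z φ T) :
    T * (200 * T * (entryScale φ T * rowScale N z φ T + (qval N d)⁻¹ * entryScale φ T ^ 3)) ≤
      T ^ 9 * ((1 + φ) ^ 3 * √((φ + (mSC z).im) / (N * z.im) + 1 / d)) := by
  have h1 := h.const_le
  have h2 := h.error_nonneg
  have hT : (1 : ℝ) ≤ T := by linarith
  have hd : (0 : ℝ) < d := by exact_mod_cast (by have := h.two_le_deg; lia : 0 < d)
  have hV := h.im_term_nonneg
  set V := (φ + (mSC z).im) / (N * z.im) with hVdef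
  set S := √(V + 1 / d) with hS
  have hS0 : 0 ≤ S := Real.sqrt_nonneg _
  have hS2 : S ^ 2 = V + 1 / d := Real.sq_sqrt (by positivity)
  have hψ : rowScale N z φ T ≤ T * S := by
    refine le_of_sq_le_sq ?_ (by positivity)
    rw [h.rowScale_sq, mul_pow, hS2]
    have : 0 ≤ 1 / (d : ℝ) := by positivity
    calc T * V ≤ T ^ 2 * V := by gcongr; exact le_self_pow₀ hT two_ne_zero
      _ ≤ _ := by gcongr; linarith
  have hq := qval_pos h.two_le_deg h.two_mul_deg_le
  have hκ : (qval N d)⁻¹ ≤ 2 * S := by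
    refine le_of_sq_le_sq ?_ (by positivity)
    have hle : (qval N d)⁻¹ ^ 2 ≤ 2 * (1 / d) := by
      rw [inv_pow, mul_one_div, inv_le_iff_one_le_mul₀ (by positivity), div_mul_eq_mul_div,
        le_div_iff₀ hd]
      linarith [le_two_mul_qval_sq h.two_le_deg h.two_mul_deg_le]
    have : 0 ≤ 1 / (d : ℝ) := by positivity
    rw [mul_pow, hS2]
    linarith
  have hΓ := h.one_le_entryScale
  have hφ : (1 + φ) ≤ (1 + φ) ^ 3 := le_self_pow₀ (by linarith) (by norm_num)
  calc T * (200 * T * (entryScale φ T * rowScale N z φ T + (qval N d)⁻¹ * entryScale φ T ^ 3))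
      ≤ T * (200 * T * (entryScale φ T * (T * S) + 2 * S * entryScale φ T ^ 3)) := by gcongr
    _ = 200 * (T ^ 5 * (1 + φ) + 2 * T ^ 8 * (1 + φ) ^ 3) * S := by unfold entryScale; ring
    _ ≤ 200 * (T ^ 8 * (1 + φ) ^ 3 + 2 * T ^ 8 * (1 + φ) ^ 3) * S := by
        gcongr
        norm_num
    _ = 600 * (T ^ 8 * ((1 + φ) ^ 3 * S)) := by ring
    _ ≤ T * (T ^ 8 * ((1 + φ) ^ 3 * S)) := by gcongr; linarith
    _ = _ := by ring

lemma inv_card_le (h : Admissible N d z φ T) : (N : ℝ)⁻¹ ≤ (qval N d)⁻¹ := by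
  have := inv_qval_le_one h.two_le_deg h.two_mul_deg_le
  have hq := inv_pos.2 (qval_pos h.two_le_deg h.two_mul_deg_le)
  refine (inv_le_inv_qval_sq h.two_le_deg h.two_mul_deg_le).trans ?_
  nlinarith

end Admissible

lemma eventually_admissible {τ δ a : ℝ} (hτ : 0 < τ) (hδ : 0 < δ) (ha : 0 < a) (haτ : 8 * a ≤ τ)
    {d : ℕ → ℕ} {z : ℕ → ℂ} {φ : ℕ → ℝ}
    (hd : ∀ᶠ N : ℕ in atTop, (N : ℝ) ^ τ ≤ d N) (hdN : ∀ᶠ N in atTop, 2 * d N ≤ N)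
    (hre : ∀ᶠ N in atTop, |(z N).re| ≤ δ⁻¹)
    (him : ∀ᶠ N : ℕ in atTop, (N : ℝ) ^ (-1 + δ : ℝ) ≤ (z N).im)
    (him' : ∀ᶠ N in atTop, (z N).im ≤ δ⁻¹) (hφ : ∀ᶠ N in atTop, 0 ≤ φ N) :
    ∀ᶠ N : ℕ in atTop, Admissible N (d N) (z N) (φ N) ((N : ℝ) ^ a) := by
  have hgrow : ∀ {s : ℝ}, 0 < s → ∀ C : ℝ, ∀ᶠ N : ℕ in atTop, C ≤ (N : ℝ) ^ s := fun hs C =>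
    ((tendsto_rpow_atTop hs).comp tendsto_natCast_atTop_atTop).eventually_ge_atTop C
  have hs : 0 < a / 2 := by positivity
  filter_upwards [hd, hdN, hre, him, him', hφ, hgrow hτ 2, hgrow ha 41000, hgrow ha (2 * δ⁻¹),
    hgrow one_pos (2 * δ⁻¹), eventually_ge_atTop 1,
    hgrow hs (2 * ((1 + 2 * (2 + δ⁻¹)) ^ (a / 2) / (a / 2)))]
    with N hd hdN hre him him' hφ hd2 hT hTδ hNδ hN hlog
  have hN' : (1 : ℝ) ≤ N := by exact_mod_cast hN
  have hδ' : 0 < δ⁻¹ := inv_pos.2 hδ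
  have hN0 : (0 : ℝ) < N := by linarith
  have hη : 0 < (z N).im := lt_of_lt_of_le (by positivity) him
  have hNη : 1 ≤ (N : ℝ) * (z N).im := by
    calc (1 : ℝ) ≤ (N : ℝ) ^ δ := Real.one_le_rpow hN' hδ.le
      _ = N * (N : ℝ) ^ (-1 + δ : ℝ) := by
        rw [← Real.rpow_one_add' hN0.le (by simpa using hδ.ne')]; ring_nf
      _ ≤ _ := by gcongr
  have hz : ‖z N‖ ≤ 2 * δ⁻¹ := by
    have := Complex.norm_le_abs_re_add_abs_im (z N)
    rw [abs_of_pos hη] at this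
    linarith
  have hd2' : 2 ≤ d N := by exact_mod_cast hd2.trans hd
  have hq := qval_pos hd2' hdN
  rw [Real.rpow_one] at hNδ
  refine ⟨hd2', hdN, hη, hNη, hz.trans hNδ, hz.trans hTδ, hT, ?_, ?_, hφ⟩
  · refine (norm_mSC_le hη).trans ?_
    have hη' : ((2 + |(z N).re|) / (z N).im) ≤ (2 + δ⁻¹) * N := by
      rw [div_le_iff₀ hη, mul_assoc]
      nlinarith [abs_nonneg (z N).re]
    have hx : 1 + 2 * ((2 + |(z N).re|) / (z N).im) ≤ (1 + 2 * (2 + δ⁻¹)) * N := by linarith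
    have hx0 : 0 ≤ 1 + 2 * ((2 + |(z N).re|) / (z N).im) := by positivity
    calc 2 * Real.log (1 + 2 * ((2 + |(z N).re|) / (z N).im))
        ≤ 2 * ((1 + 2 * ((2 + |(z N).re|) / (z N).im)) ^ (a / 2) / (a / 2)) := by
          gcongr; exact Real.log_le_rpow_div hx0 hs
      _ ≤ 2 * (((1 + 2 * (2 + δ⁻¹)) * N) ^ (a / 2) / (a / 2)) := by gcongr
      _ = 2 * ((1 + 2 * (2 + δ⁻¹)) ^ (a / 2) / (a / 2)) * (N : ℝ) ^ (a / 2) := by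
          rw [Real.mul_rpow (by positivity) hN0.le]; ring
      _ ≤ (N : ℝ) ^ (a / 2) * (N : ℝ) ^ (a / 2) := by gcongr
      _ = _ := by rw [← Real.rpow_add hN0]; ring_nf
  · rw [mul_inv_le_iff₀ hq, one_mul]
    refine le_of_sq_le_sq ?_ hq.le
    set T := (N : ℝ) ^ a
    have h8 : T ^ 8 ≤ (N : ℝ) ^ τ := by
      rw [← Real.rpow_natCast, ← Real.rpow_mul hN0.le]
      exact Real.rpow_le_rpow_of_exponent_le hN' (by push_cast; linarith)
    have h3 : T ^ 3 ≤ T ^ 8 := pow_le_pow_right₀ (by linarith) (by norm_num)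
    have := le_two_mul_qval_sq hd2' hdN
    nlinarith [sq_nonneg T]

/-- Self-consistent equation for the entries of the Green function: bootstrap step. -/
theorem entrywise_self_consistent_equation
    (τ δ ν : ℝ) (hτ : 0 < τ) (hδ : 0 < δ) (hδτ : δ < τ / 10) (hν : 0 < ν) (hνδ : ν < δ / 10)
    (d : ℕ → ℕ) (z : ℕ → ℂ) (φ : ℕ → ℝ)
    (hreg : ∀ᶠ N : ℕ in atTop,
      (N : ℝ) ^ τ ≤ (d N : ℝ) ∧ 2 * d N ≤ N ∧ Even (d N * N) ∧
      |(z N).re| ≤ δ⁻¹ ∧ (N : ℝ) ^ (-1 + δ : ℝ) ≤ (z N).im ∧ (z N).im ≤ δ⁻¹ ∧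
      (N : ℝ)⁻¹ ≤ φ N ∧ φ N ≤ (N : ℝ) ^ ν)
    (hin : ∀ ε > (0 : ℝ), ∀ D > (0 : ℝ), ∃ N₀ : ℕ, ∀ N, N₀ ≤ N →
      PrReg N (d N) (fun A => ∃ i j : Fin N,
        (N : ℝ) ^ ε * φ N ≤
          ‖(greenM N (d N) A (z N) i j - if i = j then mSC (z N) else 0 : ℂ)‖) ≤
        (N : ℝ) ^ (-D)) :
    ∀ ε > (0 : ℝ), ∀ D > (0 : ℝ), ∃ N₀ : ℕ, ∀ N, N₀ ≤ N →
      PrReg N (d N) (fun A => ∃ i j : Fin N,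
        (N : ℝ) ^ ε * ((1 + φ N) ^ 3 *
            Real.sqrt ((φ N + (mSC (z N)).im) / ((N : ℝ) * (z N).im) + 1 / (d N : ℝ))) ≤
          ‖((if i = j then 1 else 0) + z N * greenM N (d N) A (z N) i j +
            gbar N (d N) A (z N) * greenM N (d N) A (z N) i j : ℂ)‖) ≤
        (N : ℝ) ^ (-D) := by
  intro ε hε
  obtain ⟨a, ha, haτ, haε⟩ : ∃ a : ℝ, 0 < a ∧ 8 * a ≤ τ ∧ a * 9 ≤ ε :=
    ⟨min (ε / 9) (τ / 8), by positivity, by linarith [min_le_right (ε / 9) (τ / 8)],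
      by linarith [min_le_left (ε / 9) (τ / 8)]⟩
  have hadm : ∀ᶠ N : ℕ in atTop, Admissible N (d N) (z N) (φ N) ((N : ℝ) ^ a) :=
    eventually_admissible hτ hδ ha haτ (hreg.mono fun N h => h.1) (hreg.mono fun N h => h.2.1)
      (hreg.mono fun N h => h.2.2.2.1) (hreg.mono fun N h => h.2.2.2.2.1)
      (hreg.mono fun N h => h.2.2.2.2.2.1)
      (hreg.mono fun N h => (inv_nonneg.2 N.cast_nonneg).trans h.2.2.2.2.2.2.1)
  have hentry : Rare d fun N A => ∃ i j : Fin N, (N : ℝ) ^ a * φ N ≤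
      ‖(greenM N (d N) A (z N) i j - if i = j then mSC (z N) else 0 : ℂ)‖ := fun D hD =>
    eventually_atTop.2 (hin a ha D hD)
  have hcodeg : Rare d fun N A => ∃ p : {p : Fin N × Fin N // p.1 ≠ p.2},
      (N : ℝ) ^ a * (100 * (qval N (d N))⁻¹) ≤ ‖(codegObs N (d N) p.1.1 p.1.2 A : ℂ)‖ := by
    refine rare_of_switchBound (ι := fun N => {p : Fin N × Fin N // p.1 ≠ p.2}) (fun N => ?_)
      (fun N p => p.1.1) (good := fun _ _ _ => True)
      (Z := fun N p A => (codegObs N (d N) p.1.1 p.1.2 A : ℂ))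
      (E := fun N => 100 * (qval N (d N))⁻¹)
      (hadm.mono fun N h => ⟨?_, fun p =>
        ⟨_, _, _, _, _, codeg_switchBound h.two_le_deg h.two_mul_deg_le p.2⟩⟩) ?_ ha
    · exact (Fintype.card_subtype_le _).trans (by simp [sq])
    · have := inv_pos.2 (qval_pos h.two_le_deg h.two_mul_deg_le)
      linarith [h.inv_card_le]
    · intro D _
      refine Eventually.of_forall fun N => ?_
      simp only [not_true_eq_false, exists_false]
      simp only [PrReg, and_false, Nat.card_of_isEmpty, Nat.cast_zero, zero_div]
      positivity
  have hgreen : Rare d fun N A => ¬GreenBound N (d N) (z N) (entryScale (φ N) ((N : ℝ) ^ a))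
      (rowScale N (z N) (φ N) ((N : ℝ) ^ a)) A := by
    refine (hentry.or hcodeg).mono (hadm.mono fun N h A hA hbad => ?_)
    contrapose! hbad
    refine h.greenBound hA (fun i j => (hbad.1 i j).le) fun x y hxy => ?_
    simpa using (hbad.2 ⟨(x, y), hxy⟩).le
  have hdiag : Rare d fun N A => ∃ i : Fin N, (N : ℝ) ^ a * (100 * (rowScale N (z N) (φ N)
      ((N : ℝ) ^ a) + (qval N (d N))⁻¹ * entryScale (φ N) ((N : ℝ) ^ a) ^ 2)) ≤
        ‖diagObs N (d N) (z N) i A‖ := by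
    refine rare_of_switchBound (ι := Fin) (fun N => ?_) (fun N i => i)
      (Z := fun N i => diagObs N (d N) (z N) i)
      (E := fun N => 100 * (rowScale N (z N) (φ N) ((N : ℝ) ^ a) +
        (qval N (d N))⁻¹ * entryScale (φ N) ((N : ℝ) ^ a) ^ 2)) (hadm.mono fun N h => ⟨?_, fun i =>
      ⟨_, _, _, _, _, diag_switchBound h.two_le_deg h.two_mul_deg_le h.im_pos h.one_le_mul_im
        h.one_le_entryScale (Real.sqrt_nonneg _) h.rowScale_le_entryScale i⟩⟩)
      (hgreen.mono (Eventually.of_forall fun N A _ ⟨_, h⟩ => h)) ha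
    · simpa using Nat.le_self_pow two_ne_zero N
    · have hκ := inv_pos.2 (qval_pos h.two_le_deg h.two_mul_deg_le)
      have hψ : 0 ≤ rowScale N (z N) (φ N) ((N : ℝ) ^ a) := Real.sqrt_nonneg _
      have := le_mul_of_one_le_right hκ.le (one_le_pow₀ h.one_le_entryScale (n := 2))
      linarith [h.inv_card_le]
  have hself : Rare d fun N A => ∃ p : Fin N × Fin N, (N : ℝ) ^ a * (200 * (N : ℝ) ^ a *
      (entryScale (φ N) ((N : ℝ) ^ a) * rowScale N (z N) (φ N) ((N : ℝ) ^ a) +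
        (qval N (d N))⁻¹ * entryScale (φ N) ((N : ℝ) ^ a) ^ 3)) ≤
          ‖selfObs N (d N) (z N) p.1 p.2 A‖ := by
    refine rare_of_switchBound (ι := fun N => Fin N × Fin N) (fun N => ?_) (fun N p => p.1)
      (Z := fun N p => selfObs N (d N) (z N) p.1 p.2)
      (E := fun N => 200 * (N : ℝ) ^ a *
        (entryScale (φ N) ((N : ℝ) ^ a) * rowScale N (z N) (φ N) ((N : ℝ) ^ a) +
          (qval N (d N))⁻¹ * entryScale (φ N) ((N : ℝ) ^ a) ^ 3)) (hadm.mono fun N h => ⟨?_, fun p =>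
      ⟨_, _, _, _, _, self_switchBound h.two_le_deg h.two_mul_deg_le h.im_pos h.one_le_mul_im
        h.norm_le_card (h.norm_le.trans h.le_entryScale) h.one_le_entryScale (Real.sqrt_nonneg _)
        h.rowScale_le_entryScale (by linarith [h.const_le]) p.1 p.2⟩⟩)
      ((hgreen.or hdiag).mono (Eventually.of_forall fun N A _ hbad => ?_)) ha
    · simp [sq]
    · have hκ := inv_pos.2 (qval_pos h.two_le_deg h.two_mul_deg_le)
      have hψ : 0 ≤ entryScale (φ N) ((N : ℝ) ^ a) * rowScale N (z N) (φ N) ((N : ℝ) ^ a) :=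
        mul_nonneg (by linarith [h.one_le_entryScale]) (Real.sqrt_nonneg _)
      have := le_mul_of_one_le_right hκ.le (one_le_pow₀ h.one_le_entryScale (n := 3))
      nlinarith [h.inv_card_le, h.const_le]
    · contrapose! hbad
      exact fun p => ⟨hbad.1, (hbad.2 p.1).le⟩
  have hfinal : Rare d fun N A => ∃ i j : Fin N, (N : ℝ) ^ ε * ((1 + φ N) ^ 3 *
      Real.sqrt ((φ N + (mSC (z N)).im) / ((N : ℝ) * (z N).im) + 1 / (d N : ℝ))) ≤
        ‖selfObs N (d N) (z N) i j A‖ := by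
    refine hself.mono ?_
    filter_upwards [hadm, eventually_ge_atTop 1] with N h hN A _ ⟨i, j, hij⟩
    refine ⟨(i, j), h.selfScale_le.trans (le_trans ?_ hij)⟩
    have hφ := h.error_nonneg
    refine mul_le_mul_of_nonneg_right ?_ (by positivity)
    rw [← Real.rpow_natCast, ← Real.rpow_mul N.cast_nonneg]
    exact Real.rpow_le_rpow_of_exponent_le (by exact_mod_cast hN) (by exact_mod_cast haε)
  exact fun D hD => eventually_atTop.1 (hfinal D hD)

end
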